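/- For every constant vertex mapping the number of planar graphs drawable with few bends is an exponentially small fraction of all planar graphs: there exist a constant c > 0 and N such that for all n ≥ N and every injective map π : Fin n → ℝ², the number of planar simple graphs G on vertex set Fin n that admit a polyline drawing with vertex mapping π having total number of bends less than c·n² is at most 2^{−n} times the total number of planar simple graphs on vertex set Fin n. (Equivalently, a uniformly random planar graph on n labeled vertices requires at least c·n² bends in every polyline drawing with vertex mapping π, with probability at least 1 − 2^{−n}.) -/

import Mathlib

open Finset
open scoped Classical

noncomputable section

/-- The polyline traced by a list of points: the union of the closed segments
between consecutive points. -/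
def polylineOf (pts : List (ℝ × ℝ)) : Set (ℝ × ℝ) :=
  ⋃ p ∈ pts.zip pts.tail, segment ℝ p.1 p.2

/-- The curve drawn for the edge `{u, v}`: the polyline through
`π u`, the bend points assigned to `(u, v)`, and `π v`. -/
def edgeCurve {n : ℕ} (π : Fin n → ℝ × ℝ) (bends : Fin n → Fin n → List (ℝ × ℝ))
    (u v : Fin n) : Set (ℝ × ℝ) :=
  polylineOf (π u :: (bends u v ++ [π v]))

/-- `bends` is a polyline drawing of `G` with vertex mapping `π`:
each edge `{u,v}` of `G` is assigned the finite sequence of bend points `bends u v`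
(recorded consistently in both directions); the polyline of every edge is a simple
arc from `π u` to `π v`; the polylines of two distinct edges intersect exactly in
the images under `π` of the shared endpoints; and no polyline passes through the
image of a vertex that is not an endpoint of its edge. -/
structure IsPolylineDrawing {n : ℕ} (G : SimpleGraph (Fin n)) (π : Fin n → ℝ × ℝ)
    (bends : Fin n → Fin n → List (ℝ × ℝ)) : Prop where
  symm : ∀ u v : Fin n, bends v u = (bends u v).reverse
  arc : ∀ u v : Fin n, G.Adj u v → ∃ γ : ℝ → ℝ × ℝ,
    ContinuousOn γ (Set.Icc 0 1) ∧ Set.InjOn γ (Set.Icc 0 1) ∧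
    γ 0 = π u ∧ γ 1 = π v ∧ γ '' Set.Icc 0 1 = edgeCurve π bends u v
  inter : ∀ u v x y : Fin n, G.Adj u v → G.Adj x y → s(u, v) ≠ s(x, y) →
    edgeCurve π bends u v ∩ edgeCurve π bends x y =
      π '' (({u, v} : Set (Fin n)) ∩ ({x, y} : Set (Fin n)))
  noVertex : ∀ u v w : Fin n, G.Adj u v → w ≠ u → w ≠ v →
    π w ∉ edgeCurve π bends u v

/-- The total number of bends of a drawing: the sum over all edges of the number
of bend points of that edge (each unordered edge is counted once, hence the
division by 2 of the sum over ordered pairs). -/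
def totalBends {n : ℕ} (G : SimpleGraph (Fin n))
    (bends : Fin n → Fin n → List (ℝ × ℝ)) : ℝ :=
  (∑ u : Fin n, ∑ v : Fin n,
    if G.Adj u v then ((bends u v).length : ℝ) else 0) / 2

/-- A simple graph is planar if it admits a polyline drawing with respect to some
injective vertex mapping into `ℝ²`. -/
def IsPlanarGraph {n : ℕ} (G : SimpleGraph (Fin n)) : Prop :=
  ∃ (π : Fin n → ℝ × ℝ) (bends : Fin n → Fin n → List (ℝ × ℝ)),
    Function.Injective π ∧ IsPolylineDrawing G π bends

/-- The height at abscissa `x` of the line through `a` and `b`. -/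
def lineHeight (a b : ℝ × ℝ) (x : ℝ) : ℝ := a.2 + (x - a.1) * ((b.2 - a.2) / (b.1 - a.1))

theorem lineHeight_left (a b : ℝ × ℝ) : lineHeight a b a.1 = a.2 := by simp [lineHeight]

theorem lineHeight_right {a b : ℝ × ℝ} (h : a.1 ≠ b.1) : lineHeight a b b.1 = b.2 := by
  have : b.1 - a.1 ≠ 0 := sub_ne_zero.2 h.symm
  simp only [lineHeight]; field_simp; ring

theorem lineHeight_comm {a b : ℝ × ℝ} (h : a.1 ≠ b.1) (x : ℝ) :
    lineHeight a b x = lineHeight b a x := by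
  have h1 : b.1 - a.1 ≠ 0 := sub_ne_zero.2 h.symm
  have h2 : a.1 - b.1 ≠ 0 := sub_ne_zero.2 h
  simp only [lineHeight]; field_simp; ring

theorem lineHeight_continuous (a b : ℝ × ℝ) : Continuous (lineHeight a b) := by
  unfold lineHeight; fun_prop

theorem lineHeight_combo (a b : ℝ × ℝ) (x y s t : ℝ) (h : s + t = 1) :
    lineHeight a b (s * x + t * y) = s * lineHeight a b x + t * lineHeight a b y := by
  obtain rfl : t = 1 - s := by linarith
  simp only [lineHeight]; ring

theorem mem_segment_iff_lineHeight {a b : ℝ × ℝ} (h : a.1 < b.1) (z : ℝ × ℝ) :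
    z ∈ segment ℝ a b ↔ a.1 ≤ z.1 ∧ z.1 ≤ b.1 ∧ z.2 = lineHeight a b z.1 := by
  have h1 : b.1 - a.1 > 0 := sub_pos.2 h
  rw [segment_eq_image']
  constructor
  · rintro ⟨t, ⟨h0, h2⟩, rfl⟩
    simp only [lineHeight, Prod.fst_add, Prod.smul_fst, Prod.fst_sub, Prod.snd_add, Prod.smul_snd,
      Prod.snd_sub, smul_eq_mul]
    refine ⟨by nlinarith, by nlinarith, ?_⟩
    field_simp; ring
  · rintro ⟨h2, h3, h4⟩
    refine ⟨(z.1 - a.1) / (b.1 - a.1), ⟨div_nonneg (by linarith) h1.le,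
      (div_le_one h1).2 (by linarith)⟩, ?_⟩
    ext
    · simp; field_simp; ring
    · simp [h4, lineHeight]; field_simp

/-- Two lines whose order is different at `x` and `y` cross in between. -/
theorem exists_lineHeight_eq {a b c d : ℝ × ℝ} {x y : ℝ}
    (hx : lineHeight a b x ≤ lineHeight c d x) (hy : lineHeight c d y ≤ lineHeight a b y) :
    ∃ w, min x y ≤ w ∧ w ≤ max x y ∧ lineHeight a b w = lineHeight c d w := by
  have hc : ContinuousOn (fun w => lineHeight c d w - lineHeight a b w) (Set.uIcc x y) :=
    ((lineHeight_continuous c d).sub (lineHeight_continuous a b)).continuousOn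
  have h0 : (0 : ℝ) ∈ Set.uIcc (lineHeight c d x - lineHeight a b x)
      (lineHeight c d y - lineHeight a b y) := by
    rw [Set.mem_uIcc]; right; constructor <;> linarith
  obtain ⟨w, hw, hw0⟩ := intermediate_value_uIcc hc h0
  rw [Set.uIcc] at hw
  exact ⟨w, hw.1, hw.2, by simp only at hw0; linarith⟩

/-- Whether the vertical upward ray from `v` meets the segment from `a` to `b`, modulo two. -/
def rayParity (v a b : ℝ × ℝ) : ZMod 2 :=
  if (a.1 < v.1 ∧ v.1 < b.1 ∨ b.1 < v.1 ∧ v.1 < a.1) ∧ v.2 < lineHeight a b v.1 then 1 else 0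

/-- Whether `u` is strictly to the left of `v`, modulo two. -/
def leftParity (u v : ℝ × ℝ) : ZMod 2 := if u.1 < v.1 then 1 else 0

theorem rayParity_comm (v a b : ℝ × ℝ) : rayParity v a b = rayParity v b a := by
  unfold rayParity
  by_cases h : a.1 = b.1
  · rw [if_neg, if_neg]
    · rintro ⟨h1 | h1, -⟩ <;> linarith
    · rintro ⟨h1 | h1, -⟩ <;> linarith
  · rw [lineHeight_comm h]; simp only [or_comm]

theorem rayParity_self (v a : ℝ × ℝ) : rayParity v a a = 0 := by
  unfold rayParity
  rw [if_neg]; rintro ⟨h1 | h1, -⟩ <;> linarith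

theorem leftParity_swap {u v : ℝ × ℝ} (h : u.1 ≠ v.1) : leftParity v u = 1 + leftParity u v := by
  unfold leftParity
  rcases lt_or_gt_of_ne h with h | h
  · rw [if_neg (by linarith), if_pos h]; decide
  · rw [if_pos h, if_neg (by linarith)]; decide

theorem zmod2_add_self (x : ZMod 2) : x + x = 0 := CharTwo.add_self_eq_zero x

theorem not_cross_of_disjoint {a b c d : ℝ × ℝ} (hab : a.1 < b.1) (hcd : c.1 < d.1)
    (hd : Disjoint (segment ℝ a b) (segment ℝ c d)) {x y : ℝ}
    (hx1 : a.1 ≤ x) (hx2 : x ≤ b.1) (hx3 : c.1 ≤ x) (hx4 : x ≤ d.1)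
    (hy1 : a.1 ≤ y) (hy2 : y ≤ b.1) (hy3 : c.1 ≤ y) (hy4 : y ≤ d.1) :
    lineHeight a b x < lineHeight c d x ↔ lineHeight a b y < lineHeight c d y := by
  have key : ∀ x y, a.1 ≤ x → x ≤ b.1 → c.1 ≤ x → x ≤ d.1 → a.1 ≤ y → y ≤ b.1 → c.1 ≤ y →
      y ≤ d.1 → lineHeight a b x < lineHeight c d x → lineHeight a b y < lineHeight c d y := by
    intro x y hx1 hx2 hx3 hx4 hy1 hy2 hy3 hy4 h
    by_contra hlt
    obtain ⟨w, hw1, hw2, hw⟩ := exists_lineHeight_eq h.le (not_lt.1 hlt)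
    have e1 : a.1 ≤ w := le_trans (le_min hx1 hy1) hw1
    have e2 : w ≤ b.1 := le_trans hw2 (max_le hx2 hy2)
    have e3 : c.1 ≤ w := le_trans (le_min hx3 hy3) hw1
    have e4 : w ≤ d.1 := le_trans hw2 (max_le hx4 hy4)
    exact Set.disjoint_left.1 hd ((mem_segment_iff_lineHeight hab (w, lineHeight a b w)).2
      ⟨e1, e2, rfl⟩) ((mem_segment_iff_lineHeight hcd _).2 ⟨e3, e4, hw⟩)
  exact ⟨key x y hx1 hx2 hx3 hx4 hy1 hy2 hy3 hy4, key y x hy1 hy2 hy3 hy4 hx1 hx2 hx3 hx4⟩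

theorem ne_lineHeight_of_disjoint {a b c d : ℝ × ℝ} (hab : a.1 < b.1) (hcd : c.1 < d.1)
    (hd : Disjoint (segment ℝ a b) (segment ℝ c d)) {x : ℝ}
    (hx1 : a.1 ≤ x) (hx2 : x ≤ b.1) (hx3 : c.1 ≤ x) (hx4 : x ≤ d.1) :
    lineHeight a b x ≠ lineHeight c d x := fun h =>
  Set.disjoint_left.1 hd ((mem_segment_iff_lineHeight hab (x, lineHeight a b x)).2
      ⟨hx1, hx2, rfl⟩) ((mem_segment_iff_lineHeight hcd _).2 ⟨hx3, hx4, h⟩)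

theorem segment_parity_aux {a b c d : ℝ × ℝ} (hab : a.1 < b.1) (hcd : c.1 < d.1)
    (h1 : a.1 < c.1) (h3 : b.1 ≠ c.1) (h4 : b.1 ≠ d.1)
    (hd : Disjoint (segment ℝ a b) (segment ℝ c d)) :
    rayParity a c d + rayParity b c d + rayParity c a b + rayParity d a b =
      leftParity a c + leftParity a d + leftParity b c + leftParity b d := by
  have hac : rayParity a c d = 0 := by
    unfold rayParity; rw [if_neg]; rintro ⟨h | h, -⟩ <;> linarith
  have e1 : leftParity a c = 1 := by simp [leftParity, h1]
  have e2 : leftParity a d = 1 := by simp [leftParity, h1.trans hcd]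
  rw [hac, e1, e2]
  rcases lt_or_gt_of_ne h3 with h3 | h3
  · have e3 : leftParity b c = 1 := by simp [leftParity, h3]
    have e4 : leftParity b d = 1 := by simp [leftParity, h3.trans hcd]
    have f1 : rayParity b c d = 0 := by
      unfold rayParity; rw [if_neg]; rintro ⟨h | h, -⟩ <;> linarith
    have f2 : rayParity c a b = 0 := by
      unfold rayParity; rw [if_neg]; rintro ⟨h | h, -⟩ <;> linarith
    have f3 : rayParity d a b = 0 := by
      unfold rayParity; rw [if_neg]; rintro ⟨h | h, -⟩ <;> linarith
    rw [e3, e4, f1, f2, f3]; decide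
  · have e3 : leftParity b c = 0 := by simp [leftParity, h3.le]
    rcases lt_or_gt_of_ne h4 with h4 | h4
    · have e4 : leftParity b d = 1 := by simp [leftParity, h4]
      have f3 : rayParity d a b = 0 := by
        unfold rayParity; rw [if_neg]; rintro ⟨h | h, -⟩ <;> linarith
      have hiff := not_cross_of_disjoint hab hcd hd (x := c.1) (y := b.1) h1.le h3.le le_rfl
        hcd.le hab.le le_rfl h3.le h4.le
      rw [lineHeight_left, lineHeight_right hab.ne] at hiff
      have hne := ne_lineHeight_of_disjoint hab hcd hd (x := c.1) h1.le h3.le le_rfl hcd.le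
      rw [lineHeight_left] at hne
      rw [e3, e4, f3]
      by_cases hc : lineHeight a b c.1 < c.2
      · have f1 : rayParity b c d = 1 := by
          unfold rayParity; rw [if_pos]; exact ⟨Or.inl ⟨h3, h4⟩, hiff.1 hc⟩
        have f2 : rayParity c a b = 0 := by
          unfold rayParity; rw [if_neg]; rintro ⟨-, h⟩; linarith
        rw [f1, f2]; decide
      · have f1 : rayParity b c d = 0 := by
          unfold rayParity; rw [if_neg]; rintro ⟨-, h⟩; exact hc (hiff.2 h)
        have f2 : rayParity c a b = 1 := by
          unfold rayParity; rw [if_pos]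
          exact ⟨Or.inl ⟨h1, h3⟩, lt_of_le_of_ne (not_lt.1 hc) (Ne.symm hne)⟩
        rw [f1, f2]; decide
    · have e4 : leftParity b d = 0 := by simp [leftParity, h4.le]
      have f1 : rayParity b c d = 0 := by
        unfold rayParity; rw [if_neg]; rintro ⟨h | h, -⟩ <;> linarith
      have hiff := not_cross_of_disjoint hab hcd hd (x := c.1) (y := d.1) h1.le h3.le le_rfl
        hcd.le (h1.trans hcd).le h4.le hcd.le le_rfl
      have hne := ne_lineHeight_of_disjoint hab hcd hd (x := c.1) h1.le h3.le le_rfl hcd.le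
      have hne' := ne_lineHeight_of_disjoint hab hcd hd (x := d.1) (h1.trans hcd).le h4.le
        hcd.le le_rfl
      rw [lineHeight_left] at hiff hne
      rw [lineHeight_right hcd.ne] at hiff hne'
      have f2 : rayParity c a b = rayParity d a b := by
        unfold rayParity
        refine if_congr ?_ rfl rfl
        constructor
        · rintro ⟨-, h⟩
          refine ⟨Or.inl ⟨h1.trans hcd, h4⟩, lt_of_le_of_ne (not_lt.1 fun h' => ?_) hne'.symm⟩
          have := hiff.2 h'; linarith
        · rintro ⟨-, h⟩
          refine ⟨Or.inl ⟨h1, h3⟩, lt_of_le_of_ne (not_lt.1 fun h' => ?_) hne.symm⟩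
          have := hiff.1 h'; linarith
      rw [e3, e4, f1, f2, zero_add, zero_add, zmod2_add_self]; decide

theorem segment_parity_of_lt {a b c d : ℝ × ℝ} (hab : a.1 < b.1) (hcd : c.1 < d.1)
    (h1 : a.1 ≠ c.1) (h2 : a.1 ≠ d.1) (h3 : b.1 ≠ c.1) (h4 : b.1 ≠ d.1)
    (hd : Disjoint (segment ℝ a b) (segment ℝ c d)) :
    rayParity a c d + rayParity b c d + rayParity c a b + rayParity d a b =
      leftParity a c + leftParity a d + leftParity b c + leftParity b d := by
  rcases lt_or_gt_of_ne h1 with h | h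
  · exact segment_parity_aux hab hcd h h3 h4 hd
  · have := segment_parity_aux hcd hab h h2.symm h4.symm hd.symm
    rw [leftParity_swap h1, leftParity_swap h2, leftParity_swap h3, leftParity_swap h4] at this
    have h2 : (2 : ZMod 2) = 0 := by decide
    linear_combination this + 2 * h2

theorem segment_parity {a b c d : ℝ × ℝ} (hab : a = b ∨ a.1 ≠ b.1) (hcd : c = d ∨ c.1 ≠ d.1)
    (h1 : a.1 ≠ c.1) (h2 : a.1 ≠ d.1) (h3 : b.1 ≠ c.1) (h4 : b.1 ≠ d.1)
    (hd : Disjoint (segment ℝ a b) (segment ℝ c d)) :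
    rayParity a c d + rayParity b c d + rayParity c a b + rayParity d a b =
      leftParity a c + leftParity a d + leftParity b c + leftParity b d := by
  have h20 : (2 : ZMod 2) = 0 := by decide
  rcases hab with rfl | hab
  · simp only [rayParity_self]
    linear_combination (rayParity a c d - leftParity a c - leftParity a d) * h20
  rcases hcd with rfl | hcd
  · simp only [rayParity_self]
    linear_combination (rayParity c a b - leftParity a c - leftParity b c) * h20
  rcases lt_or_gt_of_ne hab with hab | hab <;> rcases lt_or_gt_of_ne hcd with hcd | hcd
  · exact segment_parity_of_lt hab hcd h1 h2 h3 h4 hd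
  · have := segment_parity_of_lt hab hcd h2 h1 h4 h3 (by rwa [segment_symm ℝ d c])
    rw [rayParity_comm a c d, rayParity_comm b c d]; linear_combination this
  · have := segment_parity_of_lt hab hcd h3 h4 h1 h2 (by rwa [segment_symm ℝ b a])
    rw [rayParity_comm c a b, rayParity_comm d a b]; linear_combination this
  · have := segment_parity_of_lt hab hcd h4 h3 h2 h1
      (by rwa [segment_symm ℝ b a, segment_symm ℝ d c])
    rw [rayParity_comm c a b, rayParity_comm d a b, rayParity_comm a c d, rayParity_comm b c d]
    linear_combination this

/-! ### Polylines as lists of points -/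

theorem polylineOf_nil : polylineOf [] = ∅ := by simp [polylineOf]

theorem polylineOf_singleton (a : ℝ × ℝ) : polylineOf [a] = ∅ := by simp [polylineOf]

theorem polylineOf_cons_cons (a b : ℝ × ℝ) (l : List (ℝ × ℝ)) :
    polylineOf (a :: b :: l) = segment ℝ a b ∪ polylineOf (b :: l) := by
  simp [polylineOf]

theorem polylineOf_append (l m : List (ℝ × ℝ)) (a : ℝ × ℝ) :
    polylineOf (l ++ a :: m) = polylineOf (l ++ [a]) ∪ polylineOf (a :: m) := by
  induction l with
  | nil => simp [polylineOf_singleton]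
  | cons b l ih =>
    cases l with
    | nil => simp [polylineOf_cons_cons, polylineOf_singleton]
    | cons d l =>
      simp only [List.cons_append, polylineOf_cons_cons] at ih ⊢
      rw [ih, Set.union_assoc]

theorem mem_polylineOf_of_mem {l : List (ℝ × ℝ)} {z : ℝ × ℝ} (hz : z ∈ l) (hl : 2 ≤ l.length) :
    z ∈ polylineOf l := by
  induction l with
  | nil => simp at hz
  | cons a l ih =>
    cases l with
    | nil => simp at hl
    | cons b l =>
      rw [polylineOf_cons_cons]
      rcases List.mem_cons.1 hz with rfl | hz
      · exact Or.inl (left_mem_segment ℝ _ _)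
      · cases l with
        | nil => simp at hz; subst hz; exact Or.inl (right_mem_segment ℝ _ _)
        | cons d l => exact Or.inr (ih hz (by simp))

theorem polylineOf_map (f : (ℝ × ℝ) →ₗ[ℝ] (ℝ × ℝ)) (l : List (ℝ × ℝ)) :
    polylineOf (l.map f) = f '' polylineOf l := by
  induction l with
  | nil => simp [polylineOf_nil]
  | cons a l ih =>
    cases l with
    | nil => simp [polylineOf_singleton]
    | cons b l =>
      simp only [List.map_cons, polylineOf_cons_cons, Set.image_union] at ih ⊢
      rw [ih]
      congr 1
      exact (image_segment ℝ f.toAffineMap a b).symm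

/-- Sum of the ray parities of a point against the consecutive segments of a list. -/
def rayPath (v : ℝ × ℝ) : List (ℝ × ℝ) → ZMod 2
  | a :: b :: l => rayParity v a b + rayPath v (b :: l)
  | _ => 0

theorem segment_rayPath {a b : ℝ × ℝ} {M : List (ℝ × ℝ)} {c d : ℝ × ℝ} {S : Set (ℝ × ℝ)}
    (hS : Set.InjOn Prod.fst S) (ha : a ∈ S) (hb : b ∈ S) (hM : ∀ z ∈ c :: (M ++ [d]), z ∈ S)
    (hd : Disjoint (segment ℝ a b) (polylineOf (c :: (M ++ [d])))) :
    rayPath a (c :: (M ++ [d])) + rayPath b (c :: (M ++ [d])) + rayParity c a b + rayParity d a b =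
      leftParity a c + leftParity a d + leftParity b c + leftParity b d := by
  have key : ∀ p q, p ∈ S → q ∈ S → p ≠ q → p.1 ≠ q.1 := fun p q hp hq h h' => h (hS hp hq h')
  have key' : ∀ p q, p ∈ S → q ∈ S → (p = q ∨ p.1 ≠ q.1) := fun p q hp hq => by
    by_cases h : p = q
    · exact Or.inl h
    · exact Or.inr (key p q hp hq h)
  have one : ∀ c d, c ∈ S → d ∈ S → Disjoint (segment ℝ a b) (segment ℝ c d) →
      rayParity a c d + rayParity b c d + rayParity c a b + rayParity d a b =
      leftParity a c + leftParity a d + leftParity b c + leftParity b d := by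
    intro c d hc hd' hdis
    have aux : ∀ p ∈ segment ℝ a b, ∀ q ∈ segment ℝ c d, p ∈ S → q ∈ S → p.1 ≠ q.1 := by
      intro p hp q hq hpS hqS
      refine key p q hpS hqS ?_
      rintro rfl
      exact Set.disjoint_left.1 hdis hp hq
    exact segment_parity (key' a b ha hb) (key' c d hc hd')
      (aux _ (left_mem_segment ℝ _ _) _ (left_mem_segment ℝ _ _) ha hc)
      (aux _ (left_mem_segment ℝ _ _) _ (right_mem_segment ℝ _ _) ha hd')
      (aux _ (right_mem_segment ℝ _ _) _ (left_mem_segment ℝ _ _) hb hc)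
      (aux _ (right_mem_segment ℝ _ _) _ (right_mem_segment ℝ _ _) hb hd') hdis
  induction M generalizing c with
  | nil =>
    simp only [List.nil_append, polylineOf_cons_cons, polylineOf_singleton, Set.union_empty] at hd
    simpa [rayPath] using one c d (hM c (by simp)) (hM d (by simp)) hd
  | cons e M ih =>
    simp only [List.cons_append, polylineOf_cons_cons, Set.disjoint_union_right] at hd
    have h1 := one c e (hM c (by simp)) (hM e (by simp)) hd.1
    have h2 := ih (c := e) (fun z hz => hM z (List.mem_cons_of_mem _ hz)) hd.2
    have h20 : (2 : ZMod 2) = 0 := by decide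
    simp only [List.cons_append, rayPath]
    linear_combination h1 + h2 - (rayParity e a b - leftParity a e - leftParity b e) * h20

theorem rayPath_parity {a b : ℝ × ℝ} {L M : List (ℝ × ℝ)} {c d : ℝ × ℝ} {S : Set (ℝ × ℝ)}
    (hS : Set.InjOn Prod.fst S) (hL : ∀ z ∈ a :: (L ++ [b]), z ∈ S)
    (hM : ∀ z ∈ c :: (M ++ [d]), z ∈ S)
    (hd : Disjoint (polylineOf (a :: (L ++ [b]))) (polylineOf (c :: (M ++ [d])))) :
    rayPath a (c :: (M ++ [d])) + rayPath b (c :: (M ++ [d])) +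
      rayPath c (a :: (L ++ [b])) + rayPath d (a :: (L ++ [b])) =
      leftParity a c + leftParity a d + leftParity b c + leftParity b d := by
  induction L generalizing a with
  | nil =>
    simp only [List.nil_append, polylineOf_cons_cons, polylineOf_singleton, Set.union_empty] at hd
    simpa [rayPath] using segment_rayPath hS (hL a (by simp)) (hL b (by simp)) hM hd
  | cons e L ih =>
    simp only [List.cons_append, polylineOf_cons_cons, Set.disjoint_union_left] at hd
    have h1 := segment_rayPath hS (hL a (by simp)) (hL e (by simp)) hM hd.1
    have h2 := ih (a := e) (fun z hz => hL z (List.mem_cons_of_mem _ hz)) hd.2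
    have h20 : (2 : ZMod 2) = 0 := by decide
    simp only [List.cons_append, rayPath] at *
    linear_combination h1 + h2 -
      (rayPath e (c :: (M ++ [d])) - leftParity e c - leftParity e d) * h20

/-- The shear `(x, y) ↦ (x + t y, y)`. -/
def shear (t : ℝ) : (ℝ × ℝ) →ₗ[ℝ] (ℝ × ℝ) :=
  (LinearMap.fst ℝ ℝ ℝ + t • LinearMap.snd ℝ ℝ ℝ).prod (LinearMap.snd ℝ ℝ ℝ)

theorem shear_apply (t : ℝ) (z : ℝ × ℝ) : shear t z = (z.1 + t * z.2, z.2) := rfl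

theorem shear_injective (t : ℝ) : Function.Injective (shear t) := by
  intro a b h
  simp only [shear_apply, Prod.mk.injEq] at h
  obtain ⟨h1, h2⟩ := h
  rw [h2] at h1
  exact Prod.ext (by linarith) h2

theorem exists_shear_injOn {S : Set (ℝ × ℝ)} (hS : S.Finite) :
    ∃ t : ℝ, Set.InjOn Prod.fst (shear t '' S) := by
  have hfin : ((fun p : (ℝ × ℝ) × (ℝ × ℝ) => (p.2.1 - p.1.1) / (p.1.2 - p.2.2)) ''
      (S ×ˢ S)).Finite := (hS.prod hS).image _
  obtain ⟨t, ht⟩ := hfin.exists_notMem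
  refine ⟨t, ?_⟩
  rintro _ ⟨a, ha, rfl⟩ _ ⟨b, hb, rfl⟩ h
  simp only [shear_apply] at h
  by_cases h2 : a.2 = b.2
  · rw [h2] at h
    rw [shear_apply, shear_apply, h2]; simp; linarith
  · exfalso
    apply ht
    refine ⟨(a, b), ⟨ha, hb⟩, ?_⟩
    have : a.2 - b.2 ≠ 0 := sub_ne_zero.2 h2
    simp only
    rw [div_eq_iff this]; linarith

/-! ### Clique minors -/

/-- Any two vertices of `S` are joined by a path of `G` staying in `S`. -/
def ConnIn {W : Type*} (G : SimpleGraph W) (S : Set W) : Prop :=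
  ∀ u ∈ S, ∀ v ∈ S, Relation.ReflTransGen (fun a b => G.Adj a b ∧ b ∈ S) u v

/-- `G` has a `K_t` minor. -/
def HasCliqueMinor {W : Type*} (G : SimpleGraph W) (t : ℕ) : Prop :=
  ∃ B : Fin t → Set W, (∀ i, (B i).Nonempty) ∧ (∀ i, ConnIn G (B i)) ∧
    (∀ i j, i ≠ j → Disjoint (B i) (B j)) ∧
    (∀ i j, i ≠ j → ∃ u ∈ B i, ∃ v ∈ B j, G.Adj u v)

theorem exists_drawn_path {W : Type*} (c : W → ℝ × ℝ) (bd : W → W → List (ℝ × ℝ))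
    {G : SimpleGraph W} {S : Set W} {u v : W} (huv : u ≠ v) (hu : u ∈ S)
    (h : Relation.ReflTransGen (fun a b => G.Adj a b ∧ b ∈ S) u v) :
    ∃ L : List (ℝ × ℝ), (∀ z ∈ c u :: (L ++ [c v]),
        z ∈ Set.range c ∪ {z | ∃ a b, z ∈ bd a b}) ∧
      polylineOf (c u :: (L ++ [c v])) ⊆ ⋃ a ∈ S, ⋃ b ∈ S, ⋃ _ : G.Adj a b,
        polylineOf (c a :: (bd a b ++ [c b])) := by
  induction h using Relation.ReflTransGen.head_induction_on with
  | refl => exact absurd rfl huv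
  | @head a b h1 _ ih =>
    by_cases hb : b = v
    · subst hb
      refine ⟨bd a b, ?_, ?_⟩
      · intro z hz
        simp only [List.mem_cons, List.mem_append, List.not_mem_nil, or_false] at hz
        rcases hz with rfl | hz | rfl
        · exact Or.inl ⟨_, rfl⟩
        · exact Or.inr ⟨_, _, hz⟩
        · exact Or.inl ⟨_, rfl⟩
      · intro z hz
        simp only [Set.mem_iUnion]
        exact ⟨a, hu, b, h1.2, h1.1, hz⟩
    · obtain ⟨L, hL, hL'⟩ := ih hb h1.2
      refine ⟨bd a b ++ c b :: L, ?_, ?_⟩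
      · intro z hz
        simp only [List.mem_cons, List.mem_append, List.not_mem_nil, or_false] at hz hL
        rcases hz with rfl | (hz | rfl | hz) | rfl
        · exact Or.inl ⟨_, rfl⟩
        · exact Or.inr ⟨_, _, hz⟩
        · exact Or.inl ⟨_, rfl⟩
        · exact hL _ (Or.inr (Or.inl hz))
        · exact Or.inl ⟨_, rfl⟩
      · have : c a :: (bd a b ++ c b :: L ++ [c v]) = (c a :: bd a b) ++ c b :: (L ++ [c v]) := by
          simp
        rw [this, polylineOf_append]
        apply Set.union_subset _ hL'
        intro z hz
        simp only [Set.mem_iUnion]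
        exact ⟨a, hu, b, h1.2, h1.1, hz⟩

theorem ConnIn.link {W : Type*} {G : SimpleGraph W} {S T : Set W} (hS : ConnIn G S)
    (hT : ConnIn G T) {u v : W} (hu : u ∈ S) (hv : v ∈ T) (h : ∃ a ∈ S, ∃ b ∈ T, G.Adj a b) :
    Relation.ReflTransGen (fun a b => G.Adj a b ∧ b ∈ S ∪ T) u v := by
  obtain ⟨a, ha, b, hb, hab⟩ := h
  have h1 : Relation.ReflTransGen (fun a b => G.Adj a b ∧ b ∈ S ∪ T) u a :=
    Relation.ReflTransGen.mono (fun x y h => ⟨h.1, Or.inl h.2⟩) _ _ (hS u hu a ha)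
  have h2 : Relation.ReflTransGen (fun a b => G.Adj a b ∧ b ∈ S ∪ T) b v :=
    Relation.ReflTransGen.mono (fun x y h => ⟨h.1, Or.inr h.2⟩) _ _ (hT b hb v hv)
  exact h1.trans (.head ⟨hab, Or.inr hb⟩ h2)

theorem fin5_exists_two_others (i j : Fin 5) :
    ∃ k l : Fin 5, k ≠ l ∧ i ≠ k ∧ i ≠ l ∧ j ≠ k ∧ j ≠ l := by
  revert i j; decide

theorem k5_parity_contradiction (R : Fin 5 → Fin 5 → Fin 5 → ZMod 2) (L : Fin 5 → Fin 5 → ZMod 2)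
    (hL : ∀ i j, i < j → L j i = 1 + L i j)
    (h : ∀ i j k l, i < j → k < l → i < k → j ≠ k → j ≠ l →
      R i k l + R j k l + R k i j + R l i j = L i k + L i l + L j k + L j l) : False := by
  have e1 := h 0 1 2 3 (by decide) (by decide) (by decide) (by decide) (by decide)
  have e2 := h 0 1 2 4 (by decide) (by decide) (by decide) (by decide) (by decide)
  have e3 := h 0 1 3 4 (by decide) (by decide) (by decide) (by decide) (by decide)
  have e4 := h 0 2 1 3 (by decide) (by decide) (by decide) (by decide) (by decide)
  have e5 := h 0 2 1 4 (by decide) (by decide) (by decide) (by decide) (by decide)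
  have e6 := h 0 2 3 4 (by decide) (by decide) (by decide) (by decide) (by decide)
  have e7 := h 0 3 1 2 (by decide) (by decide) (by decide) (by decide) (by decide)
  have e8 := h 0 3 1 4 (by decide) (by decide) (by decide) (by decide) (by decide)
  have e9 := h 0 3 2 4 (by decide) (by decide) (by decide) (by decide) (by decide)
  have e10 := h 0 4 1 2 (by decide) (by decide) (by decide) (by decide) (by decide)
  have e11 := h 0 4 1 3 (by decide) (by decide) (by decide) (by decide) (by decide)
  have e12 := h 0 4 2 3 (by decide) (by decide) (by decide) (by decide) (by decide)
  have e13 := h 1 2 3 4 (by decide) (by decide) (by decide) (by decide) (by decide)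
  have e14 := h 1 3 2 4 (by decide) (by decide) (by decide) (by decide) (by decide)
  have e15 := h 1 4 2 3 (by decide) (by decide) (by decide) (by decide) (by decide)
  have l1 := hL 1 2 (by decide)
  have l2 := hL 1 3 (by decide)
  have l3 := hL 1 4 (by decide)
  have l4 := hL 2 3 (by decide)
  have l5 := hL 2 4 (by decide)
  have l6 := hL 3 4 (by decide)
  have h20 : (2 : ZMod 2) = 0 := by decide
  have h10 : (1 : ZMod 2) = 0 := by linear_combination e1 + e2 + e3 + e4 + e5 + e6 + e7 + e8 + e9
    + e10 + e11 + e12 + e13 + e14 + e15 - ((R 0 1 2 + R 0 1 3 + R 0 1 4 + R 0 2 3 + R 0 2 4 + R 0 3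
    4 + R 1 0 2 + R 1 0 3 + R 1 0 4 + R 1 2 3 + R 1 2 4 + R 1 3 4 + R 2 0 1 + R 2 0 3 + R 2 0 4 + R
    2 1 3 + R 2 1 4 + R 2 3 4 + R 3 0 1 + R 3 0 2 + R 3 0 4 + R 3 1 2 + R 3 1 4 + R 3 2 4 + R 4 0 1
    + R 4 0 2 + R 4 0 3 + R 4 1 2 + R 4 1 3 + R 4 2 3) - 3 * (L 0 1 + L 0 2 + L 0 3 + L 0 4 + L 1 2
    + L 1 3 + L 1 4 + L 2 3 + L 2 4 + L 3 4) - 8) * h20 + 2 * l1 + 2 * l2 +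
      2 * l3 + 3 * l4 + 3 * l5 + 3 * l6
  exact one_ne_zero h10

theorem not_hasCliqueMinor_five {W : Type*} [Finite W] (G : SimpleGraph W) (c : W → ℝ × ℝ)
    (bd : W → W → List (ℝ × ℝ))
    (hd : ∀ u v x y, G.Adj u v → G.Adj x y → u ≠ x → u ≠ y → v ≠ x → v ≠ y →
      Disjoint (polylineOf (c u :: (bd u v ++ [c v]))) (polylineOf (c x :: (bd x y ++ [c y])))) :
    ¬ HasCliqueMinor G 5 := by
  -- make all abscissae distinct
  have hfin : (Set.range c ∪ {z | ∃ a b, z ∈ bd a b}).Finite := by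
    refine (Set.finite_range c).union ?_
    have : {z | ∃ a b, z ∈ bd a b} = ⋃ a, ⋃ b, {z | z ∈ bd a b} := by ext; simp
    rw [this]
    exact Set.finite_iUnion fun a => Set.finite_iUnion fun b => List.finite_toSet _
  obtain ⟨t, ht⟩ := exists_shear_injOn hfin
  set S := shear t '' (Set.range c ∪ {z | ∃ a b, z ∈ bd a b}) with hS
  rintro ⟨B, hne, hconn, hdisj, hadj⟩
  choose r hr using hne
  have hrne : ∀ i j, i ≠ j → r i ≠ r j := fun i j hij h =>
    Set.disjoint_left.1 (hdisj i j hij) (hr i) (h ▸ hr j)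
  have hpath : ∀ i j, i ≠ j → ∃ L : List (ℝ × ℝ), (∀ z ∈ c (r i) :: (L ++ [c (r j)]),
        z ∈ Set.range c ∪ {z | ∃ a b, z ∈ bd a b}) ∧
      polylineOf (c (r i) :: (L ++ [c (r j)])) ⊆ ⋃ a ∈ B i ∪ B j, ⋃ b ∈ B i ∪ B j,
        ⋃ _ : G.Adj a b, polylineOf (c a :: (bd a b ++ [c b])) := fun i j hij =>
    exists_drawn_path c bd (hrne i j hij) (Or.inl (hr i))
      ((hconn i).link (hconn j) (hr i) (hr j) (hadj i j hij))
  choose! L hL1 hL2 using hpath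
  let P : Fin 5 → ℝ × ℝ := fun i => shear t (c (r i))
  let M : Fin 5 → Fin 5 → List (ℝ × ℝ) := fun i j => (L i j).map (shear t)
  have hM : ∀ i j, P i :: (M i j ++ [P j]) = (c (r i) :: (L i j ++ [c (r j)])).map (shear t) := by
    intro i j; simp [P, M]
  have hMS : ∀ i j, i ≠ j → ∀ z ∈ P i :: (M i j ++ [P j]), z ∈ S := by
    intro i j hij z hz
    rw [hM] at hz
    obtain ⟨w, hw, rfl⟩ := List.mem_map.1 hz
    exact ⟨w, hL1 i j hij w hw, rfl⟩
  have hMd : ∀ i j k l, i ≠ j → k ≠ l → i ≠ k → i ≠ l → j ≠ k → j ≠ l →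
      Disjoint (polylineOf (P i :: (M i j ++ [P j]))) (polylineOf (P k :: (M k l ++ [P l]))) := by
    intro i j k l hij hkl hik hil hjk hjl
    rw [hM, hM, polylineOf_map, polylineOf_map, Set.disjoint_image_iff (shear_injective t)]
    refine Set.disjoint_of_subset (hL2 i j hij) (hL2 k l hkl) ?_
    have hBB : Disjoint (B i ∪ B j) (B k ∪ B l) := by
      simp only [Set.disjoint_union_left, Set.disjoint_union_right]
      exact ⟨⟨hdisj _ _ hik, hdisj _ _ hjk⟩, hdisj _ _ hil, hdisj _ _ hjl⟩
    simp only [Set.disjoint_iUnion_left, Set.disjoint_iUnion_right]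
    intro a ha b hb hab x hx y hy hxy
    exact hd _ _ _ _ hxy hab (fun h => Set.disjoint_left.1 hBB hx (h ▸ ha))
      (fun h => Set.disjoint_left.1 hBB hx (h ▸ hb)) (fun h => Set.disjoint_left.1 hBB hy (h ▸ ha))
      (fun h => Set.disjoint_left.1 hBB hy (h ▸ hb))
  apply k5_parity_contradiction (fun i j k => rayPath (P i) (P j :: (M j k ++ [P k])))
    (fun i j => leftParity (P i) (P j))
  · intro i j hij
    apply leftParity_swap
    intro h
    have hPS : ∀ i, P i ∈ S := fun i => ⟨_, Or.inl ⟨_, rfl⟩, rfl⟩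
    have h3 : P i = P j := ht (hPS i) (hPS j) h
    obtain ⟨k, l, hkl, hik, hil, hjk, hjl⟩ : ∃ k l : Fin 5, k ≠ l ∧ i ≠ k ∧ i ≠ l ∧ j ≠ k ∧ j ≠ l :=
      fin5_exists_two_others i j
    refine Set.disjoint_left.1 (hMd i k j l hik hjl hij.ne hil hjk.symm hkl)
      (mem_polylineOf_of_mem (z := P i) (by simp) (by simp)) ?_
    rw [h3]
    exact mem_polylineOf_of_mem (by simp) (by simp)
  · intro i j k l hij hkl hik hjk hjl
    exact rayPath_parity ht (hMS i j hij.ne) (hMS k l hkl.ne)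
      (hMd i j k l hij.ne hkl.ne hik.ne (hik.trans hkl).ne hjk hjl)

/-! ### Contractions and the edge bound for graphs without clique minors -/

section Minors

variable {W : Type*}

theorem HasCliqueMinor.mono {G H : SimpleGraph W} {t : ℕ} (h : HasCliqueMinor G t) (hGH : G ≤ H) :
    HasCliqueMinor H t := by
  obtain ⟨B, h1, h2, h3, h4⟩ := h
  refine ⟨B, h1, fun i u hu v hv => ?_, h3, fun i j hij => ?_⟩
  · exact Relation.ReflTransGen.mono (fun a b h => ⟨hGH h.1, h.2⟩) _ _ (h2 i u hu v hv)
  · obtain ⟨u, hu, v, hv, huv⟩ := h4 i j hij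
    exact ⟨u, hu, v, hv, hGH huv⟩

/-- Identify `v` with `u`, leaving `v` isolated. -/
def mergeInto (G : SimpleGraph W) (u v : W) : SimpleGraph W where
  Adj a b := a ≠ b ∧ a ≠ v ∧ b ≠ v ∧ (G.Adj a b ∨ (a = u ∧ G.Adj v b) ∨ (b = u ∧ G.Adj a v))
  symm := ⟨fun a b h => by
    obtain ⟨h1, h2, h3, h4⟩ := h
    refine ⟨h1.symm, h3, h2, ?_⟩
    rcases h4 with h | h | h
    · exact Or.inl h.symm
    · exact Or.inr (Or.inr ⟨h.1, h.2.symm⟩)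
    · exact Or.inr (Or.inl ⟨h.1, h.2.symm⟩)⟩
  loopless := ⟨fun a h => h.1 rfl⟩

theorem mergeInto_le_of_twins {G : SimpleGraph W} {u v : W}
    (h : ∀ x, G.Adj v x → G.Adj u x) : mergeInto G u v ≤ G := by
  intro a b hab
  obtain ⟨-, -, -, h1 | ⟨rfl, h1⟩ | ⟨rfl, h1⟩⟩ := hab
  · exact h1
  · exact h _ h1
  · exact (h _ h1.symm).symm

theorem HasCliqueMinor.of_mergeInto {G : SimpleGraph W} {u v : W} (huv : G.Adj u v) {t : ℕ}
    (ht : 2 ≤ t) (h : HasCliqueMinor (mergeInto G u v) t) : HasCliqueMinor G t := by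
  obtain ⟨B, h1, h2, h3, h4⟩ := h
  have hex : ∀ i, ∃ x ∈ B i, x ≠ v := by
    intro i
    have : ∃ j, i ≠ j := by
      have : Nontrivial (Fin t) := Fin.nontrivial_iff_two_le.2 ht
      obtain ⟨j, hj⟩ := exists_ne i
      exact ⟨j, hj.symm⟩
    obtain ⟨j, hij⟩ := this
    obtain ⟨x, hx, y, hy, hxy⟩ := h4 i j hij
    exact ⟨x, hx, hxy.2.1⟩
  let φ : W → W := fun x => if x = v then u else x
  have hφv : φ v = u := by simp [φ]
  have hφ : ∀ x, x ≠ v → φ x = x := fun x hx => by simp [φ, hx]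
  refine ⟨fun i => {x | φ x ∈ B i}, ?_, ?_, ?_, ?_⟩
  · intro i
    obtain ⟨x, hx, hxv⟩ := hex i
    exact ⟨x, by simpa [hφ x hxv] using hx⟩
  · intro i
    -- steps of the contracted graph lift
    have lift : ∀ x y, Relation.ReflTransGen (fun a b => (mergeInto G u v).Adj a b ∧ b ∈ B i) x y →
        x ∈ B i → x ≠ v → Relation.ReflTransGen (fun a b => G.Adj a b ∧ φ b ∈ B i) x y := by
      intro x y hxy
      induction hxy using Relation.ReflTransGen.head_induction_on with
      | refl => exact fun _ _ => .refl
      | @head a b hab _ ih =>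
        intro ha hav
        obtain ⟨⟨-, -, hbv, hab⟩, hb⟩ := hab
        have hb' : φ b ∈ B i := by rwa [hφ b hbv]
        refine Relation.ReflTransGen.trans ?_ (ih hb hbv)
        rcases hab with h | ⟨rfl, h⟩ | ⟨rfl, h⟩
        · exact .single ⟨h, hb'⟩
        · exact .head (b := v) ⟨huv, by rwa [hφv]⟩ (.single ⟨h, hb'⟩)
        · exact .head (b := v) ⟨h, by rwa [hφv]⟩ (.single ⟨huv.symm, hb'⟩)
    have down : ∀ a, φ a ∈ B i → Relation.ReflTransGen (fun a b => G.Adj a b ∧ φ b ∈ B i) a (φ a) ∧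
        Relation.ReflTransGen (fun a b => G.Adj a b ∧ φ b ∈ B i) (φ a) a := by
      intro a ha
      by_cases hav : a = v
      · subst hav
        rw [hφv] at ha ⊢
        exact ⟨.single ⟨huv.symm, by rwa [hφ u huv.ne]⟩, .single ⟨huv, by rwa [hφv]⟩⟩
      · rw [hφ a hav]; exact ⟨.refl, .refl⟩
    have hφne : ∀ a, φ a ≠ v := by
      intro a
      by_cases hav : a = v
      · rw [hav, hφv]; exact huv.ne
      · rwa [hφ a hav]
    intro a ha b hb
    exact (down a ha).1.trans ((lift _ _ (h2 i _ ha _ hb) ha (hφne a)).trans (down b hb).2)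
  · intro i j hij
    exact Set.disjoint_left.2 fun x hx hy => Set.disjoint_left.1 (h3 i j hij) hx hy
  · intro i j hij
    obtain ⟨x, hx, y, hy, hxy⟩ := h4 i j hij
    obtain ⟨-, hxv, hyv, h⟩ := hxy
    have hx' : φ x ∈ B i := by rwa [hφ x hxv]
    have hy' : φ y ∈ B j := by rwa [hφ y hyv]
    rcases h with h | ⟨rfl, h⟩ | ⟨rfl, h⟩
    · exact ⟨x, hx', y, hy', h⟩
    · exact ⟨v, by simpa [hφv] using hx, y, hy', h⟩
    · exact ⟨x, hx', v, by simpa [hφv] using hy, h⟩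

/-- Every edge of `G` has both ends in `V`. -/
def SupportedOn (G : SimpleGraph W) (V : Finset W) : Prop := ∀ a b, G.Adj a b → a ∈ V

theorem SupportedOn.mergeInto {G : SimpleGraph W} {V : Finset W} (h : SupportedOn G V)
    {u v : W} (hu : u ∈ V) : SupportedOn (mergeInto G u v) (V.erase v) := by
  rintro a b ⟨-, hav, -, h1 | ⟨rfl, -⟩ | ⟨-, h1⟩⟩
  · exact Finset.mem_erase.2 ⟨hav, h _ _ h1⟩
  · exact Finset.mem_erase.2 ⟨hav, hu⟩
  · exact Finset.mem_erase.2 ⟨hav, h _ _ h1⟩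

/-- The subgraph of `G` consisting of the edges inside `R`. -/
def restrictTo (G : SimpleGraph W) (R : Set W) : SimpleGraph W where
  Adj a b := G.Adj a b ∧ a ∈ R ∧ b ∈ R
  symm := ⟨fun _ _ h => ⟨h.1.symm, h.2.2, h.2.1⟩⟩
  loopless := ⟨fun _ h => h.1.ne rfl⟩

theorem restrictTo_le (G : SimpleGraph W) (R : Set W) : restrictTo G R ≤ G := fun _ _ h => h.1

theorem supportedOn_restrictTo (G : SimpleGraph W) (R : Finset W) :
    SupportedOn (restrictTo G (R : Set W)) R := fun _ _ h => h.2.1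

theorem HasCliqueMinor.subset_of_supportedOn {G : SimpleGraph W} {V : Finset W}
    (h : SupportedOn G V) {t : ℕ} (ht : 2 ≤ t) {B : Fin t → Set W} (hB : ∀ i, ConnIn G (B i))
    (hadj : ∀ i j, i ≠ j → ∃ u ∈ B i, ∃ v ∈ B j, G.Adj u v) (i : Fin t) : B i ⊆ V := by
  have : Nontrivial (Fin t) := Fin.nontrivial_iff_two_le.2 ht
  obtain ⟨j, hj⟩ := exists_ne i
  obtain ⟨u, hu, v, hv, huv⟩ := hadj i j hj.symm
  intro x hx
  rcases Relation.ReflTransGen.cases_head (hB i x hx u hu) with rfl | ⟨y, hy, -⟩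
  · exact h _ _ huv
  · exact h _ _ hy.1

theorem hasCliqueMinor_two_of_adj {G : SimpleGraph W} {u v : W} (h : G.Adj u v) :
    HasCliqueMinor G 2 := by
  have hc : ∀ x : W, ConnIn G {x} := by
    rintro x a rfl b rfl; exact .refl
  refine ⟨![{u}, {v}], ?_, ?_, ?_, ?_⟩
  · intro i; fin_cases i <;> simp
  · intro i; fin_cases i
    · exact hc u
    · exact hc v
  · intro i j hij; fin_cases i <;> fin_cases j <;> simp_all [h.ne, h.ne']
  · intro i j hij; fin_cases i <;> fin_cases j <;> simp_all [h.symm]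

variable [Fintype W]

/-- The number of ordered pairs of adjacent vertices. -/
def dartCount (G : SimpleGraph W) : ℕ := (univ.filter fun p : W × W => G.Adj p.1 p.2).card

/-- The finite set of neighbours of a vertex. -/
def nbrs (G : SimpleGraph W) (v : W) : Finset W := univ.filter fun w => G.Adj v w

theorem mem_nbrs {G : SimpleGraph W} {v w : W} : w ∈ nbrs G v ↔ G.Adj v w := by simp [nbrs]

theorem dartCount_eq_sum (G : SimpleGraph W) {V : Finset W} (h : SupportedOn G V) :
    dartCount G = ∑ v ∈ V, (nbrs G v).card := by
  unfold dartCount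
  rw [Finset.card_eq_sum_card_fiberwise (f := Prod.fst) (t := V)
    (fun p hp => h p.1 p.2 (by simpa using hp))]
  refine Finset.sum_congr rfl fun v _ => ?_
  refine Finset.card_nbij' (fun p => p.2) (fun w => (v, w)) ?_ ?_ ?_ ?_
  · rintro ⟨a, b⟩ hp; simp at hp; obtain ⟨h1, rfl⟩ := hp; simpa [nbrs] using h1
  · intro w hw; simpa [nbrs] using hw
  · rintro ⟨a, b⟩ hp; simp at hp; simp [hp.2]
  · intro w _; rfl

theorem dartCount_le_mergeInto {G : SimpleGraph W} {u v : W} (huv : G.Adj u v) :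
    dartCount G ≤ dartCount (mergeInto G u v) + 2 + 2 * (nbrs G u ∩ nbrs G v).card := by
  set A := univ.filter fun p : W × W => G.Adj p.1 p.2
  set A' := univ.filter fun p : W × W => (mergeInto G u v).Adj p.1 p.2
  set D : Finset (W × W) := {(u, v), (v, u)} ∪ ((nbrs G u ∩ nbrs G v).image (fun w => (v, w)) ∪
    (nbrs G u ∩ nbrs G v).image (fun w => (w, v)))
  have hD : D.card ≤ 2 + 2 * (nbrs G u ∩ nbrs G v).card := by
    have h3 := Finset.card_image_le (s := nbrs G u ∩ nbrs G v) (f := fun w => (v, w))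
    have h4 := Finset.card_image_le (s := nbrs G u ∩ nbrs G v) (f := fun w => (w, v))
    rw [two_mul]
    exact (Finset.card_union_le _ _).trans (Nat.add_le_add Finset.card_le_two
      ((Finset.card_union_le _ _).trans (Nat.add_le_add h3 h4)))
  have hmap : (A \ D).card ≤ A'.card := by
    let φ : W → W := fun x => if x = v then u else x
    have hφv : φ v = u := by simp [φ]
    have hφ : ∀ x, x ≠ v → φ x = x := fun x hx => by simp [φ, hx]
    refine Finset.card_le_card_of_injOn (fun p => (φ p.1, φ p.2)) ?_ ?_
    · rintro ⟨a, b⟩ hp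
      simp only [A, D, Finset.coe_sdiff, Set.mem_sdiff, Finset.mem_coe, mem_filter, mem_univ,
        true_and, mem_union, mem_insert, Prod.mk.injEq, mem_singleton, mem_image, mem_inter,
        mem_nbrs, not_or] at hp
      obtain ⟨hab, ⟨h1, h2⟩, -⟩ := hp
      refine Finset.mem_coe.2 (mem_filter.2 ⟨mem_univ _, ?_⟩)
      change (mergeInto G u v).Adj (φ a) (φ b)
      by_cases ha : a = v
      · subst ha
        have hb : b ≠ a := hab.ne'
        rw [hφv, hφ b hb]
        have : u ≠ b := fun h => h2 ⟨rfl, h.symm⟩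
        exact ⟨this, huv.ne, hb, Or.inr (Or.inl ⟨rfl, hab⟩)⟩
      · rw [hφ a ha]
        by_cases hb : b = v
        · subst hb
          rw [hφv]
          exact ⟨fun h => h1 ⟨h, rfl⟩, ha, huv.ne, Or.inr (Or.inr ⟨rfl, hab⟩)⟩
        · rw [hφ b hb]; exact ⟨hab.ne, ha, hb, Or.inl hab⟩
    · rintro ⟨a, b⟩ hp ⟨a', b'⟩ hp' heq
      simp only [A, D, Finset.coe_sdiff, Set.mem_sdiff, Finset.mem_coe, mem_filter, mem_univ,
        true_and, mem_union, mem_insert, Prod.mk.injEq, mem_singleton, mem_image, mem_inter,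
        mem_nbrs, not_or, not_exists, not_and] at hp hp' heq
      obtain ⟨hab, ⟨h1, h2⟩, h3, h4⟩ := hp
      obtain ⟨hab', ⟨h1', h2'⟩, h3', h4'⟩ := hp'
      obtain ⟨e1, e2⟩ := heq
      have hne := huv.ne
      have s1 := hab.symm
      have s2 := hab'.symm
      have l1 := hab.ne
      have l2 := hab'.ne
      have h3b := h3 b
      have h3b' := h3' b'
      have h4a := h4 a
      have h4a' := h4' a'
      simp only [φ] at e1 e2
      simp only [Prod.mk.injEq]
      split_ifs at e1 e2 <;> subst_vars <;> simp_all
  have h1 : A.card ≤ (A \ D).card + D.card := Finset.card_le_card_sdiff_add_card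
  have h2 : dartCount G = A.card := rfl
  have h3 : dartCount (mergeInto G u v) = A'.card := rfl
  omega

theorem HasCliqueMinor.succ_of_nbrs {G : SimpleGraph W} {v : W} {t : ℕ} (ht : 2 ≤ t)
    (h : HasCliqueMinor (restrictTo G (nbrs G v : Set W)) t) : HasCliqueMinor G (t + 1) := by
  obtain ⟨B, h1, h2, h3, h4⟩ := h
  have hsub := HasCliqueMinor.subset_of_supportedOn (supportedOn_restrictTo G (nbrs G v)) ht h2 h4
  have hvB : ∀ i, v ∉ B i := fun i hv => by
    have := hsub i hv
    simp [nbrs] at this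
  have hadjv : ∀ i, ∃ x ∈ B i, G.Adj v x := fun i => by
    obtain ⟨x, hx⟩ := h1 i
    exact ⟨x, hx, mem_nbrs.1 (hsub i hx)⟩
  refine ⟨Fin.cons {v} B, ?_, ?_, ?_, ?_⟩
  · intro i
    refine Fin.cases ?_ (fun i => ?_) i
    · exact ⟨v, rfl⟩
    · simpa using h1 i
  · intro i
    refine Fin.cases ?_ (fun i => ?_) i
    · rintro a ha b hb
      simp only [Fin.cons_zero, Set.mem_singleton_iff] at ha hb
      subst ha; subst hb; exact .refl
    · intro a ha b hb
      exact Relation.ReflTransGen.mono (fun x y h => ⟨h.1.1, h.2⟩) _ _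
        (h2 i a (by simpa using ha) b (by simpa using hb))
  · intro i j
    refine Fin.cases ?_ (fun i => ?_) i <;> refine Fin.cases ?_ (fun j => ?_) j
    · intro h; exact absurd rfl h
    · intro _; simpa using hvB j
    · intro _; simpa using hvB i
    · intro h; simpa using h3 i j (fun h' => h (by rw [h']))
  · intro i j
    refine Fin.cases ?_ (fun i => ?_) i <;> refine Fin.cases ?_ (fun j => ?_) j
    · intro h; exact absurd rfl h
    · intro _
      obtain ⟨x, hx, hvx⟩ := hadjv j
      exact ⟨v, rfl, x, by simpa using hx, hvx⟩
    · intro _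
      obtain ⟨x, hx, hvx⟩ := hadjv i
      exact ⟨x, by simpa using hx, v, rfl, hvx.symm⟩
    · intro h
      obtain ⟨x, hx, y, hy, hxy⟩ := h4 i j (fun h' => h (by rw [h']))
      exact ⟨x, by simpa using hx, y, by simpa using hy, hxy.1⟩

theorem hasCliqueMinor_step {t c : ℕ} (ht : 2 ≤ t)
    (hc : ∀ (G : SimpleGraph W) (V : Finset W), SupportedOn G V → V.Nonempty →
      c * V.card ≤ dartCount G → HasCliqueMinor G t)
    (G : SimpleGraph W) (V : Finset W) (hG : SupportedOn G V) (hV : V.Nonempty)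
    (he : (2 * c + 2) * V.card ≤ dartCount G) : HasCliqueMinor G (t + 1) := by
  induction hn : V.card using Nat.strong_induction_on generalizing G V with
  | _ n ih =>
    subst hn
    by_cases hex : ∃ u v, G.Adj u v ∧ (nbrs G u ∩ nbrs G v).card ≤ c
    · obtain ⟨u, v, huv, hcm⟩ := hex
      have hu := hG _ _ huv
      have hv := hG _ _ huv.symm
      have hcard := Finset.card_erase_of_mem hv
      have hpos := Finset.card_pos.2 hV
      refine HasCliqueMinor.of_mergeInto huv (by omega)
        (ih _ (by omega) _ _ (hG.mergeInto hu) ⟨u, Finset.mem_erase.2 ⟨huv.ne, hu⟩⟩ ?_ rfl)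
      have := dartCount_le_mergeInto huv
      rw [hcard]
      obtain ⟨m, hm⟩ : ∃ m, V.card = m + 1 := ⟨V.card - 1, by omega⟩
      rw [hm] at he ⊢
      simp only [Nat.add_sub_cancel]
      rw [Nat.mul_succ] at he
      omega
    · push Not at hex
      have hpos : 0 < dartCount G := lt_of_lt_of_le (Nat.mul_pos (by omega) (card_pos.2 hV)) he
      obtain ⟨⟨v, w⟩, hp⟩ := card_pos.1 hpos
      have hvw : G.Adj v w := by simpa using hp
      refine HasCliqueMinor.succ_of_nbrs ht (v := v) (hc _ _ (supportedOn_restrictTo G (nbrs G v))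
        ⟨w, mem_nbrs.2 hvw⟩ ?_)
      rw [dartCount_eq_sum _ (supportedOn_restrictTo G (nbrs G v)), mul_comm, ← smul_eq_mul]
      refine Finset.card_nsmul_le_sum _ _ _ fun u hu => ?_
      have h1 := hex v u (mem_nbrs.1 hu)
      refine h1.le.trans (Finset.card_le_card fun x hx => ?_)
      rw [mem_inter] at hx
      rw [mem_nbrs]
      exact ⟨mem_nbrs.1 hx.2, by simpa using hu, by simpa using hx.1⟩

theorem hasCliqueMinor_five_of_dartCount (G : SimpleGraph W) (V : Finset W) (hG : SupportedOn G V)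
    (hV : V.Nonempty) (he : 22 * V.card ≤ dartCount G) : HasCliqueMinor G 5 := by
  refine hasCliqueMinor_step (c := 10) (by norm_num) (hasCliqueMinor_step (c := 4) (by norm_num)
    (hasCliqueMinor_step (c := 1) (by norm_num) ?_)) G V hG hV he
  intro G V _ hV he
  have hpos : 0 < dartCount G := lt_of_lt_of_le (Nat.mul_pos (by omega) (card_pos.2 hV)) he
  obtain ⟨⟨v, w⟩, hp⟩ := card_pos.1 hpos
  exact hasCliqueMinor_two_of_adj (by simpa using hp)

theorem dartCount_le_of_not_hasCliqueMinor {G : SimpleGraph W} {V : Finset W}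
    (hG : SupportedOn G V) (h : ¬ HasCliqueMinor G 5) : dartCount G ≤ 22 * V.card := by
  by_contra! hlt
  rcases V.eq_empty_or_nonempty with rfl | hV
  · rw [dartCount_eq_sum _ hG] at hlt; simp at hlt
  · exact h (hasCliqueMinor_five_of_dartCount G V hG hV hlt.le)

end Minors

/-! ### Removable vertices in graphs without a `K₅` minor -/

section Removable

variable {W : Type*} [Fintype W]

/-- The cliques of `G` contained in `R`. -/
def cliquesIn (G : SimpleGraph W) (R : Finset W) : Finset (Finset W) :=
  R.powerset.filter fun S => ∀ a ∈ S, ∀ b ∈ S, a ≠ b → G.Adj a b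

theorem exists_small_degree {G : SimpleGraph W} {V : Finset W} (hV : V.Nonempty)
    (hG : SupportedOn G V) (h : ¬ HasCliqueMinor G 5) : ∃ v ∈ V, (nbrs G v).card ≤ 22 := by
  have h1 := dartCount_le_of_not_hasCliqueMinor hG h
  rw [dartCount_eq_sum _ hG] at h1
  by_contra! hlt
  have h2 : V.card • 23 ≤ ∑ v ∈ V, (nbrs G v).card :=
    Finset.card_nsmul_le_sum _ _ _ fun v hv => hlt v hv
  have := card_pos.2 hV
  rw [smul_eq_mul] at h2
  omega

theorem card_cliquesIn_le {G : SimpleGraph W} (h : ¬ HasCliqueMinor G 5) (R : Finset W) :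
    (cliquesIn G R).card ≤ 2 ^ 22 * R.card + 1 := by
  induction hn : R.card generalizing R with
  | zero =>
    obtain rfl := card_eq_zero.1 hn
    refine (card_filter_le _ _).trans ?_
    simp
  | succ n ih =>
    have hR : R.Nonempty := card_pos.1 (by omega)
    obtain ⟨v, hv, hdeg⟩ := exists_small_degree hR (supportedOn_restrictTo G R)
      (fun h' => h (h'.mono (restrictTo_le _ _)))
    have hcard : (R.erase v).card = n := by rw [card_erase_of_mem hv]; omega
    have h1 := ih (R.erase v) hcard
    set N := nbrs (restrictTo G (R : Set W)) v
    have h2 : (cliquesIn G R).card ≤ (cliquesIn G (R.erase v)).card + N.powerset.card := by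
      rw [← Finset.card_filter_add_card_filter_not (s := cliquesIn G R) (fun S => v ∉ S)]
      refine Nat.add_le_add (card_le_card ?_) ?_
      · intro S hS
        simp only [cliquesIn, mem_filter, mem_powerset] at hS ⊢
        exact ⟨fun x hx => mem_erase.2 ⟨fun h => hS.2 (h ▸ hx), hS.1.1 hx⟩, hS.1.2⟩
      · refine card_le_card_of_injOn (fun S => S.erase v) ?_ ?_
        · intro S hS
          simp only [cliquesIn, coe_filter, mem_filter, mem_powerset, not_not,
            Set.mem_ofPred_eq] at hS
          obtain ⟨⟨hSR, hS⟩, hvS⟩ := hS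
          refine mem_coe.2 (mem_powerset.2 fun x hx => ?_)
          rw [mem_erase] at hx
          exact mem_nbrs.2 ⟨hS _ hvS _ hx.2 hx.1.symm, hSR hvS, hSR hx.2⟩
        · intro S hS T hT hST
          simp only [coe_filter, not_not, Set.mem_ofPred_eq] at hS hT
          simp only at hST
          rw [← insert_erase hS.2, hST, insert_erase hT.2]
    rw [card_powerset] at h2
    have h3 : 2 ^ N.card ≤ 2 ^ 22 := Nat.pow_le_pow_right (by norm_num) hdeg
    rw [Nat.mul_succ]
    omega

theorem card_le_of_nbrs_injOn {G : SimpleGraph W} (h : ¬ HasCliqueMinor G 5) (L R : Finset W)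
    (hLR : Disjoint L R) (hsub : ∀ v ∈ L, nbrs G v ⊆ R)
    (hinj : Set.InjOn (nbrs G) (L : Set W)) :
    L.card + dartCount (restrictTo G (R : Set W)) ≤ (2 ^ 22 + 22) * R.card + 1 := by
  induction hn : L.card generalizing L G with
  | zero =>
    have := dartCount_le_of_not_hasCliqueMinor (supportedOn_restrictTo G R)
      (fun h' => h (h'.mono (restrictTo_le _ _)))
    omega
  | succ n ih =>
    by_cases hcl : ∀ v ∈ L, nbrs G v ∈ cliquesIn G R
    · have h1 : L.card ≤ (cliquesIn G R).card :=
        card_le_card_of_injOn (nbrs G) (fun v hv => hcl v hv) hinj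
      have h2 := card_cliquesIn_le h R
      have h3 := dartCount_le_of_not_hasCliqueMinor (supportedOn_restrictTo G R)
        (fun h' => h (h'.mono (restrictTo_le _ _)))
      rw [add_mul]
      omega
    · push Not at hcl
      obtain ⟨v, hv, hncl⟩ := hcl
      simp only [cliquesIn, mem_filter, mem_powerset, hsub v hv, true_and, not_forall] at hncl
      obtain ⟨x, hx, y, hy, hxy, hnadj⟩ := hncl
      rw [mem_nbrs] at hx hy
      have hxR : x ∈ R := hsub v hv (mem_nbrs.2 hx)
      have hyR : y ∈ R := hsub v hv (mem_nbrs.2 hy)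
      have hvR : v ∉ R := disjoint_left.1 hLR hv
      have hnb : ∀ w ∈ L.erase v, nbrs (mergeInto G x v) w = nbrs G w := by
        intro w hw
        rw [mem_erase] at hw
        have hwR : w ∉ R := disjoint_left.1 hLR hw.2
        have hwv : ¬ G.Adj w v := fun h => hvR (hsub w hw.2 (mem_nbrs.2 h))
        ext z
        rw [mem_nbrs, mem_nbrs]
        constructor
        · rintro ⟨-, -, -, h | ⟨rfl, -⟩ | ⟨rfl, h⟩⟩
          · exact h
          · exact absurd hxR hwR
          · exact absurd h hwv
        · intro h
          exact ⟨h.ne, hw.1, fun hz => hwv (hz ▸ h), Or.inl h⟩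
      have h1 := ih (G := mergeInto G x v) (fun h' => h (h'.of_mergeInto hx.symm (by norm_num)))
        (L.erase v) (hLR.mono_left (erase_subset _ _))
        (fun w hw => by rw [hnb w hw]; exact hsub w (mem_of_mem_erase hw))
        (fun a ha b hb hab => hinj (mem_of_mem_erase ha) (mem_of_mem_erase hb)
          (by rw [← hnb a ha, ← hnb b hb, hab])) (by rw [card_erase_of_mem hv]; omega)
      have h2 : dartCount (restrictTo G (R : Set W)) <
          dartCount (restrictTo (mergeInto G x v) (R : Set W)) := by
        refine card_lt_card ⟨?_, ?_⟩
        · intro p hp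
          simp only [mem_filter, mem_univ, true_and] at hp ⊢
          obtain ⟨hp1, hp2, hp3⟩ := hp
          exact ⟨⟨hp1.ne, fun h => hvR (h ▸ hp2), fun h => hvR (h ▸ hp3), Or.inl hp1⟩, hp2, hp3⟩
        · intro hss
          have : (x, y) ∈ univ.filter fun p : W × W =>
              (restrictTo (mergeInto G x v) (R : Set W)).Adj p.1 p.2 := by
            simp only [mem_filter, mem_univ, true_and]
            exact ⟨⟨hxy, fun h => hvR (h ▸ hxR), fun h => hvR (h ▸ hyR),
              Or.inr (Or.inl ⟨rfl, hy⟩)⟩, hxR, hyR⟩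
          have := hss this
          simp only [mem_filter, mem_univ, true_and] at this
          exact hnadj this.1
      omega

theorem exists_twin_constant : ∃ C : ℕ, 4 ≤ C ∧ ∀ (W : Type) [Fintype W] (G : SimpleGraph W),
    ¬ HasCliqueMinor G 5 → ∀ L R : Finset W, Disjoint L R → (∀ v ∈ L, nbrs G v ⊆ R) →
    Set.InjOn (nbrs G) (L : Set W) → L.card ≤ C * R.card + 1 := by
  refine ⟨2 ^ 22 + 22, by norm_num, ?_⟩
  intro W _ G h L R h1 h2 h3
  have := card_le_of_nbrs_injOn h L R h1 h2 h3
  omega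

variable {ι : Type*}

/-- The pairs of adjacent vertices with distinct colours, both different from `z`. -/
def crossPairs (G : SimpleGraph W) (f : W → ι) (z : ι) : Finset (W × W) :=
  univ.filter fun p => G.Adj p.1 p.2 ∧ f p.1 ≠ z ∧ f p.2 ≠ z ∧ f p.1 ≠ f p.2

/-- `v` and `u` have the same colour, and they are adjacent vertices of degree at most `d`, or
twins. -/
def IsPartner (G : SimpleGraph W) (f : W → ι) (d : ℕ) (v u : W) : Prop :=
  u ≠ v ∧ f u = f v ∧ ((G.Adj u v ∧ (nbrs G u).card ≤ d ∧ (nbrs G v).card ≤ d) ∨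
    nbrs G u = nbrs G v)

theorem card_le_two_mul_partnered {W : Type} [Fintype W] [Fintype ι] {C : ℕ} (hC4 : 4 ≤ C)
    (hC : ∀ (G : SimpleGraph W), ¬ HasCliqueMinor G 5 → ∀ L R : Finset W, Disjoint L R →
      (∀ v ∈ L, nbrs G v ⊆ R) → Set.InjOn (nbrs G) (L : Set W) → L.card ≤ C * R.card + 1)
    {G : SimpleGraph W} (h : ¬ HasCliqueMinor G 5) {V : Finset W} (hG : SupportedOn G V)
    (f : W → ι) (z : ι) (k : ℕ) (hA : (V.filter fun v => f v = z).card ≤ k)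
    (hX : (crossPairs G f z).card ≤ k) (hV : 8 * (Fintype.card ι * (C * k + 1)) ≤ V.card) :
    V.card ≤ 2 * (V.filter fun v => ∃ u ∈ V, IsPartner G f (22 * (8 * C)) v u).card := by
  set d := 22 * (8 * C) with hd
  set A := V.filter fun v => f v = z with hAdef
  set H := V.filter fun v => d < (nbrs G v).card with hHdef
  set X := (crossPairs G f z).image Prod.fst with hXdef
  set T := V.filter fun v => ¬ ∃ u ∈ V, IsPartner G f d v u with hTdef
  let Li : ι → Finset W := fun i => T.filter fun v => f v = i ∧ v ∉ A ∧ v ∉ H ∧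
    nbrs G v ⊆ A ∪ H.filter fun w => f w = i
  have hH : 8 * C * H.card ≤ V.card := by
    have h1 := dartCount_le_of_not_hasCliqueMinor hG h
    rw [dartCount_eq_sum _ hG] at h1
    have h2 : H.card • d ≤ ∑ v ∈ H, (nbrs G v).card :=
      Finset.card_nsmul_le_sum _ _ _ fun v hv => (mem_filter.1 hv).2.le
    have h3 : ∑ v ∈ H, (nbrs G v).card ≤ ∑ v ∈ V, (nbrs G v).card :=
      Finset.sum_le_sum_of_subset (filter_subset _ _)
    rw [smul_eq_mul] at h2
    have h4 : 22 * (8 * C * H.card) ≤ 22 * V.card := by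
      calc 22 * (8 * C * H.card) = H.card * d := by rw [hd]; ring
        _ ≤ _ := h2.trans (h3.trans h1)
    omega
  have hXc : X.card ≤ k := card_image_le.trans hX
  have hLi : ∀ i, (Li i).card ≤ C * (k + (H.filter fun w => f w = i).card) + 1 := by
    intro i
    have h1 := hC G h (Li i) (A ∪ H.filter fun w => f w = i) ?_ ?_ ?_
    · refine h1.trans (Nat.add_le_add_right (Nat.mul_le_mul_left _ ?_) _)
      exact (card_union_le _ _).trans (Nat.add_le_add_right hA _)
    · refine disjoint_left.2 fun v hv hv' => ?_
      obtain ⟨-, -, h1, h2, -⟩ := mem_filter.1 hv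
      rcases mem_union.1 hv' with h3 | h3
      · exact h1 h3
      · exact h2 (mem_filter.1 h3).1
    · intro v hv
      exact (mem_filter.1 hv).2.2.2.2
    · intro a ha b hb hab
      by_contra hne
      have ha' := mem_filter.1 (mem_coe.1 ha)
      have hb' := mem_filter.1 (mem_coe.1 hb)
      refine (mem_filter.1 ha'.1).2 ⟨b, (mem_filter.1 hb'.1).1, fun h => hne h.symm, ?_,
        Or.inr hab.symm⟩
      rw [ha'.2.1, hb'.2.1]
  have hTsub : T ⊆ (A ∪ H ∪ X) ∪ univ.biUnion Li := by
    intro v hv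
    by_contra hcon
    simp only [mem_union, mem_biUnion, mem_univ, true_and, not_or, not_exists] at hcon
    obtain ⟨⟨⟨hvA, hvH⟩, hvX⟩, hvL⟩ := hcon
    have hvL := hvL (f v)
    obtain ⟨hvV, hvT⟩ := mem_filter.1 hv
    have hfv : f v ≠ z := fun h => hvA (mem_filter.2 ⟨hvV, h⟩)
    have hdv : (nbrs G v).card ≤ d := by
      by_contra! hlt; exact hvH (mem_filter.2 ⟨hvV, hlt⟩)
    apply hvL
    refine mem_filter.2 ⟨hv, rfl, hvA, hvH, fun u hu => ?_⟩
    rw [mem_nbrs] at hu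
    have huV := hG _ _ hu.symm
    by_cases hfu : f u = z
    · exact mem_union_left _ (mem_filter.2 ⟨huV, hfu⟩)
    · have hfuv : f u = f v := by
        by_contra hne
        exact hvX (mem_image.2 ⟨(v, u), mem_filter.2 ⟨mem_univ _, hu, hfv, hfu,
            fun h => hne h.symm⟩, rfl⟩)
      refine mem_union_right _ (mem_filter.2 ⟨mem_filter.2 ⟨huV, ?_⟩, hfuv⟩)
      by_contra! hle
      exact hvT ⟨u, huV, hu.ne', hfuv, Or.inl ⟨hu.symm, hle, hdv⟩⟩
  have hsumH : ∑ i, (H.filter fun w => f w = i).card = H.card := by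
    rw [← Finset.card_eq_sum_card_fiberwise (f := f) (t := univ)
      (fun _ _ => mem_coe.2 (mem_univ _))]
  have hTcard : T.card ≤ k + H.card + k + (Fintype.card ι * (C * k + 1) + C * H.card) := by
    refine (card_le_card hTsub).trans ((card_union_le _ _).trans (Nat.add_le_add ?_ ?_))
    · refine (card_union_le _ _).trans (Nat.add_le_add ((card_union_le _ _).trans
        (Nat.add_le_add_right hA _)) hXc)
    · refine card_biUnion_le.trans ((Finset.sum_le_sum fun i _ => hLi i).trans (le_of_eq ?_))
      rw [sum_add_distrib, ← mul_sum, sum_add_distrib, hsumH]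
      simp only [sum_const, card_univ, smul_eq_mul]
      ring
  have hsplit : (V.filter fun v => ∃ u ∈ V, IsPartner G f d v u).card + T.card = V.card :=
    Finset.card_filter_add_card_filter_not _
  have hι : 1 ≤ Fintype.card ι := Fintype.card_pos_iff.2 ⟨z⟩
  have e1 : C * k + 1 ≤ Fintype.card ι * (C * k + 1) := Nat.le_mul_of_pos_left _ hι
  have e2 : 4 * k ≤ C * k := Nat.mul_le_mul_right _ hC4
  have e3 : 4 * H.card ≤ C * H.card := Nat.mul_le_mul_right _ hC4
  have e4 : 8 * C * H.card = 8 * (C * H.card) := by ring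
  rw [e4] at hH
  omega

end Removable

/-! ### Counting graphs without a `K₅` minor with prescribed classes -/

section Counting

variable {W : Type} {ι : Type*}

/-- The number of vertices of `V` of colour `i`. -/
def classSize (f : W → ι) (V : Finset W) (i : ι) : ℕ := (V.filter fun v => f v = i).card

theorem classSize_erase_self (f : W → ι) {V : Finset W} {v : W} (hv : v ∈ V) :
    classSize f V (f v) = classSize f (V.erase v) (f v) + 1 := by
  unfold classSize
  rw [filter_erase, card_erase_of_mem (s := V.filter fun w => f w = f v)
    (mem_filter.2 ⟨hv, rfl⟩)]
  have : 0 < (V.filter fun w => f w = f v).card := card_pos.2 ⟨v, mem_filter.2 ⟨hv, rfl⟩⟩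
  omega

theorem classSize_erase_of_ne (f : W → ι) {V : Finset W} {v : W} {i : ι} (hi : f v ≠ i) :
    classSize f (V.erase v) i = classSize f V i := by
  unfold classSize
  rw [filter_erase, erase_eq_of_notMem]
  simp [hi]

theorem sum_classSize [Fintype ι] (f : W → ι) (V : Finset W) : ∑ i, classSize f V i = V.card :=
  (Finset.card_eq_sum_card_fiberwise (f := f) (t := univ) (fun _ _ => mem_coe.2 (mem_univ _))).symm

theorem prod_factorial_erase [Fintype ι] (f : W → ι) {V : Finset W} {v : W} (hv : v ∈ V) :
    classSize f V (f v) * ∏ i, (classSize f (V.erase v) i).factorial =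
      ∏ i, (classSize f V i).factorial := by
  rw [← mul_prod_erase univ _ (mem_univ (f v)), ← mul_prod_erase univ _ (mem_univ (f v)),
    classSize_erase_self f hv, Nat.factorial_succ, mul_assoc]
  congr 2
  exact prod_congr rfl fun i hi => by rw [classSize_erase_of_ne f (ne_of_mem_erase hi).symm]

theorem factorial_card_le [Fintype ι] (f : W → ι) (V : Finset W) :
    V.card.factorial ≤ Fintype.card ι ^ V.card * ∏ i, (classSize f V i).factorial := by
  induction hn : V.card generalizing V with
  | zero =>
    have : 0 < ∏ i, (classSize f V i).factorial := prod_pos fun i _ => Nat.factorial_pos _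
    simp only [card_eq_zero.1 hn, pow_zero, one_mul, Nat.factorial_zero]
    rwa [card_eq_zero.1 hn] at this
  | succ n ih =>
    have hVne : V.Nonempty := card_pos.1 (by omega)
    obtain ⟨w, hw⟩ := hVne
    have : ∃ i, V.card ≤ Fintype.card ι * classSize f V i := by
      by_contra! hlt
      have h1 : ∑ i : ι, Fintype.card ι * classSize f V i < ∑ i : ι, V.card :=
        sum_lt_sum_of_nonempty ⟨f w, mem_univ _⟩ fun i _ => hlt i
      rw [← mul_sum, sum_classSize] at h1
      simp at h1
    obtain ⟨i, hi⟩ := this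
    have hpos : 0 < classSize f V i := by
      rcases Nat.eq_zero_or_pos (classSize f V i) with h | h
      · rw [h] at hi; omega
      · exact h
    obtain ⟨v, hv⟩ := card_pos.1 hpos
    obtain ⟨hvV, rfl⟩ := mem_filter.1 hv
    replace hv := hvV
    have h1 := ih (V.erase v) (by rw [card_erase_of_mem hv]; omega)
    rw [← prod_factorial_erase f hv, Nat.factorial_succ, pow_succ]
    calc (n + 1) * n.factorial ≤ (Fintype.card ι * classSize f V (f v)) *
        (Fintype.card ι ^ n * ∏ i, (classSize f (V.erase v) i).factorial) :=
          Nat.mul_le_mul (hn ▸ hi) h1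
      _ = _ := by ring

variable [Fintype W]

/-- The `K₅`-minor-free graphs supported on `V` with at most `k` cross pairs. -/
def sparseGraphs (f : W → ι) (z : ι) (k : ℕ) (V : Finset W) : Finset (SimpleGraph W) :=
  univ.filter fun G => SupportedOn G V ∧ ¬ HasCliqueMinor G 5 ∧ (crossPairs G f z).card ≤ k

theorem mem_crossPairs {G : SimpleGraph W} {f : W → ι} {z : ι} {p : W × W} :
    p ∈ crossPairs G f z ↔ G.Adj p.1 p.2 ∧ f p.1 ≠ z ∧ f p.2 ≠ z ∧ f p.1 ≠ f p.2 := by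
  simp [crossPairs]

theorem card_crossPairs_mergeInto_le (G : SimpleGraph W) (f : W → ι) (z : ι) {u v : W}
    (huv : f u = f v) : (crossPairs (mergeInto G u v) f z).card ≤ (crossPairs G f z).card := by
  refine card_le_card_of_injOn (fun p => if G.Adj p.1 p.2 then p else
    if p.1 = u ∧ G.Adj v p.2 then (v, p.2) else (p.1, v)) ?_ ?_
  · rintro ⟨a, b⟩ hp
    rw [mem_coe, mem_crossPairs] at hp
    obtain ⟨⟨-, -, -, h⟩, h1, h2, h3⟩ := hp
    rw [mem_coe, mem_crossPairs]
    simp only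
    by_cases hab : G.Adj a b
    · rw [if_pos hab]; exact ⟨hab, h1, h2, h3⟩
    · rw [if_neg hab]
      by_cases ha : a = u ∧ G.Adj v b
      · rw [if_pos ha]
        obtain ⟨rfl, hvb⟩ := ha
        rw [huv] at h1 h3
        exact ⟨hvb, h1, h2, h3⟩
      · rw [if_neg ha]
        obtain ⟨rfl, hvb⟩ := (h.resolve_left hab).resolve_left ha
        rw [huv] at h2 h3
        exact ⟨hvb, h1, h2, h3⟩
  · rintro ⟨a, b⟩ hp ⟨a', b'⟩ hp' heq
    rw [mem_coe, mem_crossPairs] at hp hp'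
    obtain ⟨⟨l1, l2, l3, h⟩, -⟩ := hp
    obtain ⟨⟨l1', l2', l3', h'⟩, -⟩ := hp'
    simp only at heq
    split_ifs at heq <;> simp only [Prod.mk.injEq] at heq ⊢ <;> grind

theorem mergeInto_mem_sparseGraphs {f : W → ι} {z : ι} {k d : ℕ} {V : Finset W} {u v : W}
    (hu : u ∈ V) {G : SimpleGraph W} (hG : G ∈ sparseGraphs f z k V) (hp : IsPartner G f d v u) :
    mergeInto G u v ∈ sparseGraphs f z k (V.erase v) := by
  simp only [sparseGraphs, mem_filter, mem_univ, true_and] at hG ⊢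
  obtain ⟨h1, h2, h3⟩ := hG
  refine ⟨h1.mergeInto hu, fun h => h2 ?_, (card_crossPairs_mergeInto_le G f z hp.2.1).trans h3⟩
  rcases hp.2.2 with h' | h'
  · exact h.of_mergeInto h'.1 (by norm_num)
  · refine h.mono (mergeInto_le_of_twins fun x hx => ?_)
    rw [← mem_nbrs, h', mem_nbrs]; exact hx

theorem card_partner_fibre_le (f : W → ι) (d : ℕ) (u v : W)
    (G' : SimpleGraph W) :
    (univ.filter fun G => IsPartner G f d v u ∧ mergeInto G u v = G').card ≤ 4 ^ (2 * d) + 1 := by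
  set A := univ.filter fun G : SimpleGraph W => (G.Adj u v ∧ (nbrs G u).card ≤ d ∧
    (nbrs G v).card ≤ d) ∧ mergeInto G u v = G' with hA
  set T := univ.filter fun G : SimpleGraph W => u ≠ v ∧ nbrs G u = nbrs G v ∧
    mergeInto G u v = G' with hT
  have hsub : (univ.filter fun G => IsPartner G f d v u ∧ mergeInto G u v = G') ⊆ A ∪ T := by
    intro G hG
    simp only [mem_filter, mem_univ, true_and] at hG
    obtain ⟨⟨h0, -, h | h⟩, h'⟩ := hG
    · exact mem_union_left _ (mem_filter.2 ⟨mem_univ _, h, h'⟩)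
    · exact mem_union_right _ (mem_filter.2 ⟨mem_univ _, h0, h, h'⟩)
  have hTc : T.card ≤ 1 := by
    have key : ∀ G₁ ∈ T, ∀ G₂ ∈ T, G₁ ≤ G₂ := by
      intro G₁ h₁ G₂ h₂
      simp only [hT, mem_filter, mem_univ, true_and] at h₁ h₂
      obtain ⟨huv, h1, e1⟩ := h₁
      obtain ⟨-, h2, e2⟩ := h₂
      have t1 : ∀ x, G₁.Adj u x ↔ G₁.Adj v x := fun x => by rw [← mem_nbrs, h1, mem_nbrs]
      have t2 : ∀ x, G₂.Adj u x ↔ G₂.Adj v x := fun x => by rw [← mem_nbrs, h2, mem_nbrs]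
      have n1 : ¬ G₁.Adj u v := fun h => (G₁.loopless.irrefl v) ((t1 v).1 h)
      -- an edge avoiding `v`
      have base : ∀ a b, a ≠ v → b ≠ v → G₁.Adj a b → G₂.Adj a b := by
        intro a b ha hb hab
        have : (mergeInto G₂ u v).Adj a b := by
          rw [e2, ← e1]; exact ⟨hab.ne, ha, hb, Or.inl hab⟩
        exact mergeInto_le_of_twins (fun x hx => (t2 x).2 hx) this
      intro a b hab
      by_cases ha : a = v
      · subst ha
        have hub := (t1 b).2 hab
        exact (t2 b).1 (base u b huv hab.ne' hub)
      · by_cases hb : b = v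
        · subst hb
          have hua := (t1 a).2 hab.symm
          exact ((t2 a).1 (base u a huv ha hua)).symm
        · exact base a b ha hb hab
    exact card_le_one.2 fun a ha b hb => le_antisymm (key a ha b hb) (key b hb a ha)
  have hAc : A.card ≤ 4 ^ (2 * d) := by
    rcases A.eq_empty_or_nonempty with h0 | ⟨G₀, hG₀⟩
    · rw [h0]; simp
    set N := nbrs G' u with hN
    have hNsub : ∀ G ∈ A, (nbrs G u).erase v ⊆ N ∧ (nbrs G v).erase u ⊆ N ∧
        N ⊆ nbrs G u ∪ nbrs G v := by
      intro G hG
      obtain ⟨-, ⟨huv, -⟩, rfl⟩ := mem_filter.1 hG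
      refine ⟨fun x hx => ?_, fun x hx => ?_, fun x hx => ?_⟩
      · rw [mem_erase, mem_nbrs] at hx
        exact mem_nbrs.2 ⟨hx.2.ne, huv.ne, hx.1, Or.inl hx.2⟩
      · rw [mem_erase, mem_nbrs] at hx
        exact mem_nbrs.2 ⟨hx.1.symm, huv.ne, hx.2.ne', Or.inr (Or.inl ⟨rfl, hx.2⟩)⟩
      · obtain ⟨h1, -, -, h | ⟨-, h⟩ | ⟨h, -⟩⟩ := mem_nbrs.1 hx
        · exact mem_union_left _ (mem_nbrs.2 h)
        · exact mem_union_right _ (mem_nbrs.2 h)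
        · exact absurd h.symm h1
    have hNc : N.card ≤ 2 * d := by
      obtain ⟨-, ⟨-, h1, h2⟩, -⟩ := mem_filter.1 hG₀
      have := (card_le_card (hNsub G₀ hG₀).2.2).trans (card_union_le _ _)
      omega
    have hle : A.card ≤ (N.powerset ×ˢ N.powerset).card := by
      refine card_le_card_of_injOn (fun G => ((nbrs G u).erase v, (nbrs G v).erase u)) ?_ ?_
      · intro G hG
        have := hNsub G hG
        exact mem_coe.2 (mem_product.2 ⟨mem_powerset.2 this.1, mem_powerset.2 this.2.1⟩)
      · have key : ∀ G₁ ∈ A, ∀ G₂ ∈ A, (nbrs G₁ u).erase v = (nbrs G₂ u).erase v →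
            (nbrs G₁ v).erase u = (nbrs G₂ v).erase u → G₁ ≤ G₂ := by
          intro G₁ h₁ G₂ h₂ hu hv
          obtain ⟨-, ⟨a1, -⟩, e1⟩ := mem_filter.1 h₁
          obtain ⟨-, ⟨a2, -⟩, e2⟩ := mem_filter.1 h₂
          have hu' : ∀ x, G₁.Adj u x → G₂.Adj u x := by
            intro x hx
            by_cases hxv : x = v
            · rwa [hxv]
            · have : x ∈ (nbrs G₂ u).erase v := by
                rw [← hu]; exact mem_erase.2 ⟨hxv, mem_nbrs.2 hx⟩
              exact mem_nbrs.1 (mem_of_mem_erase this)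
          have hv' : ∀ x, G₁.Adj v x → G₂.Adj v x := by
            intro x hx
            by_cases hxv : x = u
            · rw [hxv]; exact a2.symm
            · have : x ∈ (nbrs G₂ v).erase u := by
                rw [← hv]; exact mem_erase.2 ⟨hxv, mem_nbrs.2 hx⟩
              exact mem_nbrs.1 (mem_of_mem_erase this)
          intro a b hab
          by_cases hau : a = u
          · subst hau; exact hu' b hab
          by_cases hav : a = v
          · subst hav; exact hv' b hab
          by_cases hbu : b = u
          · subst hbu; exact (hu' a hab.symm).symm
          by_cases hbv : b = v
          · subst hbv; exact (hv' a hab.symm).symm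
          have : (mergeInto G₂ u v).Adj a b := by
            rw [e2, ← e1]; exact ⟨hab.ne, hav, hbv, Or.inl hab⟩
          obtain ⟨-, -, -, h | ⟨h, -⟩ | ⟨h, -⟩⟩ := this
          · exact h
          · exact absurd h hau
          · exact absurd h hbu
        intro G₁ h₁ G₂ h₂ heq
        simp only [Prod.mk.injEq] at heq
        exact le_antisymm (key G₁ h₁ G₂ h₂ heq.1 heq.2)
          (key G₂ h₂ G₁ h₁ heq.1.symm heq.2.symm)
    rw [card_product, card_powerset, ← mul_pow] at hle
    exact hle.trans (Nat.pow_le_pow_right (by norm_num) hNc)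
  exact (card_le_card hsub).trans ((card_union_le _ _).trans (Nat.add_le_add hAc hTc))

theorem card_sparseGraphs_partner_le (f : W → ι) (z : ι) (k d : ℕ) {V : Finset W} {u v : W}
    (hu : u ∈ V) : ((sparseGraphs f z k V).filter fun G => IsPartner G f d v u).card ≤
      (4 ^ (2 * d) + 1) * (sparseGraphs f z k (V.erase v)).card := by
  refine card_le_mul_card_image_of_maps_to (f := fun G => mergeInto G u v) ?_ _ ?_
  · intro G hG
    obtain ⟨h1, h2⟩ := mem_filter.1 hG
    exact mergeInto_mem_sparseGraphs hu h1 h2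
  · intro G' _
    refine (card_le_card ?_).trans (card_partner_fibre_le f d u v G')
    intro G hG
    simp only [mem_filter, mem_univ, true_and] at hG ⊢
    exact ⟨hG.1.2, hG.2⟩

theorem card_sparseGraphs_step {C : ℕ} [Fintype ι] (hC4 : 4 ≤ C)
    (hC : ∀ (G : SimpleGraph W), ¬ HasCliqueMinor G 5 → ∀ L R : Finset W, Disjoint L R →
      (∀ v ∈ L, nbrs G v ⊆ R) → Set.InjOn (nbrs G) (L : Set W) → L.card ≤ C * R.card + 1)
    (f : W → ι) (z : ι) (k : ℕ) {V : Finset W} (hA : classSize f V z ≤ k)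
    (hV : 8 * (Fintype.card ι * (C * k + 1)) ≤ V.card) :
    (sparseGraphs f z k V).card * V.card ≤ 2 * ((4 ^ (2 * (22 * (8 * C))) + 1) *
      ∑ v ∈ V, classSize f V (f v) * (sparseGraphs f z k (V.erase v)).card) := by
  set d := 22 * (8 * C)
  have h1 : (sparseGraphs f z k V).card * V.card ≤ ∑ G ∈ sparseGraphs f z k V,
      2 * (V.filter fun v => ∃ u ∈ V, IsPartner G f d v u).card := by
    rw [← smul_eq_mul]
    refine card_nsmul_le_sum _ _ _ fun G hG => ?_
    simp only [sparseGraphs, mem_filter, mem_univ, true_and] at hG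
    exact card_le_two_mul_partnered hC4 hC hG.2.1 hG.1 f z k hA hG.2.2 hV
  refine h1.trans ?_
  rw [← mul_sum]
  refine Nat.mul_le_mul_left _ ?_
  have h2 : ∀ G, (V.filter fun v => ∃ u ∈ V, IsPartner G f d v u).card ≤
      ∑ v ∈ V, ∑ u ∈ V.filter (fun u => f u = f v), if IsPartner G f d v u then 1 else 0 := by
    intro G
    rw [card_filter]
    refine sum_le_sum fun v _ => ?_
    split_ifs with h
    · obtain ⟨u, hu, hp⟩ := h
      rw [← card_filter]
      exact card_pos.2 ⟨u, mem_filter.2 ⟨mem_filter.2 ⟨hu, hp.2.1⟩, hp⟩⟩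
    · exact Nat.zero_le _
  refine (sum_le_sum fun G _ => h2 G).trans ?_
  rw [sum_comm, mul_sum]
  refine sum_le_sum fun v hv => ?_
  rw [sum_comm]
  have h3 : ∀ u ∈ V.filter (fun u => f u = f v), (∑ G ∈ sparseGraphs f z k V,
      if IsPartner G f d v u then 1 else 0) ≤
      (4 ^ (2 * d) + 1) * (sparseGraphs f z k (V.erase v)).card := by
    intro u hu
    rw [← card_filter]
    exact card_sparseGraphs_partner_le f z k d (mem_filter.1 hu).1
  refine (sum_le_card_nsmul _ _ _ h3).trans (le_of_eq ?_)
  rw [smul_eq_mul]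
  change classSize f V (f v) * _ = _
  ring

theorem card_sparseGraphs_induction {C D B : ℕ} [Fintype ι] (hC4 : 4 ≤ C)
    (hC : ∀ (G : SimpleGraph W), ¬ HasCliqueMinor G 5 → ∀ L R : Finset W, Disjoint L R →
      (∀ v ∈ L, nbrs G v ⊆ R) → Set.InjOn (nbrs G) (L : Set W) → L.card ≤ C * R.card + 1)
    (hD : D = 2 * (4 ^ (2 * (22 * (8 * C))) + 1))
    (f : W → ι) (z : ι) (k : ℕ)
    (hbase : ∀ V : Finset W, V.card < 8 * (Fintype.card ι * (C * k + 1)) →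
      (sparseGraphs f z k V).card ≤ B * D ^ V.card * ∏ i, (classSize f V i).factorial)
    (V : Finset W) (hA : classSize f V z ≤ k) :
    (sparseGraphs f z k V).card ≤ B * D ^ V.card * ∏ i, (classSize f V i).factorial := by
  induction hn : V.card generalizing V with
  | zero =>
    rw [← hn]
    refine hbase V ?_
    have : 0 < Fintype.card ι := Fintype.card_pos_iff.2 ⟨z⟩
    rw [hn]; positivity
  | succ n ih =>
    by_cases hlt : V.card < 8 * (Fintype.card ι * (C * k + 1))
    · rw [← hn]; exact hbase V hlt
    · have h1 := card_sparseGraphs_step hC4 hC f z k hA (not_lt.1 hlt)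
      have h2 : ∀ v ∈ V, classSize f V (f v) * (sparseGraphs f z k (V.erase v)).card ≤
          B * D ^ n * ∏ i, (classSize f V i).factorial := by
        intro v hv
        have h3 := ih (V.erase v) ((card_le_card (filter_subset_filter _ (erase_subset _ _))).trans
            hA)
          (by rw [card_erase_of_mem hv]; omega)
        calc _ ≤ classSize f V (f v) * (B * D ^ n * ∏ i, (classSize f (V.erase v) i).factorial) :=
              Nat.mul_le_mul_left _ h3
          _ = B * D ^ n * (classSize f V (f v) * ∏ i, (classSize f (V.erase v) i).factorial) := by
              ring
          _ = _ := by rw [prod_factorial_erase f hv]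
      have h4 := sum_le_card_nsmul V _ _ h2
      rw [← mul_assoc, ← hD] at h1
      have h5 : (sparseGraphs f z k V).card * V.card ≤
          (B * D ^ (n + 1) * ∏ i, (classSize f V i).factorial) * V.card := by
        refine h1.trans ((Nat.mul_le_mul_left _ h4).trans (le_of_eq ?_))
        rw [smul_eq_mul]; ring
      exact Nat.le_of_mul_le_mul_right h5 (by omega)

theorem card_supportedOn_le (V : Finset W) :
    (univ.filter fun G : SimpleGraph W => SupportedOn G V).card ≤ 2 ^ (V.card * V.card) := by
  rw [← card_product, ← card_powerset]
  refine card_le_card_of_injOn (fun G => (V ×ˢ V).filter fun p => G.Adj p.1 p.2) ?_ ?_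
  · intro G _
    exact mem_coe.2 (mem_powerset.2 (filter_subset _ _))
  · intro G₁ h₁ G₂ h₂ heq
    simp only [coe_filter, mem_univ, true_and, Set.mem_ofPred_eq] at h₁ h₂
    simp only at heq
    ext a b
    have := Finset.ext_iff.1 heq (a, b)
    simp only [mem_filter, mem_product] at this
    constructor
    · intro h; exact (this.1 ⟨⟨h₁ _ _ h, h₁ _ _ h.symm⟩, h⟩).2
    · intro h; exact (this.2 ⟨⟨h₂ _ _ h, h₂ _ _ h.symm⟩, h⟩).2

end Counting

theorem exists_card_sparseGraphs_le : ∃ C D B : ℕ, ∀ (W ι : Type) [Fintype W] [Fintype ι]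
    (f : W → ι) (z : ι) (k : ℕ), classSize f univ z ≤ k →
    (sparseGraphs f z k univ).card ≤ B * Fintype.card ι ^ (8 * (Fintype.card ι * (C * k + 1))) *
      D ^ Fintype.card W * ∏ i, (classSize f univ i).factorial := by
  obtain ⟨C, hC4, hC⟩ := exists_twin_constant
  obtain ⟨D, hD⟩ : ∃ D, D = 2 * (4 ^ (2 * (22 * (8 * C))) + 1) := ⟨_, rfl⟩
  obtain ⟨B, hB⟩ : ∃ B, B = 2 ^ (16 * 16) := ⟨_, rfl⟩
  have hD1 : 1 ≤ D := by rw [hD]; exact Nat.succ_le_of_lt (by positivity)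
  refine ⟨C, D, B, ?_⟩
  intro W ι _ _ f z k hz
  have hone : ∀ V : Finset W, (sparseGraphs (fun _ : W => true) false 0 V).card ≤
      B * D ^ V.card * V.card.factorial := by
    intro V
    have hb : ∀ V : Finset W, ∏ i, (classSize (fun _ : W => true) V i).factorial =
        V.card.factorial := by
      intro V
      simp [classSize]
    have h1 := card_sparseGraphs_induction (B := B) hC4 (hC W) hD (fun _ : W => true) false 0 ?_ V
      (by simp [classSize])
    · rwa [hb] at h1
    · intro V hV
      simp only [Fintype.card_bool, mul_zero, zero_add] at hV
      have h1 : (sparseGraphs (fun _ : W => true) false 0 V).card ≤ 2 ^ (V.card * V.card) :=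
        (card_le_card fun G hG => by
          simp only [sparseGraphs, mem_filter, mem_univ, true_and] at hG ⊢
          exact hG.1).trans (card_supportedOn_le V)
      have h2 : 2 ^ (V.card * V.card) ≤ B := by
        rw [hB]
        exact Nat.pow_le_pow_right (by norm_num) (Nat.mul_le_mul (by omega) (by omega))
      have h3 : 1 ≤ D ^ V.card := Nat.one_le_pow _ _ hD1
      rw [hb]
      have h4 := Nat.factorial_pos V.card
      calc _ ≤ B * 1 * 1 := by omega
        _ ≤ _ := Nat.mul_le_mul (Nat.mul_le_mul_left _ h3) h4
  have hι : 1 ≤ Fintype.card ι := Fintype.card_pos_iff.2 ⟨z⟩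
  have := card_sparseGraphs_induction
    (B := B * Fintype.card ι ^ (8 * (Fintype.card ι * (C * k + 1)))) hC4 (hC W) hD f z k ?_ univ hz
  · simpa using this
  · intro V hV
    have h1 : (sparseGraphs f z k V).card ≤ (sparseGraphs (fun _ : W => true) false 0 V).card := by
      refine card_le_card fun G hG => ?_
      simp only [sparseGraphs, mem_filter, mem_univ, true_and] at hG ⊢
      exact ⟨hG.1, hG.2.1, by simp [crossPairs]⟩
    have h2 := factorial_card_le f V
    have h3 : Fintype.card ι ^ V.card ≤ Fintype.card ι ^ (8 * (Fintype.card ι * (C * k + 1))) :=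
      Nat.pow_le_pow_right hι hV.le
    calc _ ≤ B * D ^ V.card * (Fintype.card ι ^ V.card * ∏ i, (classSize f V i).factorial) :=
          h1.trans ((hone V).trans (Nat.mul_le_mul_left _ h2))
      _ = B * Fintype.card ι ^ V.card * D ^ V.card * ∏ i, (classSize f V i).factorial := by ring
      _ ≤ _ := by gcongr

/-! ### Balanced separators in graphs without a `K₅` minor -/

section Separator

variable {W : Type*} {G : SimpleGraph W}

theorem connIn_singleton (G : SimpleGraph W) (x : W) : ConnIn G {x} := by
  rintro a rfl b rfl; exact .refl

theorem ConnIn.adjoin {S : Set W} (hS : ConnIn G S) {a b : W} (ha : a ∈ S) (hab : G.Adj a b) :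
    ConnIn G (insert b S) := by
  have up : ∀ x y, Relation.ReflTransGen (fun a b => G.Adj a b ∧ b ∈ S) x y →
      Relation.ReflTransGen (fun u v => G.Adj u v ∧ v ∈ insert b S) x y := fun x y h =>
    Relation.ReflTransGen.mono (fun _ _ h => ⟨h.1, Or.inr h.2⟩) _ _ h
  have back : ∀ x ∈ insert b S,
      Relation.ReflTransGen (fun u v => G.Adj u v ∧ v ∈ insert b S) x a := by
    rintro x (rfl | hx)
    · exact .single ⟨hab.symm, Or.inr ha⟩
    · exact up _ _ (hS x hx a ha)
  rintro x hx y (rfl | hy)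
  · exact (back x hx).trans (.single ⟨hab, Or.inl rfl⟩)
  · exact (back x hx).trans (up _ _ (hS a ha y hy))

theorem ConnIn.closed_induction {S : Set W} (hS : ConnIn G S) {P : W → Prop} {a : W} (ha : a ∈ S)
    (hP : P a) (hstep : ∀ x ∈ S, ∀ y ∈ S, G.Adj x y → P x → P y) : ∀ b ∈ S, P b := by
  intro b hb
  have h := hS a ha b hb
  have : P b ∧ b ∈ S := by
    induction h with
    | refl => exact ⟨hP, ha⟩
    | tail h1 h2 ih =>
      have ih := ih (by
        rcases Relation.ReflTransGen.cases_tail h1 with h | ⟨c, -, h⟩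
        · rw [h]; exact ha
        · exact h.2)
      exact ⟨hstep _ ih.2 _ h2.2 h2.1 ih.1, h2.2⟩
  exact this.1

/-- Vertices reached within `m` breadth-first steps in `k` stacked copies of `U`, where one
starts from `A 0` in the bottom copy and moves up to copy `j + 1` at the vertices of
`A (j + 1)`. -/
def stackedBall (G : SimpleGraph W) (U : Finset W) (A : ℕ → Finset W) (k : ℕ) :
    ℕ → Finset (W × ℕ)
  | 0 => ∅
  | m + 1 => (U ×ˢ range k).filter fun p => p ∈ stackedBall G U A k m ∨ (p.2 = 0 ∧ p.1 ∈ A 0) ∨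
      (∃ v ∈ U, G.Adj v p.1 ∧ (v, p.2) ∈ stackedBall G U A k m) ∨
      (∃ j, p.2 = j + 1 ∧ p.1 ∈ A (j + 1) ∧ (p.1, j) ∈ stackedBall G U A k m)

theorem stackedBall_subset (U : Finset W) (A : ℕ → Finset W) (k m : ℕ) :
    stackedBall G U A k m ⊆ U ×ˢ range k := by
  cases m with
  | zero => exact empty_subset _
  | succ m => exact filter_subset _ _

theorem stackedBall_subset_succ (U : Finset W) (A : ℕ → Finset W) (k m : ℕ) :
    stackedBall G U A k m ⊆ stackedBall G U A k (m + 1) := fun _ hp =>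
  mem_filter.2 ⟨stackedBall_subset U A k m hp, Or.inl hp⟩

theorem exists_small_connected_of_mem_stackedBall {U : Finset W} {A : ℕ → Finset W} {k m : ℕ}
    {v : W} {i : ℕ} (h : (v, i) ∈ stackedBall G U A k m) :
    ∃ T : Finset W, T ⊆ U ∧ v ∈ T ∧ T.card ≤ m ∧ ConnIn G (T : Set W) ∧
      ∀ j ≤ i, ∃ t ∈ T, t ∈ A j := by
  induction m generalizing v i with
  | zero => exact absurd h (notMem_empty _)
  | succ m ih =>
    obtain ⟨hv, h | ⟨h1, h2⟩ | ⟨u, hu, h1, h2⟩ | ⟨j, h1, h2, h3⟩⟩ := mem_filter.1 h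
    · obtain ⟨T, h1, h2, h3, h4⟩ := ih h
      exact ⟨T, h1, h2, h3.trans (Nat.le_succ m), h4⟩
    · simp only at h1 h2
      subst h1
      refine ⟨{v}, ?_, mem_singleton_self v, by simp, by simpa using connIn_singleton G v, ?_⟩
      · simpa using (mem_product.1 hv).1
      · intro j hj
        obtain rfl : j = 0 := by omega
        exact ⟨v, mem_singleton_self v, h2⟩
    · obtain ⟨T, t1, t2, t3, t4, t5⟩ := ih h2
      refine ⟨insert v T, ?_, mem_insert_self _ _, ?_, ?_, ?_⟩
      · exact insert_subset (mem_product.1 hv).1 t1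
      · exact (card_insert_le _ _).trans (by omega)
      · rw [coe_insert]; exact t4.adjoin (mem_coe.2 t2) h1
      · intro j hj
        obtain ⟨t, ht, htA⟩ := t5 j hj
        exact ⟨t, mem_insert_of_mem ht, htA⟩
    · simp only at h1 h2 h3
      obtain ⟨T, t1, t2, t3, t4, t5⟩ := ih h3
      refine ⟨T, t1, t2, t3.trans (Nat.le_succ m), t4, fun l hl => ?_⟩
      by_cases hlj : l ≤ j
      · exact t5 l hlj
      · obtain rfl : l = j + 1 := by omega
        exact ⟨v, t2, h2⟩

theorem exists_tree_or_separator (G : SimpleGraph W) (U : Finset W) (A : ℕ → Finset W) (k r : ℕ)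
    (hk : 1 ≤ k) (hr : 1 ≤ r) :
    (∃ T : Finset W, T ⊆ U ∧ T.Nonempty ∧ T.card ≤ r ∧ ConnIn G (T : Set W) ∧
      ∀ j ≤ k, ∃ t ∈ T, t ∈ A j) ∨
    (∃ Z : Finset W, Z ⊆ U ∧ r * Z.card ≤ k * U.card ∧ ∀ D : Finset W, D ⊆ U → Disjoint D Z →
      ConnIn G (D : Set W) → ∃ j ≤ k, ∀ t ∈ D, t ∉ A j) := by
  by_cases hex : ∃ v, (v, k - 1) ∈ stackedBall G U A k r ∧ v ∈ A k
  · left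
    obtain ⟨v, hv, hvA⟩ := hex
    obtain ⟨T, h1, h2, h3, h4, h5⟩ := exists_small_connected_of_mem_stackedBall hv
    refine ⟨T, h1, ⟨v, h2⟩, h3, h4, fun j hj => ?_⟩
    by_cases hjk : j ≤ k - 1
    · exact h5 j hjk
    · obtain rfl : j = k := by omega
      exact ⟨v, h2, hvA⟩
  · right
    push Not at hex
    have hsum : ∀ m, ∑ i ∈ range m, (stackedBall G U A k (i + 1) \ stackedBall G U A k i).card =
        (stackedBall G U A k m).card := by
      intro m
      induction m with
      | zero => simp [stackedBall]
      | succ m ih =>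
        rw [sum_range_succ, ih, card_sdiff_of_subset (stackedBall_subset_succ U A k m)]
        have := card_le_card (stackedBall_subset_succ (G := G) U A k m)
        omega
    obtain ⟨m, hm, hle⟩ : ∃ m ∈ range r,
        r * (stackedBall G U A k (m + 1) \ stackedBall G U A k m).card ≤ k * U.card := by
      by_contra! hlt
      have h1 : ∑ i ∈ range r, k * U.card <
          ∑ i ∈ range r, r * (stackedBall G U A k (i + 1) \ stackedBall G U A k i).card :=
        sum_lt_sum_of_nonempty ⟨0, mem_range.2 hr⟩ hlt
      rw [sum_const, ← mul_sum, hsum, card_range, smul_eq_mul] at h1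
      have h2 := card_le_card (stackedBall_subset (G := G) U A k r)
      rw [card_product, card_range, mul_comm U.card] at h2
      exact absurd (Nat.mul_le_mul_left r h2) (not_le.2 h1)
    have hmr : m < r := mem_range.1 hm
    have hmono : ∀ i j, i ≤ j → stackedBall G U A k i ⊆ stackedBall G U A k j := by
      intro i j hij
      induction hij with
      | refl => exact fun _ h => h
      | step _ ih => exact ih.trans (stackedBall_subset_succ U A k _)
    refine ⟨(stackedBall G U A k (m + 1) \ stackedBall G U A k m).image Prod.fst, ?_, ?_, ?_⟩
    · intro v hv
      obtain ⟨p, hp, rfl⟩ := mem_image.1 hv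
      exact (mem_product.1 (stackedBall_subset U A k _ (mem_sdiff.1 hp).1)).1
    · exact (Nat.mul_le_mul_left r card_image_le).trans hle
    · intro D hDU hDZ hD
      by_contra! hcon
      -- inside `D` the exploration never leaves the ball of radius `m`
      have back : ∀ v ∈ D, ∀ i, (v, i) ∈ stackedBall G U A k (m + 1) →
          (v, i) ∈ stackedBall G U A k m := by
        intro v hv i h
        by_contra hn
        exact disjoint_left.1 hDZ hv (mem_image.2 ⟨(v, i), mem_sdiff.2 ⟨h, hn⟩, rfl⟩)
      have spread : ∀ i < k, (∃ v ∈ D, (v, i) ∈ stackedBall G U A k m) →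
          ∀ v ∈ D, (v, i) ∈ stackedBall G U A k m := by
        rintro i hi ⟨v, hv, h⟩
        refine hD.closed_induction (P := fun v => (v, i) ∈ stackedBall G U A k m) (mem_coe.2 hv)
          h ?_
        intro x hx y hy hxy hx'
        exact back y hy i (mem_filter.2 ⟨mem_product.2 ⟨hDU hy, mem_range.2 hi⟩,
          Or.inr (Or.inr (Or.inl ⟨x, hDU hx, hxy, hx'⟩))⟩)
      have all : ∀ i < k, ∀ v ∈ D, (v, i) ∈ stackedBall G U A k m := by
        intro i
        induction i with
        | zero =>
          intro hi
          obtain ⟨t, ht, htA⟩ := hcon 0 (Nat.zero_le _)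
          refine spread 0 hi ⟨t, ht, back t ht 0 (mem_filter.2
            ⟨mem_product.2 ⟨hDU ht, mem_range.2 hi⟩, Or.inr (Or.inl ⟨rfl, htA⟩)⟩)⟩
        | succ i ih =>
          intro hi
          obtain ⟨t, ht, htA⟩ := hcon (i + 1) hi.le
          refine spread (i + 1) hi ⟨t, ht, back t ht _ (mem_filter.2
            ⟨mem_product.2 ⟨hDU ht, mem_range.2 hi⟩, Or.inr (Or.inr (Or.inr
              ⟨i, rfl, htA, ih (by omega) t ht⟩))⟩)⟩
      obtain ⟨t, ht, htA⟩ := hcon k le_rfl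
      exact hex t (hmono m r hmr.le (all (k - 1) (by omega) t ht)) htA

end Separator

section BalancedSeparator

variable {W : Type*} [Fintype W] {G : SimpleGraph W}

/-- `D` is a union of components of `G` induced on `S`. -/
def ClosedIn (G : SimpleGraph W) (S D : Finset W) : Prop :=
  ∀ a ∈ D, ∀ b ∈ S, G.Adj a b → b ∈ D

omit [Fintype W] in
theorem ConnIn.exists_closed {S D : Finset W} (hD : ConnIn G (D : Set W)) (hne : D.Nonempty)
    (hDS : D ⊆ S) : ∃ E, D ⊆ E ∧ E ⊆ S ∧ ConnIn G (E : Set W) ∧ ClosedIn G S E := by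
  obtain ⟨x, hx⟩ := hne
  set R : W → W → Prop := fun a b => G.Adj a b ∧ b ∈ S
  set E : Finset W := S.filter fun y => Relation.ReflTransGen R x y with hE
  have hcl : ClosedIn G S E := fun a ha b hb hab =>
    mem_filter.2 ⟨hb, (mem_filter.1 ha).2.tail ⟨hab, hb⟩⟩
  have hxE : x ∈ E := mem_filter.2 ⟨hDS hx, .refl⟩
  have out : ∀ y, Relation.ReflTransGen R x y →
      Relation.ReflTransGen (fun a b => G.Adj a b ∧ b ∈ (E : Set W)) x y ∧
      Relation.ReflTransGen (fun a b => G.Adj a b ∧ b ∈ (E : Set W)) y x ∧ y ∈ E := by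
    intro y hy
    induction hy with
    | refl => exact ⟨.refl, .refl, hxE⟩
    | tail _ h ih =>
      obtain ⟨i1, i2, i3⟩ := ih
      have hm := hcl _ i3 _ h.2 h.1
      exact ⟨i1.tail ⟨h.1, mem_coe.2 hm⟩, .head ⟨h.1.symm, mem_coe.2 i3⟩ i2, hm⟩
  refine ⟨E, fun y hy => ?_, filter_subset _ _, fun u hu v hv => ?_, hcl⟩
  · exact mem_filter.2 ⟨hDS hy, Relation.ReflTransGen.mono (fun a b h => ⟨h.1, hDS h.2⟩) _ _
      (hD x hx y hy)⟩
  · exact (out u (mem_filter.1 (mem_coe.1 hu)).2).2.1.trans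
      (out v (mem_filter.1 (mem_coe.1 hv)).2).1

omit [Fintype W] in
theorem ConnIn.subset_of_closedIn {S D E : Finset W} (hD : ConnIn G (D : Set W)) (hDS : D ⊆ S)
    (hE : ClosedIn G S E) {x : W} (hxD : x ∈ D) (hxE : x ∈ E) : D ⊆ E := fun y hy =>
  hD.closed_induction (P := fun y => y ∈ E) (mem_coe.2 hxD) hxE
    (fun a _ b hb hab ha => hE a ha b (hDS hb) hab) y hy

/-- A component of `G - X` carrying more than half of the total weight. -/
structure IsHeavy (G : SimpleGraph W) (w : W → ℕ) (X U : Finset W) : Prop where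
  disj : U ⊆ univ \ X
  conn : ConnIn G (U : Set W)
  closed : ClosedIn G (univ \ X) U
  heavy : ∑ v, w v < 2 * ∑ v ∈ U, w v

theorem exists_mem_of_heavy {w : W → ℕ} {U D : Finset W} (hU : ∑ v, w v < 2 * ∑ v ∈ U, w v)
    (hD : ∑ v, w v < 2 * ∑ v ∈ D, w v) : ∃ x ∈ U, x ∈ D := by
  by_contra! h
  have hd : Disjoint U D := disjoint_left.2 h
  have h1 := sum_union hd (f := w)
  have h2 : ∑ v ∈ U ∪ D, w v ≤ ∑ v, w v := sum_le_sum_of_subset (subset_univ _)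
  omega

/-- Four disjoint, pairwise adjacent connected sets enclosing a heavy component `U` of `G - X`
such that the separator `X` is spread evenly over them. -/
structure IsEnclosure (G : SimpleGraph W) (w : W → ℕ) (q : ℕ) (X U : Finset W)
    (C : Fin 4 → Finset W) : Prop where
  heavy : IsHeavy G w X U
  conn : ∀ i, ConnIn G (C i : Set W)
  disj : ∀ i j, i ≠ j → Disjoint (C i) (C j)
  disjU : ∀ i, Disjoint (C i) U
  adj : ∀ i j, i ≠ j → (C i).Nonempty → (C j).Nonempty → ∃ a ∈ C i, ∃ b ∈ C j, G.Adj a b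
  cover : ∀ x ∈ X, ∃ i, x ∈ C i
  small : ∀ i, (X ∩ C i).card ≤ q

theorem IsEnclosure.card_le {w : W → ℕ} {q : ℕ} {X U : Finset W} {C : Fin 4 → Finset W}
    (h : IsEnclosure G w q X U C) : X.card ≤ 4 * q := by
  have h1 : X ⊆ univ.biUnion fun i => X ∩ C i := fun x hx => by
    obtain ⟨i, hi⟩ := h.cover x hx
    exact mem_biUnion.2 ⟨i, mem_univ _, mem_inter.2 ⟨hx, hi⟩⟩
  refine (card_le_card h1).trans (card_biUnion_le.trans ?_)
  refine (sum_le_sum fun i _ => h.small i).trans ?_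
  simp

/-- The induction measure in the proof of the separator theorem. -/
def enclosureSize (U : Finset W) (C : Fin 4 → Finset W) : ℕ :=
  5 * U.card + (univ.filter fun i => (C i).Nonempty).card

/-- The vertices of `U` adjacent to `C`. -/
def outerBoundary (G : SimpleGraph W) (U C : Finset W) : Finset W :=
  U.filter fun v => ∃ a ∈ C, G.Adj a v

theorem IsEnclosure.exists_smaller {w : W → ℕ} {q : ℕ} (hq : 1 ≤ q)
    (hW : 3 * Fintype.card W ≤ q * q) (hG : ¬ HasCliqueMinor G 5)
    (hheavy : ∀ X : Finset W, X.card ≤ 5 * q → ∃ U, IsHeavy G w X U)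
    {X U : Finset W} {C : Fin 4 → Finset W} (h : IsEnclosure G w q X U C) :
    ∃ X' U' C', IsEnclosure G w q X' U' C' ∧ enclosureSize U' C' < enclosureSize U C := by
  have hXU : ∀ x ∈ X, x ∉ U := fun x hx hxU => (mem_sdiff.1 (h.heavy.disj hxU)).2 hx
  have hCU : ∀ i, ∀ x ∈ C i, x ∉ U := fun i => disjoint_left.1 (h.disjU i)
  have hCC : ∀ i j, i ≠ j → ∀ x ∈ C i, x ∉ C j := fun i j hij => disjoint_left.1 (h.disj i j hij)
  by_cases hA : ∃ i, (C i).Nonempty ∧ outerBoundary G U (C i) = ∅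
  · obtain ⟨i, hi, hAi⟩ := hA
    refine ⟨X \ C i, U, Function.update C i ∅, ⟨⟨?_, h.heavy.conn, ?_, h.heavy.heavy⟩,
      ?_, ?_, ?_, ?_, ?_, ?_⟩, ?_⟩
    · exact h.heavy.disj.trans (sdiff_subset_sdiff (Subset.refl _) sdiff_subset)
    · intro a ha b hb hab
      by_cases hbX : b ∈ X
      · have hbC : b ∈ C i := by
          by_contra hn
          exact (mem_sdiff.1 hb).2 (mem_sdiff.2 ⟨hbX, hn⟩)
        have : a ∈ outerBoundary G U (C i) := mem_filter.2 ⟨ha, b, hbC, hab.symm⟩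
        rw [hAi] at this
        exact absurd this (notMem_empty _)
      · exact h.heavy.closed a ha b (mem_sdiff.2 ⟨mem_univ _, hbX⟩) hab
    · intro j
      by_cases hj : j = i
      · subst hj; simp [ConnIn]
      · rw [Function.update_of_ne hj]; exact h.conn j
    · intro j k hjk
      by_cases hj : j = i
      · subst hj; simp
      · by_cases hk : k = i
        · subst hk; simp
        · rw [Function.update_of_ne hj, Function.update_of_ne hk]; exact h.disj j k hjk
    · intro j
      by_cases hj : j = i
      · subst hj; simp
      · rw [Function.update_of_ne hj]; exact h.disjU j
    · intro j k hjk hjn hkn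
      by_cases hj : j = i
      · subst hj; simp at hjn
      · by_cases hk : k = i
        · subst hk; simp at hkn
        · rw [Function.update_of_ne hj] at hjn ⊢
          rw [Function.update_of_ne hk] at hkn ⊢
          exact h.adj j k hjk hjn hkn
    · intro x hx
      obtain ⟨hxX, hxi⟩ := mem_sdiff.1 hx
      obtain ⟨j, hj⟩ := h.cover x hxX
      have : j ≠ i := by rintro rfl; exact hxi hj
      exact ⟨j, by rwa [Function.update_of_ne this]⟩
    · intro j
      by_cases hj : j = i
      · subst hj; simp
      · rw [Function.update_of_ne hj]
        exact (card_le_card (inter_subset_inter sdiff_subset (Subset.refl _))).trans (h.small j)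
    · unfold enclosureSize
      refine Nat.add_lt_add_left (card_lt_card ?_) _
      refine (ssubset_iff_of_subset ?_).2 ⟨i, by simpa using hi, by simp⟩
      intro j hj
      rw [mem_filter] at hj ⊢
      refine ⟨mem_univ _, ?_⟩
      by_cases hji : j = i
      · subst hji; simp at hj
      · simpa [Function.update_of_ne hji] using hj.2
  push Not at hA
  set A : ℕ → Finset W := fun j => if hj : j < 4 then
    (if (C ⟨j, hj⟩).Nonempty then outerBoundary G U (C ⟨j, hj⟩) else U) else U with hAdef
  have hAi : ∀ i : Fin 4, (C i).Nonempty → A i = outerBoundary G U (C i) := by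
    intro i hi
    simp [hAdef, hi]
  have hAU : ∀ j, A j ⊆ U := by
    intro j
    simp only [hAdef]
    split_ifs
    · exact filter_subset _ _
    · exact Subset.refl _
    · exact Subset.refl _
  rcases exists_tree_or_separator G U A 3 q (by norm_num) hq with
    ⟨T, hTU, hTne, hTq, hT, hTA⟩ | ⟨Z, hZU, hZq, hZ⟩
  · have hTadj : ∀ i, (C i).Nonempty → ∃ a ∈ C i, ∃ b ∈ T, G.Adj a b := by
      intro i hi
      obtain ⟨t, ht, htA⟩ := hTA i (by have := i.2; omega)
      rw [hAi i hi] at htA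
      obtain ⟨a, ha, hat⟩ := (mem_filter.1 htA).2
      exact ⟨a, ha, t, ht, hat⟩
    have hTC : ∀ i, Disjoint (C i) T := fun i =>
      disjoint_of_subset_right hTU (h.disjU i)
    by_cases hall : ∀ i, (C i).Nonempty
    · refine absurd ?_ hG
      refine ⟨Fin.cons (T : Set W) fun i => (C i : Set W), ?_, ?_, ?_, ?_⟩
      · intro i
        refine Fin.cases ?_ (fun j => ?_) i
        · simpa using hTne
        · simpa using hall j
      · intro i
        refine Fin.cases ?_ (fun j => ?_) i
        · simpa using hT
        · simpa using h.conn j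
      · intro i j
        refine Fin.cases ?_ (fun i => ?_) i <;> refine Fin.cases ?_ (fun j => ?_) j
        · simp
        · intro _; simpa using (hTC j).symm
        · intro _; simpa using hTC i
        · intro hij; simpa using h.disj i j (by rintro rfl; exact hij rfl)
      · intro i j
        refine Fin.cases ?_ (fun i => ?_) i <;> refine Fin.cases ?_ (fun j => ?_) j
        · simp
        · intro _
          obtain ⟨a, ha, b, hb, hab⟩ := hTadj j (hall j)
          exact ⟨b, by simpa using hb, a, by simpa using ha, hab.symm⟩
        · intro _
          obtain ⟨a, ha, b, hb, hab⟩ := hTadj i (hall i)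
          exact ⟨a, by simpa using ha, b, by simpa using hb, hab⟩
        · intro hij
          obtain ⟨a, ha, b, hb, hab⟩ :=
            h.adj i j (by rintro rfl; exact hij rfl) (hall i) (hall j)
          exact ⟨a, by simpa using ha, b, by simpa using hb, hab⟩
    · push Not at hall
      obtain ⟨i, hi⟩ := hall
      have hXT : ∀ x ∈ X, x ∉ T := fun x hx hxT => hXU x hx (hTU hxT)
      obtain ⟨D, hD⟩ := hheavy (X ∪ T) ((card_union_le _ _).trans (by
        have := h.card_le; omega))
      have hDX : D ⊆ univ \ X :=
        hD.disj.trans (sdiff_subset_sdiff (Subset.refl _) subset_union_left)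
      obtain ⟨x, hxU, hxD⟩ := exists_mem_of_heavy h.heavy.heavy hD.heavy
      have hDU : D ⊆ U := hD.conn.subset_of_closedIn hDX h.heavy.closed hxD hxU
      have hDT : ∀ x ∈ D, x ∉ T := fun x hx hxT =>
        (mem_sdiff.1 (hD.disj hx)).2 (mem_union_right _ hxT)
      refine ⟨X ∪ T, D, Function.update C i T, ⟨hD, ?_, ?_, ?_, ?_, ?_, ?_⟩, ?_⟩
      · intro j
        by_cases hj : j = i
        · subst hj; simpa using hT
        · rw [Function.update_of_ne hj]; exact h.conn j
      · intro j k hjk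
        by_cases hj : j = i
        · subst hj
          rw [Function.update_self, Function.update_of_ne (Ne.symm hjk)]
          exact (hTC k).symm
        · rw [Function.update_of_ne hj]
          by_cases hk : k = i
          · subst hk; rw [Function.update_self]; exact hTC j
          · rw [Function.update_of_ne hk]; exact h.disj j k hjk
      · intro j
        by_cases hj : j = i
        · subst hj; rw [Function.update_self]
          exact disjoint_left.2 fun x hx hxD => hDT x hxD hx
        · rw [Function.update_of_ne hj]; exact disjoint_of_subset_right hDU (h.disjU j)
      · intro j k hjk hjn hkn
        by_cases hj : j = i
        · subst hj
          rw [Function.update_of_ne (Ne.symm hjk)] at hkn ⊢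
          rw [Function.update_self]
          obtain ⟨a, ha, b, hb, hab⟩ := hTadj k hkn
          exact ⟨b, hb, a, ha, hab.symm⟩
        · rw [Function.update_of_ne hj] at hjn ⊢
          by_cases hk : k = i
          · subst hk; rw [Function.update_self]; exact hTadj j hjn
          · rw [Function.update_of_ne hk] at hkn ⊢; exact h.adj j k hjk hjn hkn
      · intro x hx
        rcases mem_union.1 hx with hx | hx
        · obtain ⟨j, hj⟩ := h.cover x hx
          have : j ≠ i := by
            rintro rfl; rw [hi] at hj
            exact notMem_empty _ hj
          exact ⟨j, by rwa [Function.update_of_ne this]⟩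
        · exact ⟨i, by rwa [Function.update_self]⟩
      · intro j
        by_cases hj : j = i
        · subst hj; rw [Function.update_self]
          exact (card_le_card inter_subset_right).trans hTq
        · rw [Function.update_of_ne hj]
          refine (card_le_card fun x hx => ?_).trans (h.small j)
          obtain ⟨h1, h2⟩ := mem_inter.1 hx
          refine mem_inter.2 ⟨(mem_union.1 h1).resolve_right fun h3 => ?_, h2⟩
          exact disjoint_left.1 (hTC j) h2 h3
      · unfold enclosureSize
        have h1 : D.card < U.card := by
          obtain ⟨t, ht⟩ := hTne
          exact card_lt_card ((ssubset_iff_of_subset hDU).2 ⟨t, hTU ht, fun h => hDT t h ht⟩)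
        have h2 : (univ.filter fun j => (Function.update C i T j).Nonempty).card ≤ 4 :=
          (card_le_univ _).trans (by simp)
        omega
  · have hZq' : Z.card ≤ q := by
      have h1 : U.card ≤ Fintype.card W := card_le_univ _
      exact Nat.le_of_mul_le_mul_left (hZq.trans ((Nat.mul_le_mul_left 3 h1).trans hW)) hq
    obtain ⟨D, hD⟩ := hheavy (X ∪ Z) ((card_union_le _ _).trans (by
      have := h.card_le; omega))
    have hDX : D ⊆ univ \ X := hD.disj.trans (sdiff_subset_sdiff (Subset.refl _) subset_union_left)
    obtain ⟨x, hxU, hxD⟩ := exists_mem_of_heavy h.heavy.heavy hD.heavy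
    have hDU : D ⊆ U := hD.conn.subset_of_closedIn hDX h.heavy.closed hxD hxU
    have hDZ : Disjoint D Z := disjoint_left.2 fun x hx hxZ =>
      (mem_sdiff.1 (hD.disj hx)).2 (mem_union_right _ hxZ)
    obtain ⟨j, hj, hDA⟩ := hZ D hDU hDZ hD.conn
    obtain ⟨i, rfl⟩ : ∃ i : Fin 4, (i : ℕ) = j := ⟨⟨j, by omega⟩, rfl⟩
    have hi : (C i).Nonempty := by
      by_contra hn
      refine hDA x hxD ?_
      simpa [hAdef, hn] using hxU
    rw [hAi i hi] at hDA
    obtain ⟨E, hCE, hES, hE, hEcl⟩ := (h.conn i).exists_closed hi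
      (subset_union_left (s₂ := U \ D))
    have hED : ∀ x ∈ E, x ∉ D := by
      intro x hx hxD
      rcases mem_union.1 (hES hx) with h1 | h1
      · exact hCU i x h1 (hDU hxD)
      · exact (mem_sdiff.1 h1).2 hxD
    have hEX : ∀ x ∈ E, x ∈ X → x ∈ C i := by
      intro x hx hxX
      rcases mem_union.1 (hES hx) with h1 | h1
      · exact h1
      · exact absurd (mem_sdiff.1 h1).1 (hXU x hxX)
    have hEC : ∀ k, k ≠ i → Disjoint E (C k) := by
      intro k hk
      refine disjoint_left.2 fun x hx hxk => ?_
      rcases mem_union.1 (hES hx) with h1 | h1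
      · exact hCC k i hk x hxk h1
      · exact hCU k x hxk (mem_sdiff.1 h1).1
    have hclosed : ClosedIn G (univ \ (X \ C i ∪ Z ∩ E)) (U \ E) := by
      intro a ha b hb hab
      obtain ⟨haU, haE⟩ := mem_sdiff.1 ha
      have hb' : b ∉ X \ C i ∪ Z ∩ E := (mem_sdiff.1 hb).2
      rw [mem_union, mem_sdiff, mem_inter] at hb'
      have hbE : b ∉ E := by
        intro hbE
        by_cases haD : a ∈ D
        · rcases mem_union.1 (hES hbE) with h1 | h1
          · exact hDA a haD (mem_filter.2 ⟨haU, b, h1, hab.symm⟩)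
          · refine (mem_sdiff.1 h1).2 (hD.closed a haD b (mem_sdiff.2 ⟨mem_univ _, ?_⟩) hab)
            intro hn
            rcases mem_union.1 hn with h2 | h2
            · exact hXU b h2 (mem_sdiff.1 h1).1
            · exact hb' (Or.inr ⟨h2, hbE⟩)
        · exact haE (hEcl b hbE a (mem_union_right _ (mem_sdiff.2 ⟨haU, haD⟩)) hab.symm)
      have hbX : b ∉ X := fun hbX => hb' (Or.inl ⟨hbX, fun h1 => hbE (hCE h1)⟩)
      exact mem_sdiff.2 ⟨h.heavy.closed a haU b (mem_sdiff.2 ⟨mem_univ _, hbX⟩) hab, hbE⟩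
    have hsmall : ∀ k, ((X \ C i ∪ Z ∩ E) ∩ Function.update C i E k).card ≤ q := by
      intro k
      by_cases hk : k = i
      · subst hk
        rw [Function.update_self]
        refine (card_le_card fun x hx => ?_).trans hZq'
        obtain ⟨h1, h2⟩ := mem_inter.1 hx
        rcases mem_union.1 h1 with h3 | h3
        · exact absurd (hEX x h2 (mem_sdiff.1 h3).1) (mem_sdiff.1 h3).2
        · exact (mem_inter.1 h3).1
      · rw [Function.update_of_ne hk]
        refine (card_le_card fun x hx => ?_).trans (h.small k)
        obtain ⟨h1, h2⟩ := mem_inter.1 hx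
        rcases mem_union.1 h1 with h3 | h3
        · exact mem_inter.2 ⟨(mem_sdiff.1 h3).1, h2⟩
        · exact absurd (hZU (mem_inter.1 h3).1) (hCU k x h2)
    have hcard : (X \ C i ∪ Z ∩ E).card ≤ 5 * q := by
      refine (card_union_le _ _).trans ?_
      have h1 : (X \ C i).card ≤ X.card := card_le_card sdiff_subset
      have h2 : (Z ∩ E).card ≤ Z.card := card_le_card inter_subset_left
      have := h.card_le
      omega
    obtain ⟨F, hF⟩ := hheavy _ hcard
    obtain ⟨y, hyD, hyF⟩ := exists_mem_of_heavy hD.heavy hF.heavy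
    have hFU : F ⊆ U \ E := hF.conn.subset_of_closedIn hF.disj hclosed hyF
      (mem_sdiff.2 ⟨hDU hyD, fun h1 => hED y h1 hyD⟩)
    refine ⟨_, F, Function.update C i E, ⟨hF, ?_, ?_, ?_, ?_, ?_, hsmall⟩, ?_⟩
    · intro k
      by_cases hk : k = i
      · subst hk; simpa using hE
      · rw [Function.update_of_ne hk]; exact h.conn k
    · intro k l hkl
      by_cases hk : k = i
      · subst hk
        rw [Function.update_self, Function.update_of_ne (Ne.symm hkl)]
        exact hEC l (Ne.symm hkl)
      · rw [Function.update_of_ne hk]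
        by_cases hl : l = i
        · subst hl; rw [Function.update_self]; exact (hEC k hk).symm
        · rw [Function.update_of_ne hl]; exact h.disj k l hkl
    · intro k
      by_cases hk : k = i
      · subst hk; rw [Function.update_self]
        exact disjoint_left.2 fun x hx hxF => (mem_sdiff.1 (hFU hxF)).2 hx
      · rw [Function.update_of_ne hk]
        exact disjoint_of_subset_right (hFU.trans sdiff_subset) (h.disjU k)
    · intro k l hkl hkn hln
      by_cases hk : k = i
      · subst hk
        rw [Function.update_of_ne (Ne.symm hkl)] at hln ⊢
        rw [Function.update_self]
        obtain ⟨a, ha, b, hb, hab⟩ := h.adj k l hkl hi hln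
        exact ⟨a, hCE ha, b, hb, hab⟩
      · rw [Function.update_of_ne hk] at hkn ⊢
        by_cases hl : l = i
        · subst hl; rw [Function.update_self]
          obtain ⟨a, ha, b, hb, hab⟩ := h.adj k l hkl hkn hi
          exact ⟨a, ha, b, hCE hb, hab⟩
        · rw [Function.update_of_ne hl] at hln ⊢; exact h.adj k l hkl hkn hln
    · intro x hx
      rcases mem_union.1 hx with hx | hx
      · obtain ⟨hxX, hxi⟩ := mem_sdiff.1 hx
        obtain ⟨k, hk⟩ := h.cover x hxX
        have : k ≠ i := by rintro rfl; exact hxi hk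
        exact ⟨k, by rwa [Function.update_of_ne this]⟩
      · exact ⟨i, by rw [Function.update_self]; exact (mem_inter.1 hx).2⟩
    · unfold enclosureSize
      have h1 : F.card < U.card := by
        obtain ⟨a, ha⟩ := hA i hi
        obtain ⟨haU, c, hc, hca⟩ := mem_filter.1 ha
        have haD : a ∉ D := fun haD => hDA a haD ha
        have haE : a ∈ E := hEcl c (hCE hc) a (mem_union_right _ (mem_sdiff.2 ⟨haU, haD⟩)) hca
        exact card_lt_card ((ssubset_iff_of_subset (hFU.trans sdiff_subset)).2
          ⟨a, haU, fun h1 => (mem_sdiff.1 (hFU h1)).2 haE⟩)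
      have h2 : (univ.filter fun j => (Function.update C i E j).Nonempty).card ≤ 4 :=
        (card_le_univ _).trans (by simp)
      omega

/-- A graph without `K₅` minor has balanced separators of order `√|W|` (Alon–Seymour–Thomas). -/
theorem exists_balanced_separator {q : ℕ} (hq : 1 ≤ q) (hW : 3 * Fintype.card W ≤ q * q)
    (hG : ¬ HasCliqueMinor G 5) (w : W → ℕ) :
    ∃ X : Finset W, X.card ≤ 5 * q ∧ ∀ D : Finset W, Disjoint D X → ConnIn G (D : Set W) →
      2 * ∑ v ∈ D, w v ≤ ∑ v, w v := by
  by_contra! hcon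
  have hheavy : ∀ X : Finset W, X.card ≤ 5 * q → ∃ U, IsHeavy G w X U := by
    intro X hX
    obtain ⟨D, h1, h2, h3⟩ := hcon X hX
    have hne : D.Nonempty := by
      by_contra hn
      rw [not_nonempty_iff_eq_empty.1 hn] at h3
      simp at h3
    have hDX : D ⊆ univ \ X := fun x hx => mem_sdiff.2 ⟨mem_univ _, disjoint_left.1 h1 hx⟩
    obtain ⟨E, hDE, hE, hEc, hEcl⟩ := h2.exists_closed hne hDX
    exact ⟨E, hE, hEc, hEcl, h3.trans_le (Nat.mul_le_mul_left 2 (sum_le_sum_of_subset hDE))⟩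
  obtain ⟨U, hU⟩ := hheavy ∅ (by simp)
  have hstart : IsEnclosure G w q ∅ U fun _ => ∅ :=
    ⟨hU, fun i => by simp [ConnIn], by simp, by simp, by simp, by simp, by simp⟩
  have main : ∀ m, ∀ X U C, IsEnclosure G w q X U C → enclosureSize U C = m → False := by
    intro m
    induction m using Nat.strong_induction_on with
    | _ m ih =>
      rintro X U C h rfl
      obtain ⟨X', U', C', h', hlt⟩ := h.exists_smaller hq hW hG hheavy
      exact ih _ hlt X' U' C' h' rfl
  exact main _ _ _ _ hstart rfl

/-- Iterating balanced separators: removing `2 ^ j * 5 q` vertices leaves components of weight at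
most a `2 ^ j`-th of the total. -/
theorem exists_iterated_separator {q : ℕ} (hq : 1 ≤ q) (hW : 3 * Fintype.card W ≤ q * q)
    (hG : ¬ HasCliqueMinor G 5) (w : W → ℕ) (j : ℕ) :
    ∃ X : Finset W, X.card ≤ 2 ^ (j + 1) * (5 * q) ∧ ∀ D : Finset W, Disjoint D X →
      ConnIn G (D : Set W) → 2 ^ j * ∑ v ∈ D, w v ≤ ∑ v, w v := by
  induction j with
  | zero =>
    exact ⟨∅, by simp, fun D _ _ => by simpa using sum_le_sum_of_subset (subset_univ D)⟩
  | succ j ih =>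
    obtain ⟨X, hX, hXD⟩ := ih
    by_cases htot : ∑ v, w v = 0
    · refine ⟨∅, by simp, fun D _ _ => ?_⟩
      have : ∑ v ∈ D, w v ≤ ∑ v, w v := sum_le_sum_of_subset (subset_univ D)
      rw [htot] at this ⊢
      rw [Nat.le_zero.1 this]; simp
    -- the components of `G - X` that are still too heavy
    set H : Finset (Finset W) := univ.filter fun D => D ⊆ univ \ X ∧ ConnIn G (D : Set W) ∧
      ClosedIn G (univ \ X) D ∧ ∑ v, w v < 2 ^ (j + 1) * ∑ v ∈ D, w v with hH
    have hdisj : ∀ D ∈ H, ∀ E ∈ H, D ≠ E → Disjoint D E := by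
      intro D hD E hE hne
      obtain ⟨-, d1, d2, d3, -⟩ := mem_filter.1 hD
      obtain ⟨-, e1, e2, e3, -⟩ := mem_filter.1 hE
      refine disjoint_left.2 fun x hxD hxE => hne (Subset.antisymm ?_ ?_)
      · exact d2.subset_of_closedIn d1 e3 hxD hxE
      · exact e2.subset_of_closedIn e1 d3 hxE hxD
    have hHcard : H.card ≤ 2 ^ (j + 1) := by
      have h1 : ∑ D ∈ H, ∑ v ∈ D, w v ≤ ∑ v, w v := by
        rw [← sum_biUnion (fun D hD E hE hne => hdisj D hD E hE hne)]
        exact sum_le_sum_of_subset (subset_univ _)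
      have h2 : H.card * ∑ v, w v ≤ 2 ^ (j + 1) * ∑ v, w v := by
        refine le_trans ?_ (Nat.mul_le_mul_left _ h1)
        have h3 : ∑ D ∈ H, ∑ v, w v ≤ ∑ D ∈ H, 2 ^ (j + 1) * ∑ v ∈ D, w v :=
          sum_le_sum fun D hD => (mem_filter.1 hD).2.2.2.2.le
        rwa [sum_const, smul_eq_mul, ← mul_sum] at h3
      exact Nat.le_of_mul_le_mul_right h2 (Nat.pos_of_ne_zero htot)
    choose S hS hSD using fun D : Finset W =>
      exists_balanced_separator hq hW hG fun v => if v ∈ D then w v else 0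
    refine ⟨X ∪ H.biUnion S, ?_, ?_⟩
    · refine (card_union_le _ _).trans ?_
      have h1 : (H.biUnion S).card ≤ H.card * (5 * q) :=
        card_biUnion_le.trans ((sum_le_sum fun D _ => hS D).trans (by simp))
      have h2 := Nat.mul_le_mul_right (5 * q) hHcard
      have h3 : 2 ^ (j + 1 + 1) * (5 * q) = 2 ^ (j + 1) * (5 * q) + 2 ^ (j + 1) * (5 * q) := by ring
      omega
    · intro D hD hDc
      by_cases hne : D.Nonempty
      swap
      · rw [not_nonempty_iff_eq_empty.1 hne]; simp
      have hDX : D ⊆ univ \ X := fun x hx => mem_sdiff.2 ⟨mem_univ _, fun h =>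
        disjoint_left.1 hD hx (mem_union_left _ h)⟩
      obtain ⟨E, hDE, hE, hEc, hEcl⟩ := hDc.exists_closed hne hDX
      have hEX : Disjoint E X := disjoint_left.2 fun x hx => (mem_sdiff.1 (hE hx)).2
      have hEw := hXD E hEX hEc
      by_cases hlt : ∑ v, w v < 2 ^ (j + 1) * ∑ v ∈ E, w v
      · have hEH : E ∈ H := mem_filter.2 ⟨mem_univ _, hE, hEc, hEcl, hlt⟩
        have h1 := hSD E D (disjoint_left.2 fun x hx h =>
          disjoint_left.1 hD hx (mem_union_right _ (mem_biUnion.2 ⟨E, hEH, h⟩))) hDc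
        have h2 : ∑ v ∈ D, (if v ∈ E then w v else 0) = ∑ v ∈ D, w v :=
          sum_congr rfl fun v hv => if_pos (hDE hv)
        have h3 : ∑ v, (if v ∈ E then w v else 0) = ∑ v ∈ E, w v := by
          rw [← sum_filter]; simp
        rw [h2, h3] at h1
        calc 2 ^ (j + 1) * ∑ v ∈ D, w v = 2 ^ j * (2 * ∑ v ∈ D, w v) := by ring
          _ ≤ 2 ^ j * ∑ v ∈ E, w v := Nat.mul_le_mul_left _ h1
          _ ≤ _ := hEw
      · exact (Nat.mul_le_mul_left _ (sum_le_sum_of_subset hDE)).trans (not_lt.1 hlt)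

end BalancedSeparator

/-! ### Counting noncrossing partitions of a planar point set -/

section Noncrossing

variable {ι : Type*} {pt : ι → ℝ × ℝ}

/-- `r` is an equivalence relation on `V` such that chords of distinct classes do not meet. -/
structure IsNoncrossing (pt : ι → ℝ × ℝ) (V : Finset ι) (r : ι → ι → Prop) : Prop where
  supp : ∀ u v, r u v → u ∈ V
  refl : ∀ v ∈ V, r v v
  symm : ∀ u v, r u v → r v u
  trans : ∀ u v w, r u v → r v w → r u w
  cross : ∀ a b c d z, r a b → r c d → z ∈ segment ℝ (pt a) (pt b) →
    z ∈ segment ℝ (pt c) (pt d) → r a c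

/-- `a` and `b` are consecutive elements (from left to right) of a class of `r`. -/
structure IsEdge (pt : ι → ℝ × ℝ) (r : ι → ι → Prop) (a b : ι) : Prop where
  rel : r a b
  lt : (pt a).1 < (pt b).1
  next : ∀ v, r a v → (pt a).1 < (pt v).1 → (pt v).1 < (pt b).1 → False

/-- The relation `r` with the element `p` removed. -/
def removeElt (r : ι → ι → Prop) (p : ι) : ι → ι → Prop := fun u v => r u v ∧ u ≠ p ∧ v ≠ p

/-- `y` lies strictly between `s` and `t`. -/
def StrictBtw (y s t : ℝ) : Prop := s < y ∧ y < t ∨ t < y ∧ y < s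

/-- The point `v` sees the chord from `l` to `p` in the vertical direction. -/
def Sees (pt : ι → ℝ × ℝ) (r : ι → ι → Prop) (p l v : ι) : Prop :=
  (pt l).1 < (pt v).1 ∧ (pt v).1 < (pt p).1 ∧ ∀ a b, IsEdge pt r a b →
    (pt a).1 < (pt v).1 → (pt v).1 < (pt b).1 →
    ¬ StrictBtw (lineHeight (pt a) (pt b) (pt v).1) (pt v).2 (lineHeight (pt l) (pt p) (pt v).1)

theorem IsNoncrossing.removeElt {V : Finset ι} {r : ι → ι → Prop} (h : IsNoncrossing pt V r)
    (p : ι) : IsNoncrossing pt (V.erase p) (removeElt r p) where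
  supp u v huv := mem_erase.2 ⟨huv.2.1, h.supp u v huv.1⟩
  refl v hv := ⟨h.refl v (mem_erase.1 hv).2, (mem_erase.1 hv).1, (mem_erase.1 hv).1⟩
  symm u v huv := ⟨h.symm u v huv.1, huv.2.2, huv.2.1⟩
  trans u v w huv hvw := ⟨h.trans u v w huv.1 hvw.1, huv.2.1, hvw.2.2⟩
  cross a b c d z hab hcd h1 h2 := ⟨h.cross a b c d z hab.1 hcd.1 h1 h2, hab.2.1, hcd.2.1⟩

theorem IsNoncrossing.cross_height {V : Finset ι} {r : ι → ι → Prop} (h : IsNoncrossing pt V r)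
    {a b c d : ι} (hab : r a b) (hcd : r c d) (hxab : (pt a).1 < (pt b).1)
    (hxcd : (pt c).1 < (pt d).1) {x : ℝ} (h1 : (pt a).1 ≤ x) (h2 : x ≤ (pt b).1)
    (h3 : (pt c).1 ≤ x) (h4 : x ≤ (pt d).1)
    (heq : lineHeight (pt a) (pt b) x = lineHeight (pt c) (pt d) x) : r a c :=
  h.cross a b c d (x, lineHeight (pt a) (pt b) x) hab hcd
    ((mem_segment_iff_lineHeight hxab _).2 ⟨h1, h2, rfl⟩)
    ((mem_segment_iff_lineHeight hxcd _).2 ⟨h3, h4, heq⟩)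

theorem IsNoncrossing.rel_of_mem {V : Finset ι} {r : ι → ι → Prop} (h : IsNoncrossing pt V r)
    {a b v : ι} (hab : r a b) (hv : v ∈ V) (hxab : (pt a).1 < (pt b).1)
    (h1 : (pt a).1 ≤ (pt v).1) (h2 : (pt v).1 ≤ (pt b).1)
    (heq : (pt v).2 = lineHeight (pt a) (pt b) (pt v).1) : r a v :=
  h.cross a b v v (pt v) hab (h.refl v hv) ((mem_segment_iff_lineHeight hxab _).2 ⟨h1, h2, heq⟩)
    (left_mem_segment ℝ _ _)

theorem IsEdge.left_unique {V : Finset ι} {r : ι → ι → Prop} (h : IsNoncrossing pt V r)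
    (hx : Function.Injective fun i => (pt i).1) {a b c d : ι} (hab : IsEdge pt r a b)
    (hcd : IsEdge pt r c d) (hac : r a c) {x : ℝ} (h1 : (pt a).1 < x) (h2 : x ≤ (pt b).1)
    (h3 : (pt c).1 < x) (h4 : x ≤ (pt d).1) : a = c ∧ b = d := by
  have hac' : a = c := by
    apply hx
    rcases lt_trichotomy (pt a).1 (pt c).1 with h5 | h5 | h5
    · exact (hab.next c hac h5 (by linarith)).elim
    · exact h5
    · exact (hcd.next a (h.symm _ _ hac) h5 (by linarith)).elim
  subst hac'
  refine ⟨rfl, hx ?_⟩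
  rcases lt_trichotomy (pt b).1 (pt d).1 with h5 | h5 | h5
  · exact (hcd.next b hab.rel hab.lt h5).elim
  · exact h5
  · exact (hab.next d hcd.rel hcd.lt h5).elim

theorem Sees.of_removeElt {V : Finset ι} {r : ι → ι → Prop} (h : IsNoncrossing pt V r)
    (hx : Function.Injective fun i => (pt i).1) {p l v : ι} (hl : IsEdge pt r l p)
    (hs : Sees pt (removeElt r p) p l v) : Sees pt r p l v := by
  refine ⟨hs.1, hs.2.1, fun a b hab h1 h2 hbtw => ?_⟩
  by_cases hb : b = p
  · subst hb
    have hal : r a l := h.trans _ _ _ hab.rel (h.symm _ _ hl.rel)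
    obtain ⟨rfl, -⟩ := hab.left_unique h hx hl hal hab.lt le_rfl hl.lt le_rfl
    rcases hbtw with ⟨h3, h4⟩ | ⟨h3, h4⟩ <;> linarith
  · have ha : a ≠ p := by
      rintro rfl
      linarith [hs.2.1]
    exact hs.2.2 a b ⟨⟨hab.rel, ha, hb⟩, hab.lt, fun w hw => hab.next w hw.1⟩ h1 h2 hbtw

/-- The points other than `p` that see the chord from `l` to `p` after removing `p`. -/
def hits (pt : ι → ℝ × ℝ) (V : Finset ι) (r : ι → ι → Prop) (p l : ι) : Finset ι :=
  (V.erase p).filter fun v => Sees pt r p l v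

/-- The number of points of `H` to the right of `v`. -/
def rankIn (pt : ι → ℝ × ℝ) (H : Finset ι) (v : ι) : ℕ :=
  (H.filter fun w => (pt v).1 < (pt w).1).card

theorem rankIn_lt {H : Finset ι} {v : ι} (hv : v ∈ H) : rankIn pt H v < H.card :=
  card_lt_card ((ssubset_iff_of_subset (filter_subset _ _)).2
    ⟨v, hv, fun h => lt_irrefl _ (mem_filter.1 h).2⟩)

theorem rankIn_injOn (hx : Function.Injective fun i => (pt i).1) {H : Finset ι} {v w : ι}
    (hv : v ∈ H) (hw : w ∈ H) (h : rankIn pt H v = rankIn pt H w) : v = w := by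
  have key : ∀ v w, w ∈ H → (pt v).1 < (pt w).1 → rankIn pt H w < rankIn pt H v := by
    intro v w hw hlt
    refine card_lt_card ((ssubset_iff_of_subset ?_).2 ⟨w, mem_filter.2 ⟨hw, hlt⟩,
      fun h => lt_irrefl _ (mem_filter.1 h).2⟩)
    exact fun u hu => mem_filter.2 ⟨(mem_filter.1 hu).1, hlt.trans (mem_filter.1 hu).2⟩
  apply hx
  rcases lt_trichotomy (pt v).1 (pt w).1 with h1 | h1 | h1
  · have := key v w hw h1; omega
  · exact h1
  · have := key w v hv h1; omega

/-- The ranks of the hits lying above and of those lying below the chord from `l` to `p`. -/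
def sideCode (pt : ι → ℝ × ℝ) (V : Finset ι) (r : ι → ι → Prop) (p l : ι) :
    Finset ℕ × Finset ℕ :=
  (((hits pt V r p l).filter fun v => lineHeight (pt l) (pt p) (pt v).1 < (pt v).2).image
      (rankIn pt (hits pt V r p l)),
    ((hits pt V r p l).filter fun v => (pt v).2 < lineHeight (pt l) (pt p) (pt v).1).image
      (rankIn pt (hits pt V r p l)))

theorem eq_of_lineHeight_eq {a b c : ℝ × ℝ} {x y : ℝ}
    (hx : a.1 < x) (h : lineHeight a b x = lineHeight a c x) :
    lineHeight a b y = lineHeight a c y := by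
  have hx' : x - a.1 ≠ 0 := by linarith
  have : (b.2 - a.2) / (b.1 - a.1) = (c.2 - a.2) / (c.1 - a.1) := by
    simp only [lineHeight] at h
    exact mul_left_cancel₀ hx' (by linarith)
  simp only [lineHeight, this]

/-- Two different candidates for the left neighbour of `p`, with the same partition of the
other points. -/
structure TwoLeft (pt : ι → ℝ × ℝ) (V : Finset ι) (r₁ r₂ : ι → ι → Prop) (p l₁ l₂ : ι) :
    Prop where
  nc₁ : IsNoncrossing pt V r₁
  nc₂ : IsNoncrossing pt V r₂
  same : ∀ u v, u ≠ p → v ≠ p → (r₁ u v ↔ r₂ u v)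
  edge₁ : IsEdge pt r₁ l₁ p
  edge₂ : IsEdge pt r₂ l₂ p
  ne : l₁ ≠ l₂
  inj : Function.Injective fun i => (pt i).1

namespace TwoLeft

variable {V : Finset ι} {r₁ r₂ : ι → ι → Prop} {p l₁ l₂ : ι}

theorem swap (h : TwoLeft pt V r₁ r₂ p l₁ l₂) : TwoLeft pt V r₂ r₁ p l₂ l₁ :=
  ⟨h.nc₂, h.nc₁, fun u v hu hv => (h.same u v hu hv).symm, h.edge₂, h.edge₁, h.ne.symm, h.inj⟩

theorem removeElt_eq (h : TwoLeft pt V r₁ r₂ p l₁ l₂) : removeElt r₁ p = removeElt r₂ p := by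
  funext u v
  refine propext ⟨fun ⟨a, b, c⟩ => ⟨(h.same u v b c).1 a, b, c⟩,
    fun ⟨a, b, c⟩ => ⟨(h.same u v b c).2 a, b, c⟩⟩

theorem ne₁ (h : TwoLeft pt V r₁ r₂ p l₁ l₂) : l₁ ≠ p := by
  rintro rfl; exact lt_irrefl _ h.edge₁.lt

theorem not_rel (h : TwoLeft pt V r₁ r₂ p l₁ l₂) : ¬ r₁ l₁ l₂ := by
  intro h12
  have h12' := (h.same _ _ h.ne₁ h.swap.ne₁).1 h12
  rcases lt_trichotomy (pt l₁).1 (pt l₂).1 with h1 | h1 | h1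
  · exact h.edge₁.next _ h12 h1 h.edge₂.lt
  · exact h.ne (h.inj h1)
  · exact h.edge₂.next _ (h.nc₂.symm _ _ h12') h1 h.edge₁.lt

theorem not_both (h : TwoLeft pt V r₁ r₂ p l₁ l₂) {a : ι} (ha : a ≠ p) (h1 : r₁ a p)
    (h2 : r₂ a p) : False := by
  have e1 : r₁ l₁ a := h.nc₁.trans _ _ _ h.edge₁.rel (h.nc₁.symm _ _ h1)
  have e2 : r₁ a l₂ := (h.same _ _ ha h.swap.ne₁).2
    (h.nc₂.trans _ _ _ h2 (h.nc₂.symm _ _ h.edge₂.rel))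
  exact h.not_rel (h.nc₁.trans _ _ _ e1 e2)

theorem height_ne (h : TwoLeft pt V r₁ r₂ p l₁ l₂) {a b : ι} (hab : IsEdge pt (removeElt r₁ p) a b)
    {x : ℝ} (h1 : (pt a).1 < x) (h2 : x < (pt b).1) (h3 : (pt l₁).1 < x) (h4 : x < (pt p).1) :
    lineHeight (pt a) (pt b) x ≠ lineHeight (pt l₁) (pt p) x := by
  intro heq
  obtain ⟨⟨hr, hap, hbp⟩, hlt, hnext⟩ := hab
  have hal : r₁ a l₁ := h.nc₁.cross_height hr h.edge₁.rel hlt h.edge₁.lt h1.le h2.le h3.le h4.le heq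
  have hla := h.nc₁.symm _ _ hal
  obtain rfl : a = l₁ := by
    apply h.inj
    rcases lt_trichotomy (pt a).1 (pt l₁).1 with h5 | h5 | h5
    · exact (hnext l₁ ⟨hal, hap, h.ne₁⟩ h5 (by linarith)).elim
    · exact h5
    · exact (h.edge₁.next a hla h5 (by linarith)).elim
  have hpb : (pt p).1 ≤ (pt b).1 := by
    by_contra! hcon
    exact h.edge₁.next b hr hlt hcon
  have hpe := eq_of_lineHeight_eq h1 heq (y := (pt p).1)
  rw [lineHeight_right h.edge₁.lt.ne] at hpe
  have hr2 := (h.same _ _ hap hbp).1 hr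
  have hp2 : p ∈ V := h.nc₂.supp _ _ (h.nc₂.symm _ _ h.edge₂.rel)
  exact h.not_both hap h.edge₁.rel
    (h.nc₂.rel_of_mem hr2 hp2 hlt h.edge₁.lt.le hpb hpe.symm)

theorem height_ne' (h : TwoLeft pt V r₁ r₂ p l₁ l₂) {a b : ι}
    (hab : IsEdge pt (removeElt r₁ p) a b)
    {x : ℝ} (h1 : (pt a).1 < x) (h2 : x < (pt b).1) (h3 : (pt l₂).1 < x) (h4 : x < (pt p).1) :
    lineHeight (pt a) (pt b) x ≠ lineHeight (pt l₂) (pt p) x :=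
  h.swap.height_ne (h.removeElt_eq ▸ hab) h1 h2 h3 h4

theorem persist (h : TwoLeft pt V r₁ r₂ p l₁ l₂) {a b : ι} (hab : IsEdge pt (removeElt r₁ p) a b)
    {x y : ℝ} (h1 : (pt a).1 < x) (h3 : (pt l₁).1 ≤ x) (hxy : x < y)
    (hyb : y ≤ (pt b).1) (hyp : y ≤ (pt p).1) :
    (lineHeight (pt a) (pt b) x < lineHeight (pt l₁) (pt p) x →
      lineHeight (pt a) (pt b) y ≤ lineHeight (pt l₁) (pt p) y) ∧
    (lineHeight (pt l₁) (pt p) x < lineHeight (pt a) (pt b) x →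
      lineHeight (pt l₁) (pt p) y ≤ lineHeight (pt a) (pt b) y) := by
  constructor
  · intro hx
    by_contra! hy
    obtain ⟨w, w1, w2, w3⟩ := exists_lineHeight_eq hx.le hy.le
    rw [min_eq_left hxy.le] at w1
    rw [max_eq_right hxy.le] at w2
    have w4 : x ≠ w := by rintro rfl; linarith
    have w5 : w ≠ y := by rintro rfl; linarith
    have w6 := lt_of_le_of_ne w1 w4
    have w7 := lt_of_le_of_ne w2 w5
    exact h.height_ne hab (x := w) (by linarith) (by linarith) (by linarith) (by linarith) w3
  · intro hx
    by_contra! hy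
    obtain ⟨w, w1, w2, w3⟩ := exists_lineHeight_eq hx.le hy.le
    rw [min_eq_left hxy.le] at w1
    rw [max_eq_right hxy.le] at w2
    have w4 : x ≠ w := by rintro rfl; linarith
    have w5 : w ≠ y := by rintro rfl; linarith
    have w6 := lt_of_le_of_ne w1 w4
    have w7 := lt_of_le_of_ne w2 w5
    exact h.height_ne hab (x := w) (by linarith) (by linarith) (by linarith) (by linarith) w3.symm

theorem height_ne_pt (h : TwoLeft pt V r₁ r₂ p l₁ l₂) {v : ι} (hv : v ∈ V)
    (h1 : (pt l₁).1 < (pt v).1) (h2 : (pt v).1 < (pt p).1) :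
    (pt v).2 ≠ lineHeight (pt l₁) (pt p) (pt v).1 := fun heq =>
  h.edge₁.next v (h.nc₁.rel_of_mem h.edge₁.rel hv h.edge₁.lt h1.le h2.le heq) h1 h2

theorem sideCode_ne_of_lt (h : TwoLeft pt V r₁ r₂ p l₁ l₂) (hlt : (pt l₁).1 < (pt l₂).1) :
    sideCode pt V (removeElt r₁ p) p l₁ ≠ sideCode pt V (removeElt r₁ p) p l₂ := by
  intro hcode
  set r := removeElt r₁ p with hr
  set f₁ : ι → ℝ := fun v => lineHeight (pt l₁) (pt p) (pt v).1 with hf₁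
  set f₂ : ι → ℝ := fun v => lineHeight (pt l₂) (pt p) (pt v).1 with hf₂
  set Q := (V.erase p).filter fun v => (pt l₂).1 ≤ (pt v).1 ∧ (pt v).1 < (pt p).1 ∧
    (f₁ v ≤ (pt v).2 ∧ (pt v).2 ≤ f₂ v ∨ f₂ v ≤ (pt v).2 ∧ (pt v).2 ≤ f₁ v) with hQ
  have hl₂V : l₂ ∈ V.erase p := mem_erase.2 ⟨h.swap.ne₁, h.nc₂.supp _ _ h.edge₂.rel⟩
  have hl₂f : f₂ l₂ = (pt l₂).2 := lineHeight_left _ _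
  have hl₂Q : l₂ ∈ Q := by
    refine mem_filter.2 ⟨hl₂V, le_rfl, h.edge₂.lt, ?_⟩
    rw [hl₂f]
    rcases le_total (f₁ l₂) (pt l₂).2 with h1 | h1
    · exact Or.inl ⟨h1, le_rfl⟩
    · exact Or.inr ⟨le_rfl, h1⟩
  obtain ⟨s, hsQ, hsmax⟩ := exists_max_image Q (fun v => (pt v).1) ⟨l₂, hl₂Q⟩
  obtain ⟨hsV, hs1, hs2, hs3⟩ := mem_filter.1 hsQ
  have clear : ∀ a b, IsEdge pt r a b → ∀ v, (pt s).1 ≤ (pt v).1 → (pt v).1 < (pt p).1 →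
      (pt a).1 < (pt v).1 → (pt v).1 < (pt b).1 →
      ¬ StrictBtw (lineHeight (pt a) (pt b) (pt v).1) (f₁ v) (f₂ v) := by
    intro a b hab v hsv hvp hav hvb hbtw
    have hab2 : IsEdge pt (removeElt r₂ p) a b := h.removeElt_eq ▸ hab
    by_cases hbp : (pt b).1 ≤ (pt p).1
    · have hbp' : (pt b).1 < (pt p).1 := lt_of_le_of_ne hbp fun heq => hab.rel.2.2 (h.inj heq)
      have q1 := h.persist hab (x := (pt v).1) (y := (pt b).1) hav (by linarith) hvb le_rfl hbp
      have q2 := h.swap.persist hab2 (x := (pt v).1) (y := (pt b).1) hav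
        (by linarith) hvb le_rfl hbp
      rw [lineHeight_right hab.lt.ne] at q1 q2
      have hbQ : b ∈ Q := by
        refine mem_filter.2 ⟨mem_erase.2 ⟨hab.rel.2.2, h.nc₁.supp _ _ (h.nc₁.symm _ _ hab.rel.1)⟩,
          by linarith, hbp', ?_⟩
        rcases hbtw with ⟨b1, b2⟩ | ⟨b1, b2⟩
        · exact Or.inl ⟨q1.2 b1, q2.1 b2⟩
        · exact Or.inr ⟨q2.2 b1, q1.1 b2⟩
      have := hsmax b hbQ
      linarith
    · push Not at hbp
      have q1 := h.persist hab (x := (pt v).1) (y := (pt p).1) hav (by linarith) hvp hbp.le le_rfl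
      have q2 := h.swap.persist hab2 (x := (pt v).1) (y := (pt p).1) hav (by linarith) hvp hbp.le
        le_rfl
      rw [lineHeight_right h.edge₁.lt.ne] at q1
      rw [lineHeight_right h.edge₂.lt.ne] at q2
      have hp : (pt p).2 = lineHeight (pt a) (pt b) (pt p).1 := by
        rcases hbtw with ⟨b1, b2⟩ | ⟨b1, b2⟩
        · exact le_antisymm (q1.2 b1) (q2.1 b2)
        · exact le_antisymm (q2.2 b1) (q1.1 b2)
      have hpV : p ∈ V := h.nc₂.supp _ _ (h.nc₂.symm _ _ h.edge₂.rel)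
      exact h.not_both hab.rel.2.1
        (h.nc₁.rel_of_mem hab.rel.1 hpV hab.lt (by linarith) hbp.le hp)
        (h.nc₂.rel_of_mem hab2.rel.1 hpV hab.lt (by linarith) hbp.le hp)
  -- to the right of `s` the two chords see the same points, from the same sides
  have sameSide : ∀ v ∈ V.erase p, (pt s).1 < (pt v).1 → (pt v).1 < (pt p).1 →
      (f₁ v < (pt v).2 ∧ f₂ v < (pt v).2) ∨ ((pt v).2 < f₁ v ∧ (pt v).2 < f₂ v) := by
    intro v hv h1 h2
    have hvQ : v ∉ Q := fun hvQ => by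
      have := hsmax v hvQ
      linarith
    have h3 : ¬ (f₁ v ≤ (pt v).2 ∧ (pt v).2 ≤ f₂ v ∨ f₂ v ≤ (pt v).2 ∧ (pt v).2 ≤ f₁ v) :=
      fun h3 => hvQ (mem_filter.2 ⟨hv, by linarith, h2, h3⟩)
    push Not at h3
    rcases lt_trichotomy (f₁ v) (pt v).2 with h4 | h4 | h4
    · exact Or.inl ⟨h4, h3.1 h4.le⟩
    · exact absurd h4.symm (h.height_ne_pt (mem_erase.1 hv).2 (by linarith) h2)
    · refine Or.inr ⟨h4, ?_⟩
      by_contra! h5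
      exact absurd (h3.2 h5) (not_lt.2 h4.le)
  have sameHit : ∀ v ∈ V.erase p, (pt s).1 < (pt v).1 →
      (v ∈ hits pt V r p l₁ ↔ v ∈ hits pt V r p l₂) := by
    intro v hv h1
    unfold hits
    rw [mem_filter, mem_filter]
    refine and_congr_right fun _ => ?_
    unfold Sees
    refine and_congr (by constructor <;> intro <;> linarith) (and_congr_right fun h2 => ?_)
    refine forall_congr' fun a => forall_congr' fun b => forall_congr' fun hab =>
      forall_congr' fun h3 => forall_congr' fun h4 => not_congr ?_
    have c := clear a b hab v h1.le h2 h3 h4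
    have n1 := h.height_ne hab h3 h4 (by linarith) h2
    have n2 := h.height_ne' hab h3 h4 (by linarith) h2
    have sd := sameSide v hv h1 h2
    change _ ≠ f₁ v at n1
    change _ ≠ f₂ v at n2
    change StrictBtw _ _ (f₁ v) ↔ StrictBtw _ _ (f₂ v)
    unfold StrictBtw at c ⊢
    generalize lineHeight (pt a) (pt b) (pt v).1 = y at *
    rcases lt_or_gt_of_ne n1 with n1 | n1 <;> rcases lt_or_gt_of_ne n2 with n2 | n2 <;>
      rcases sd with ⟨s1, s2⟩ | ⟨s1, s2⟩
    all_goals first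
      | exact absurd (Or.inl ⟨by linarith, by linarith⟩) c
      | exact absurd (Or.inr ⟨by linarith, by linarith⟩) c
      | (constructor <;> rintro (⟨t1, t2⟩ | ⟨t1, t2⟩) <;>
          first
          | exact Or.inl ⟨by linarith, by linarith⟩
          | exact Or.inr ⟨by linarith, by linarith⟩)
  have hitsub : ∀ l, hits pt V r p l ⊆ V.erase p := fun l => filter_subset _ _
  have sameRank : rankIn pt (hits pt V r p l₁) s = rankIn pt (hits pt V r p l₂) s := by
    unfold rankIn
    congr 1
    ext v
    rw [mem_filter, mem_filter]
    constructor
    · rintro ⟨h1, h2⟩; exact ⟨(sameHit v (hitsub _ h1) h2).1 h1, h2⟩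
    · rintro ⟨h1, h2⟩; exact ⟨(sameHit v (hitsub _ h1) h2).2 h1, h2⟩
  have sN1 : (pt s).2 ≠ f₁ s := h.height_ne_pt (mem_erase.1 hsV).2 (by linarith) hs2
  have sHit : s ∈ hits pt V r p l₁ := by
    refine mem_filter.2 ⟨hsV, by linarith, hs2, fun a b hab h1 h2 hb => ?_⟩
    refine clear a b hab s le_rfl hs2 h1 h2 ?_
    change StrictBtw _ _ (f₁ s) at hb
    rcases hb with ⟨b1, b2⟩ | ⟨b1, b2⟩ <;> rcases hs3 with ⟨c1, c2⟩ | ⟨c1, c2⟩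
    · exfalso; linarith
    · exact Or.inr ⟨by linarith, by linarith⟩
    · exact Or.inl ⟨by linarith, by linarith⟩
    · exfalso; linarith
  have hA := congrArg Prod.fst hcode
  have hB := congrArg Prod.snd hcode
  unfold sideCode at hA hB
  simp only at hA hB
  by_cases hsl : s = l₂
  · have hall : rankIn pt (hits pt V r p l₂) s = (hits pt V r p l₂).card := by
      unfold rankIn
      congr 1
      refine filter_true_of_mem fun v hv => ?_
      rw [hsl]
      exact (mem_filter.1 hv).2.1
    rcases lt_or_gt_of_ne sN1 with h1 | h1
    · have h2 : rankIn pt (hits pt V r p l₁) s ∈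
          ((hits pt V r p l₁).filter fun v => (pt v).2 < lineHeight (pt l₁) (pt p) (pt v).1).image
            (rankIn pt (hits pt V r p l₁)) :=
        mem_image_of_mem (rankIn pt (hits pt V r p l₁)) (mem_filter.2 ⟨sHit, h1⟩)
      rw [hB, sameRank, hall] at h2
      obtain ⟨w, hw, hw'⟩ := mem_image.1 h2
      exact absurd hw' (rankIn_lt (mem_filter.1 hw).1).ne
    · have h2 : rankIn pt (hits pt V r p l₁) s ∈
          ((hits pt V r p l₁).filter fun v => lineHeight (pt l₁) (pt p) (pt v).1 < (pt v).2).image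
            (rankIn pt (hits pt V r p l₁)) :=
        mem_image_of_mem (rankIn pt (hits pt V r p l₁)) (mem_filter.2 ⟨sHit, h1⟩)
      rw [hA, sameRank, hall] at h2
      obtain ⟨w, hw, hw'⟩ := mem_image.1 h2
      exact absurd hw' (rankIn_lt (mem_filter.1 hw).1).ne
  · have hls : (pt l₂).1 < (pt s).1 := lt_of_le_of_ne hs1 fun heq => hsl (h.inj heq.symm)
    have sN2 : (pt s).2 ≠ f₂ s := h.swap.height_ne_pt (mem_erase.1 hsV).2 hls hs2
    have sHit2 : s ∈ hits pt V r p l₂ := by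
      refine mem_filter.2 ⟨hsV, by linarith, hs2, fun a b hab h1 h2 hb => ?_⟩
      refine clear a b hab s le_rfl hs2 h1 h2 ?_
      change StrictBtw _ _ (f₂ s) at hb
      rcases hb with ⟨b1, b2⟩ | ⟨b1, b2⟩ <;> rcases hs3 with ⟨c1, c2⟩ | ⟨c1, c2⟩
      · exact Or.inl ⟨by linarith, by linarith⟩
      · exfalso; linarith
      · exfalso; linarith
      · exact Or.inr ⟨by linarith, by linarith⟩
    rcases lt_or_gt_of_ne sN1 with h1 | h1
    · have h2 : rankIn pt (hits pt V r p l₁) s ∈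
          ((hits pt V r p l₁).filter fun v => (pt v).2 < lineHeight (pt l₁) (pt p) (pt v).1).image
            (rankIn pt (hits pt V r p l₁)) :=
        mem_image_of_mem (rankIn pt (hits pt V r p l₁)) (mem_filter.2 ⟨sHit, h1⟩)
      rw [hB, sameRank] at h2
      obtain ⟨w, hw, hw'⟩ := mem_image.1 h2
      obtain rfl := rankIn_injOn h.inj (mem_filter.1 hw).1 sHit2 hw'
      have h3 : (pt w).2 < f₂ w := (mem_filter.1 hw).2
      rcases hs3 with ⟨c1, c2⟩ | ⟨c1, c2⟩ <;> linarith
    · have h2 : rankIn pt (hits pt V r p l₁) s ∈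
          ((hits pt V r p l₁).filter fun v => lineHeight (pt l₁) (pt p) (pt v).1 < (pt v).2).image
            (rankIn pt (hits pt V r p l₁)) :=
        mem_image_of_mem (rankIn pt (hits pt V r p l₁)) (mem_filter.2 ⟨sHit, h1⟩)
      rw [hA, sameRank] at h2
      obtain ⟨w, hw, hw'⟩ := mem_image.1 h2
      obtain rfl := rankIn_injOn h.inj (mem_filter.1 hw).1 sHit2 hw'
      have h3 : f₂ w < (pt w).2 := (mem_filter.1 hw).2
      rcases hs3 with ⟨c1, c2⟩ | ⟨c1, c2⟩ <;> linarith

end TwoLeft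

/-- The left neighbour of `p` is determined by the partition of the other points and the code. -/
theorem eq_of_sideCode_eq {V : Finset ι} {r₁ r₂ : ι → ι → Prop} {p l₁ l₂ : ι}
    (h₁ : IsNoncrossing pt V r₁) (h₂ : IsNoncrossing pt V r₂)
    (hx : Function.Injective fun i => (pt i).1) (hr : removeElt r₁ p = removeElt r₂ p)
    (hl₁ : IsEdge pt r₁ l₁ p) (hl₂ : IsEdge pt r₂ l₂ p)
    (hc : sideCode pt V (removeElt r₁ p) p l₁ = sideCode pt V (removeElt r₁ p) p l₂) : l₁ = l₂ := by
  by_contra hne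
  have h : TwoLeft pt V r₁ r₂ p l₁ l₂ := by
    refine ⟨h₁, h₂, fun u v hu hv => ?_, hl₁, hl₂, hne, hx⟩
    have := congrFun (congrFun hr u) v
    simp only [removeElt, hu, hv, ne_eq, not_false_eq_true, and_true] at this
    rw [this]
  rcases lt_trichotomy (pt l₁).1 (pt l₂).1 with h1 | h1 | h1
  · exact h.sideCode_ne_of_lt h1 hc
  · exact hne (hx h1)
  · refine h.swap.sideCode_ne_of_lt h1 ?_
    rw [← hr]; exact hc.symm

end Noncrossing

section NoncrossingCount

variable {ι : Type*} {pt : ι → ℝ × ℝ}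

theorem IsNoncrossing.exists_isEdge_right {V : Finset ι} {r : ι → ι → Prop}
    (h : IsNoncrossing pt V r) {p v : ι} (hpv : r p v) (hlt : (pt p).1 < (pt v).1) :
    ∃ q, IsEdge pt r p q := by
  obtain ⟨q, hq, hmin⟩ := exists_min_image (V.filter fun q => r p q ∧ (pt p).1 < (pt q).1)
    (fun q => (pt q).1) ⟨v, mem_filter.2 ⟨h.supp _ _ (h.symm _ _ hpv), hpv, hlt⟩⟩
  obtain ⟨-, h1, h2⟩ := mem_filter.1 hq
  refine ⟨q, h1, h2, fun w hw h3 h4 => ?_⟩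
  exact absurd (hmin w (mem_filter.2 ⟨h.supp _ _ (h.symm _ _ hw), hw, h3⟩)) (not_le.2 h4)

theorem IsNoncrossing.exists_isEdge_left {V : Finset ι} {r : ι → ι → Prop}
    (h : IsNoncrossing pt V r) {p v : ι} (hpv : r p v) (hlt : (pt v).1 < (pt p).1) :
    ∃ l, IsEdge pt r l p := by
  obtain ⟨q, hq, hmax⟩ := exists_max_image (V.filter fun q => r p q ∧ (pt q).1 < (pt p).1)
    (fun q => (pt q).1) ⟨v, mem_filter.2 ⟨h.supp _ _ (h.symm _ _ hpv), hpv, hlt⟩⟩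
  obtain ⟨-, h1, h2⟩ := mem_filter.1 hq
  refine ⟨q, h.symm _ _ h1, h2, fun w hw h3 h4 => ?_⟩
  exact absurd (hmax w (mem_filter.2 ⟨h.supp _ _ (h.symm _ _ hw), h.trans _ _ _ h1 hw, h4⟩))
    (not_le.2 h3)

/-- The elements of `V` that are singleton classes. -/
def singletonElts (V : Finset ι) (r : ι → ι → Prop) : Finset ι :=
  V.filter fun p => ∀ v, r p v → v = p

/-- The elements of `V` with a left neighbour in their class. -/
def leftElts (pt : ι → ℝ × ℝ) (V : Finset ι) (r : ι → ι → Prop) : Finset ι :=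
  V.filter fun p => ∃ l, IsEdge pt r l p

/-- The elements whose chord to the left neighbour is seen by few points. -/
def goodElts (pt : ι → ℝ × ℝ) (V : Finset ι) (r : ι → ι → Prop) : Finset ι :=
  V.filter fun p => (∀ v, r p v → v = p) ∨
    ∃ l, IsEdge pt r l p ∧ (hits pt V (removeElt r p) p l).card ≤ 8

theorem IsNoncrossing.card_le_singletonElts_add {V : Finset ι} {r : ι → ι → Prop}
    (h : IsNoncrossing pt V r) (hx : Function.Injective fun i => (pt i).1) :
    V.card ≤ (singletonElts V r).card + 2 * (leftElts pt V r).card := by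
  set F := V \ (singletonElts V r ∪ leftElts pt V r) with hF
  have hnext : ∀ p ∈ F, ∃ q, IsEdge pt r p q := by
    intro p hp
    obtain ⟨hpV, hp2⟩ := mem_sdiff.1 hp
    rw [mem_union, not_or] at hp2
    have h1 : ¬ ∀ v, r p v → v = p := fun h1 => hp2.1 (mem_filter.2 ⟨hpV, h1⟩)
    push Not at h1
    obtain ⟨v, hv, hvp⟩ := h1
    rcases lt_trichotomy (pt p).1 (pt v).1 with h3 | h3 | h3
    · exact h.exists_isEdge_right hv h3
    · exact absurd (hx h3).symm hvp
    · exact absurd (mem_filter.2 ⟨hpV, h.exists_isEdge_left hv h3⟩) hp2.2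
  choose! g hg using hnext
  have hFL : F.card ≤ (leftElts pt V r).card := by
    refine card_le_card_of_injOn g (fun p hp => ?_) fun p hp q hq hpq => ?_
    · have := hg p hp
      exact mem_coe.2 (mem_filter.2 ⟨h.supp _ _ (h.symm _ _ this.rel), p, this⟩)
    · have e1 := hg p hp
      have e2 := hg q hq
      change g p = g q at hpq
      rw [← hpq] at e2
      exact (e1.left_unique h hx e2 (h.trans _ _ _ e1.rel (h.symm _ _ e2.rel)) e1.lt le_rfl
        e2.lt le_rfl).1
  have hV : V ⊆ F ∪ (singletonElts V r ∪ leftElts pt V r) := fun v hv => by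
    by_cases h1 : v ∈ singletonElts V r ∪ leftElts pt V r
    · exact mem_union_right _ h1
    · exact mem_union_left _ (mem_sdiff.2 ⟨hv, h1⟩)
  have := card_le_card hV
  have := card_union_le F (singletonElts V r ∪ leftElts pt V r)
  have := card_union_le (singletonElts V r) (leftElts pt V r)
  omega

theorem IsNoncrossing.card_sees_le {V : Finset ι} {r : ι → ι → Prop}
    (h : IsNoncrossing pt V r) (hx : Function.Injective fun i => (pt i).1) :
    ((V ×ˢ V).filter fun c => ∃ l, IsEdge pt r l c.1 ∧ Sees pt r c.1 l c.2).card
      ≤ 2 * V.card := by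
  set A := (V ×ˢ V).filter fun c => ∃ l, IsEdge pt r l c.1 ∧ Sees pt r c.1 l c.2 with hA
  have hl : ∀ c ∈ A, ∃ l, IsEdge pt r l c.1 ∧ Sees pt r c.1 l c.2 := fun c hc =>
    (mem_filter.1 hc).2
  rcases isEmpty_or_nonempty ι with hι | hι
  · simp [eq_empty_of_isEmpty]
  choose! l hl using hl
  set up : ι × ι → Prop := fun c => lineHeight (pt (l c)) (pt c.1) (pt c.2).1 < (pt c.2).2 with hup
  have key : ∀ c ∈ A, ∀ d ∈ A, c.2 = d.2 → (up c ↔ up d) → c = d := by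
    intro c hc d hd hcd hud
    obtain ⟨ec, sc⟩ := hl c hc
    obtain ⟨ed, sd⟩ := hl d hd
    have hV := (mem_product.1 (mem_filter.1 hc).1).2
    obtain ⟨p, v⟩ := c
    obtain ⟨q, v'⟩ := d
    simp only at hcd hV ec sc ed sd
    subst hcd
    have n1 : (pt v).2 ≠ lineHeight (pt (l (p, v))) (pt p) (pt v).1 := fun heq =>
      ec.next v (h.rel_of_mem ec.rel hV ec.lt sc.1.le sc.2.1.le heq) sc.1 sc.2.1
    have n2 : (pt v).2 ≠ lineHeight (pt (l (q, v))) (pt q) (pt v).1 := fun heq =>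
      ed.next v (h.rel_of_mem ed.rel hV ed.lt sd.1.le sd.2.1.le heq) sd.1 sd.2.1
    have b1 := sc.2.2 _ _ ed sd.1 sd.2.1
    have b2 := sd.2.2 _ _ ec sc.1 sc.2.1
    simp only [hup] at hud
    by_cases heq : lineHeight (pt (l (p, v))) (pt p) (pt v).1
        = lineHeight (pt (l (q, v))) (pt q) (pt v).1
    · have hr := h.cross_height ec.rel ed.rel ec.lt ed.lt sc.1.le sc.2.1.le sd.1.le sd.2.1.le heq
      rw [(ec.left_unique h hx ed hr sc.1 sc.2.1.le sd.1 sd.2.1.le).2]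
    · exfalso
      unfold StrictBtw at b1 b2
      generalize lineHeight (pt (l (p, v))) (pt p) (pt v).1 = y1 at *
      generalize lineHeight (pt (l (q, v))) (pt q) (pt v).1 = y2 at *
      rcases lt_or_gt_of_ne n1 with m1 | m1 <;> rcases lt_or_gt_of_ne n2 with m2 | m2
      · rcases lt_or_gt_of_ne heq with m3 | m3
        · exact b2 (Or.inl ⟨m1, m3⟩)
        · exact b1 (Or.inl ⟨m2, m3⟩)
      · have := hud.2 m2; linarith
      · have := hud.1 m1; linarith
      · rcases lt_or_gt_of_ne heq with m3 | m3
        · exact b1 (Or.inr ⟨m3, m2⟩)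
        · exact b2 (Or.inr ⟨m3, m1⟩)
  have : A.card ≤ (V ×ˢ (univ : Finset Prop)).card := by
    refine card_le_card_of_injOn (fun c => (c.2, up c)) (fun c hc => ?_) fun c hc d hd hcd => ?_
    · exact mem_coe.2 (mem_product.2 ⟨(mem_product.1 (mem_filter.1 hc).1).2, mem_univ _⟩)
    · have h1 := congrArg Prod.fst hcd
      have h2 := congrArg Prod.snd hcd
      exact key c hc d hd h1 (iff_of_eq h2)
  rw [card_product, card_univ, Fintype.card_prop] at this
  omega

theorem goodElts_subset (V : Finset ι) (r : ι → ι → Prop) : goodElts pt V r ⊆ V :=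
  filter_subset _ _

theorem IsNoncrossing.card_le_goodElts {V : Finset ι} {r : ι → ι → Prop}
    (h : IsNoncrossing pt V r) (hx : Function.Injective fun i => (pt i).1) :
    V.card ≤ 4 * (goodElts pt V r).card := by
  set A := (V ×ˢ V).filter fun c => ∃ l, IsEdge pt r l c.1 ∧ Sees pt r c.1 l c.2 with hA
  have hAc : A.card ≤ 2 * V.card := h.card_sees_le hx
  set B := leftElts pt V r \ goodElts pt V r with hB
  have hfib : ∀ p ∈ B, 9 ≤ (A.filter fun c => c.1 = p).card := by
    intro p hp
    obtain ⟨h1, h2⟩ := mem_sdiff.1 hp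
    obtain ⟨hpV, l, hl⟩ := mem_filter.1 h1
    have h3 : ¬ (hits pt V (_root_.removeElt r p) p l).card ≤ 8 := fun h3 =>
      h2 (mem_filter.2 ⟨hpV, Or.inr ⟨l, hl, h3⟩⟩)
    have h4 : (hits pt V (_root_.removeElt r p) p l).card ≤ (A.filter fun c => c.1 = p).card := by
      refine card_le_card_of_injOn (fun v => (p, v)) (fun v hv => ?_) fun v _ w _ hvw =>
        congrArg Prod.snd hvw
      obtain ⟨hv1, hv2⟩ := mem_filter.1 (mem_coe.1 hv)
      exact mem_coe.2 (mem_filter.2 ⟨mem_filter.2 ⟨mem_product.2 ⟨hpV, (mem_erase.1 hv1).2⟩,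
        l, hl, hv2.of_removeElt h hx hl⟩, rfl⟩)
    omega
  have hBc : 9 * B.card ≤ A.card := by
    calc 9 * B.card = ∑ p ∈ B, 9 := by rw [sum_const, smul_eq_mul, mul_comm]
      _ ≤ ∑ p ∈ B, (A.filter fun c => c.1 = p).card := sum_le_sum hfib
      _ ≤ ∑ p ∈ V, (A.filter fun c => c.1 = p).card :=
        sum_le_sum_of_subset fun p hp => (mem_filter.1 (mem_sdiff.1 hp).1).1
      _ = A.card := (card_eq_sum_card_fiberwise fun c hc =>
        (mem_product.1 (mem_filter.1 hc).1).1).symm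
  have h1 := h.card_le_singletonElts_add hx
  have hdisj : Disjoint (singletonElts V r) (leftElts pt V r \ B) := by
    rw [disjoint_left]
    intro p hp hp2
    obtain ⟨l, hl⟩ := (mem_filter.1 (mem_sdiff.1 hp2).1).2
    have := (mem_filter.1 hp).2 l (h.symm _ _ hl.rel)
    exact hl.lt.ne (by rw [this])
  have hsub : singletonElts V r ∪ (leftElts pt V r \ B) ⊆ goodElts pt V r := by
    intro p hp
    rcases mem_union.1 hp with hp | hp
    · exact mem_filter.2 ⟨(mem_filter.1 hp).1, Or.inl (mem_filter.1 hp).2⟩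
    · obtain ⟨hp1, hp2⟩ := mem_sdiff.1 hp
      by_contra h3
      exact hp2 (mem_sdiff.2 ⟨hp1, h3⟩)
  have h2 := card_le_card hsub
  rw [card_union_of_disjoint hdisj] at h2
  have h3 : (leftElts pt V r).card ≤ (leftElts pt V r \ B).card + B.card :=
    card_le_card_sdiff_add_card
  omega

/-- The code of the position of `p` in a partition for which `p` is good. -/
def goodCode (pt : ι → ℝ × ℝ) (V : Finset ι) (p : ι) (r : ι → ι → Prop) :
    Option (Finset ℕ × Finset ℕ) :=
  if h : ∃ l, IsEdge pt r l p ∧ (hits pt V (_root_.removeElt r p) p l).card ≤ 8 then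
    some (sideCode pt V (_root_.removeElt r p) p h.choose) else none

/-- All pairs of sets of numbers below `n`, and one more value. -/
def codeSet (n : ℕ) : Finset (Option (Finset ℕ × Finset ℕ)) :=
  insertNone ((range n).powerset ×ˢ (range n).powerset)

theorem card_codeSet (n : ℕ) : (codeSet n).card = 2 ^ n * 2 ^ n + 1 := by
  unfold codeSet
  rw [card_insertNone, card_product, card_powerset, card_range]

theorem mem_codeSet (n : ℕ) (o : Option (Finset ℕ × Finset ℕ)) :
    o ∈ codeSet n ↔ ∀ a ∈ o, a ∈ (range n).powerset ×ˢ (range n).powerset := mem_insertNone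

theorem goodCode_mem (V : Finset ι) (p : ι) (r : ι → ι → Prop) {n : ℕ} (hn : n = 8) :
    goodCode pt V p r ∈ codeSet n := by
  rw [mem_codeSet]
  intro a ha
  unfold goodCode at ha
  split_ifs at ha with h
  · obtain rfl := Option.mem_some_iff.1 ha
    have h8 := h.choose_spec.2
    have key : ∀ (P : ι → Prop), (((hits pt V (_root_.removeElt r p) p h.choose).filter P).image
        (rankIn pt (hits pt V (_root_.removeElt r p) p h.choose))) ⊆ range n := by
      intro P x hx
      obtain ⟨v, hv, rfl⟩ := mem_image.1 hx
      have := rankIn_lt (pt := pt) (mem_filter.1 hv).1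
      exact mem_range.2 (by omega)
    exact mem_product.2 ⟨mem_powerset.2 (key _), mem_powerset.2 (key _)⟩
  · exact absurd ha (Option.not_mem_none a)

theorem IsNoncrossing.eq_of_goodCode_eq {V : Finset ι} {r₁ r₂ : ι → ι → Prop} {p : ι}
    (h₁ : IsNoncrossing pt V r₁) (h₂ : IsNoncrossing pt V r₂)
    (hx : Function.Injective fun i => (pt i).1) (hp₁ : p ∈ goodElts pt V r₁)
    (hp₂ : p ∈ goodElts pt V r₂) (hr : _root_.removeElt r₁ p = _root_.removeElt r₂ p)
    (hc : goodCode pt V p r₁ = goodCode pt V p r₂) : r₁ = r₂ := by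
  have hoff : ∀ u v, u ≠ p → v ≠ p → (r₁ u v ↔ r₂ u v) := by
    intro u v hu hv
    have := congrFun (congrFun hr u) v
    simp only [_root_.removeElt, hu, hv, ne_eq, not_false_eq_true, and_true] at this
    rw [this]
  suffices hpv : ∀ v, v ≠ p → (r₁ p v ↔ r₂ p v) by
    funext u v
    refine propext ?_
    by_cases hu : u = p
    · by_cases hv : v = p
      · subst hu hv
        exact ⟨fun _ => h₂.refl _ (mem_filter.1 hp₂).1, fun _ => h₁.refl _ (mem_filter.1 hp₁).1⟩
      · subst hu; exact hpv v hv
    · by_cases hv : v = p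
      · subst hv
        exact ⟨fun h => h₂.symm _ _ ((hpv u hu).1 (h₁.symm _ _ h)),
          fun h => h₁.symm _ _ ((hpv u hu).2 (h₂.symm _ _ h))⟩
      · exact hoff u v hu hv
  unfold goodCode at hc
  split_ifs at hc with g₁ g₂ g₂
  · have e₁ := g₁.choose_spec.1
    have e₂ := g₂.choose_spec.1
    generalize g₂.choose = l₂ at hc e₂
    rw [← hr] at hc
    have := eq_of_sideCode_eq h₁ h₂ hx hr e₁ e₂ (Option.some_injective _ hc)
    rw [← this] at e₂
    set l := g₁.choose
    have hlp : l ≠ p := by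
      intro h; rw [h] at e₁; exact lt_irrefl _ e₁.lt
    intro v hv
    have k₁ : r₁ p v ↔ r₁ l v := ⟨fun h => h₁.trans _ _ _ e₁.rel h,
      fun h => h₁.trans _ _ _ (h₁.symm _ _ e₁.rel) h⟩
    have k₂ : r₂ p v ↔ r₂ l v := ⟨fun h => h₂.trans _ _ _ e₂.rel h,
      fun h => h₂.trans _ _ _ (h₂.symm _ _ e₂.rel) h⟩
    rw [k₁, k₂, hoff l v hlp hv]
  · intro v hv
    have s₁ := ((mem_filter.1 hp₁).2.resolve_right g₁) v
    have s₂ := ((mem_filter.1 hp₂).2.resolve_right g₂) v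
    exact ⟨fun h => absurd (s₁ h) hv, fun h => absurd (s₂ h) hv⟩

theorem card_isNoncrossing_le [Fintype ι] (hx : Function.Injective fun i => (pt i).1)
    (V : Finset ι) : (univ.filter (IsNoncrossing pt V)).card ≤ 262148 ^ V.card := by
  induction hn : V.card generalizing V with
  | zero =>
    rw [pow_zero, card_le_one]
    intro r hr s hs
    have hV := card_eq_zero.1 hn
    subst hV
    funext u v
    exact propext ⟨fun h => absurd ((mem_filter.1 hr).2.supp _ _ h) (notMem_empty _),
      fun h => absurd ((mem_filter.1 hs).2.supp _ _ h) (notMem_empty _)⟩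
  | succ m ih =>
    set A := univ.filter (IsNoncrossing pt V) with hA
    obtain ⟨n, hn8⟩ : ∃ n : ℕ, n = 8 := ⟨_, rfl⟩
    have hp : ∀ p ∈ V, (A.filter fun r => p ∈ goodElts pt V r).card ≤ 262148 ^ m * 65537 := by
      intro p hp
      have hm : (V.erase p).card = m := by rw [card_erase_of_mem hp, hn]; rfl
      calc (A.filter fun r => p ∈ goodElts pt V r).card
          ≤ ((univ.filter (IsNoncrossing pt (V.erase p))) ×ˢ
            codeSet n).card := by
            refine card_le_card_of_injOn (fun r => (_root_.removeElt r p, goodCode pt V p r))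
              (fun r hr => ?_) fun r hr s hs hrs => ?_
            · have h1 := (mem_filter.1 (mem_filter.1 (mem_coe.1 hr)).1).2
              rw [mem_coe, mem_product]
              exact ⟨mem_filter.2 ⟨mem_univ _, h1.removeElt p⟩, goodCode_mem _ _ _ hn8⟩
            · have h1 := (mem_filter.1 (mem_filter.1 (mem_coe.1 hr)).1).2
              have h2 := (mem_filter.1 (mem_filter.1 (mem_coe.1 hs)).1).2
              exact h1.eq_of_goodCode_eq h2 hx (mem_filter.1 (mem_coe.1 hr)).2
                (mem_filter.1 (mem_coe.1 hs)).2 (congrArg Prod.fst hrs) (congrArg Prod.snd hrs)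
        _ ≤ 262148 ^ m * 65537 := by
            rw [card_product, card_codeSet, hn8]
            exact Nat.mul_le_mul (ih _ hm) (by norm_num)
    have h1 : A.card * V.card ≤ V.card * (262148 ^ m * 262148) := by
      calc A.card * V.card = ∑ r ∈ A, V.card := by rw [sum_const, smul_eq_mul]
        _ ≤ ∑ r ∈ A, 4 * (goodElts pt V r).card :=
          sum_le_sum fun r hr => (mem_filter.1 hr).2.card_le_goodElts hx
        _ = 4 * ∑ r ∈ A, ∑ p ∈ V, if p ∈ goodElts pt V r then 1 else 0 := by
          rw [← mul_sum]
          congr 1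
          refine sum_congr rfl fun r _ => ?_
          rw [← card_filter]
          congr 1
          ext p
          rw [mem_filter]
          exact ⟨fun h => ⟨goodElts_subset _ _ h, h⟩, fun h => h.2⟩
        _ = 4 * ∑ p ∈ V, (A.filter fun r => p ∈ goodElts pt V r).card := by
          rw [sum_comm]
          congr 1
          exact sum_congr rfl fun p _ => (card_filter _ _).symm
        _ ≤ 4 * ∑ p ∈ V, 262148 ^ m * 65537 := Nat.mul_le_mul_left _ (sum_le_sum hp)
        _ = V.card * (262148 ^ m * 262148) := by
          rw [sum_const, smul_eq_mul]; ring
    rw [hn, mul_comm (A.card)] at h1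
    rw [pow_succ]
    exact Nat.le_of_mul_le_mul_left h1 (Nat.succ_pos m)

end NoncrossingCount

/-! ### Trapezoidal decomposition of a system of segments -/

section Trapezoids

/-- A segment, given by its left and right end. -/
abbrev Seg := (ℝ × ℝ) × (ℝ × ℝ)

/-- The height of the segment `s` at abscissa `x`. -/
def segHeight (s : Seg) (x : ℝ) : ℝ := lineHeight s.1 s.2 x

/-- The abscissa `x` is covered by `s`. -/
def Spans (s : Seg) (x : ℝ) : Prop := s.1.1 ≤ x ∧ x ≤ s.2.1

/-- A set `S` of segments that meet only in their ends, which lie in the set `V`. -/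
structure SegSystem (S : Finset Seg) (V : Finset (ℝ × ℝ)) : Prop where
  lt : ∀ s ∈ S, s.1.1 < s.2.1
  fst_mem : ∀ s ∈ S, s.1 ∈ V
  snd_mem : ∀ s ∈ S, s.2 ∈ V
  inj : ∀ u ∈ V, ∀ v ∈ V, u.1 = v.1 → u = v
  vert : ∀ v ∈ V, ∀ s ∈ S, Spans s v.1 → v.2 = segHeight s v.1 → v = s.1 ∨ v = s.2
  cross : ∀ s ∈ S, ∀ t ∈ S, s ≠ t → ∀ x, Spans s x → Spans t x → segHeight s x = segHeight t x →
    (x, segHeight s x) ∈ V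

/-- The open region between `b` and `t` over the interval from `x₀` to `x₁`. -/
def strip (b t : Seg) (x₀ x₁ : ℝ) : Set (ℝ × ℝ) :=
  {z | x₀ < z.1 ∧ z.1 < x₁ ∧ segHeight b z.1 < z.2 ∧ z.2 < segHeight t z.1}

/-- The closed region between `b` and `t` over the interval from `x₀` to `x₁`. -/
def closedStrip (b t : Seg) (x₀ x₁ : ℝ) : Set (ℝ × ℝ) :=
  {z | x₀ ≤ z.1 ∧ z.1 ≤ x₁ ∧ segHeight b z.1 ≤ z.2 ∧ z.2 ≤ segHeight t z.1}

/-- The trapezoid with upper side on `t`, lower side on `b` and vertical sides through `l` and `r`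
is a cell of the vertical decomposition. -/
structure IsCell (S : Finset Seg) (V : Finset (ℝ × ℝ)) (t b : Seg) (l r : ℝ × ℝ) : Prop where
  t_mem : t ∈ S
  b_mem : b ∈ S
  l_mem : l ∈ V
  r_mem : r ∈ V
  lr : l.1 < r.1
  tl : t.1.1 ≤ l.1
  tr : r.1 ≤ t.2.1
  bl : b.1.1 ≤ l.1
  br : r.1 ≤ b.2.1
  l_low : segHeight b l.1 ≤ l.2
  l_up : l.2 ≤ segHeight t l.1
  r_low : segHeight b r.1 ≤ r.2
  r_up : r.2 ≤ segHeight t r.1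
  lt : ∀ x, l.1 < x → x < r.1 → segHeight b x < segHeight t x
  noV : ∀ v ∈ V, v ∉ strip b t l.1 r.1
  noS : ∀ s ∈ S, ∀ x, l.1 < x → x < r.1 → Spans s x → (x, segHeight s x) ∉ strip b t l.1 r.1

theorem segHeight_left (s : Seg) : segHeight s s.1.1 = s.1.2 := lineHeight_left _ _

theorem segHeight_right {s : Seg} (h : s.1.1 < s.2.1) : segHeight s s.2.1 = s.2.2 :=
  lineHeight_right h.ne

theorem segHeight_combo (s : Seg) (x y a b : ℝ) (h : a + b = 1) :
    segHeight s (a * x + b * y) = a * segHeight s x + b * segHeight s y :=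
  lineHeight_combo _ _ _ _ _ _ h

theorem segHeight_continuous (s : Seg) : Continuous (segHeight s) := lineHeight_continuous _ _

/-- Points between a point of the open strip and a point of the closed strip. -/
theorem combo_mem_strip {b t : Seg} {x₀ x₁ : ℝ} {w z : ℝ × ℝ} (hw : w ∈ strip b t x₀ x₁)
    (hz : z ∈ closedStrip b t x₀ x₁) {α β : ℝ} (hα : 0 < α) (hβ : 0 ≤ β) (h : α + β = 1) :
    α • w + β • z ∈ strip b t x₀ x₁ := by
  obtain ⟨w1, w2, w3, w4⟩ := hw
  obtain ⟨z1, z2, z3, z4⟩ := hz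
  refine ⟨?_, ?_, ?_, ?_⟩ <;>
    simp only [Prod.fst_add, Prod.smul_fst, Prod.snd_add, Prod.smul_snd, smul_eq_mul]
  · obtain rfl : β = 1 - α := by linarith
    nlinarith [mul_pos hα (sub_pos.2 w1), mul_nonneg hβ (sub_nonneg.2 z1)]
  · obtain rfl : β = 1 - α := by linarith
    nlinarith [mul_pos hα (sub_pos.2 w2), mul_nonneg hβ (sub_nonneg.2 z2)]
  · rw [segHeight_combo _ _ _ _ _ h]; nlinarith
  · rw [segHeight_combo _ _ _ _ _ h]; nlinarith

theorem strip_subset_closedStrip (b t : Seg) (x₀ x₁ : ℝ) :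
    strip b t x₀ x₁ ⊆ closedStrip b t x₀ x₁ := fun _ h => ⟨h.1.le, h.2.1.le, h.2.2.1.le, h.2.2.2.le⟩

theorem convex_strip (b t : Seg) (x₀ x₁ : ℝ) : Convex ℝ (strip b t x₀ x₁) := by
  intro w hw z hz α β hα hβ h
  rcases hα.eq_or_lt with rfl | hα
  · obtain rfl : β = 1 := by linarith
    simpa using hz
  · exact combo_mem_strip hw (strip_subset_closedStrip _ _ _ _ hz) hα hβ h

theorem isClosed_closedStrip (b t : Seg) (x₀ x₁ : ℝ) : IsClosed (closedStrip b t x₀ x₁) := by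
  have hb := segHeight_continuous b
  have ht := segHeight_continuous t
  refine IsClosed.inter (s₁ := {z : ℝ × ℝ | x₀ ≤ z.1}) (isClosed_le (by fun_prop) (by fun_prop)) ?_
  refine IsClosed.inter (s₁ := {z : ℝ × ℝ | z.1 ≤ x₁}) (isClosed_le (by fun_prop) (by fun_prop)) ?_
  exact IsClosed.inter (s₁ := {z : ℝ × ℝ | segHeight b z.1 ≤ z.2})
    (isClosed_le (hb.comp continuous_fst) continuous_snd)
    (isClosed_le continuous_snd (ht.comp continuous_fst))

theorem isOpen_strip (b t : Seg) (x₀ x₁ : ℝ) : IsOpen (strip b t x₀ x₁) := by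
  have hb := segHeight_continuous b
  have ht := segHeight_continuous t
  refine IsOpen.inter (s := {z : ℝ × ℝ | x₀ < z.1}) (isOpen_lt (by fun_prop) (by fun_prop)) ?_
  refine IsOpen.inter (s := {z : ℝ × ℝ | z.1 < x₁}) (isOpen_lt (by fun_prop) (by fun_prop)) ?_
  exact IsOpen.inter (s := {z : ℝ × ℝ | segHeight b z.1 < z.2})
    (isOpen_lt (hb.comp continuous_fst) continuous_snd)
    (isOpen_lt continuous_snd (ht.comp continuous_fst))

variable {S : Finset Seg} {V : Finset (ℝ × ℝ)}

namespace SegSystem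

theorem mono (h : SegSystem S V) {S' : Finset Seg} {V' : Finset (ℝ × ℝ)} (hS : S' ⊆ S)
    (hV : V' ⊆ V) (h1 : ∀ s ∈ S', s.1 ∈ V') (h2 : ∀ s ∈ S', s.2 ∈ V') : SegSystem S' V' where
  lt s hs := h.lt s (hS hs)
  fst_mem := h1
  snd_mem := h2
  inj u hu v hv := h.inj u (hV hu) v (hV hv)
  vert v hv s hs := h.vert v (hV hv) s (hS hs)
  cross s hs t ht hst x hx hx' heq := by
    have h3 := h.cross s (hS hs) t (hS ht) hst x hx hx' heq
    rcases h.vert _ h3 s (hS hs) hx rfl with h4 | h4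
    · rw [h4]; exact h1 s hs
    · rw [h4]; exact h2 s hs

theorem ends_of_vert (h : SegSystem S V) {v : ℝ × ℝ} (hv : v ∈ V) {s : Seg} (hs : s ∈ S)
    (h1 : s.1.1 < v.1) (h2 : v.1 < s.2.1) : v.2 ≠ segHeight s v.1 := by
  intro heq
  rcases h.vert v hv s hs ⟨h1.le, h2.le⟩ heq with rfl | rfl
  · exact lt_irrefl _ h1
  · exact lt_irrefl _ h2

theorem height_ne (h : SegSystem S V) {s t : Seg} (hs : s ∈ S) (ht : t ∈ S) (hst : s ≠ t) {x : ℝ}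
    (h1 : s.1.1 < x) (h2 : x < s.2.1) (h3 : Spans t x) : segHeight s x ≠ segHeight t x := by
  intro heq
  have h4 := h.cross s hs t ht hst x ⟨h1.le, h2.le⟩ h3 heq
  exact h.ends_of_vert h4 hs h1 h2 rfl

theorem le_of_lt (h : SegSystem S V) {s t : Seg} (hs : s ∈ S) (ht : t ∈ S) {x y : ℝ}
    (hsx : Spans s x) (htx : Spans t x) (hsy : Spans s y) (hty : Spans t y)
    (hlt : segHeight s x < segHeight t x) : segHeight s y ≤ segHeight t y := by
  by_contra! hy
  have hst : s ≠ t := by rintro rfl; exact lt_irrefl _ hlt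
  obtain ⟨w, w1, w2, w3⟩ := exists_lineHeight_eq (a := s.1) (b := s.2) hlt.le hy.le
  have n1 : w ≠ x := by rintro rfl; exact hlt.ne w3
  have n2 : w ≠ y := by rintro rfl; exact hy.ne' w3
  obtain ⟨a1, a2⟩ := hsx
  obtain ⟨b1, b2⟩ := htx
  obtain ⟨c1, c2⟩ := hsy
  obtain ⟨d1, d2⟩ := hty
  rcases le_total x y with hxy | hxy
  · rw [min_eq_left hxy] at w1
    rw [max_eq_right hxy] at w2
    have w1 := lt_of_le_of_ne w1 n1.symm
    have w2 := lt_of_le_of_ne w2 n2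
    exact h.height_ne hs ht hst (by linarith) (by linarith) ⟨by linarith, by linarith⟩ w3
  · rw [min_eq_right hxy] at w1
    rw [max_eq_left hxy] at w2
    have w1 := lt_of_le_of_ne w1 n2.symm
    have w2 := lt_of_le_of_ne w2 n1
    exact h.height_ne hs ht hst (by linarith) (by linarith) ⟨by linarith, by linarith⟩ w3

end SegSystem

namespace IsCell

variable {t b t' b' s : Seg} {l r l' r' v z : ℝ × ℝ}

theorem t_spans (h : IsCell S V t b l r) {x : ℝ} (h1 : l.1 ≤ x) (h2 : x ≤ r.1) : Spans t x :=
  ⟨h.tl.trans h1, h2.trans h.tr⟩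

theorem b_spans (h : IsCell S V t b l r) {x : ℝ} (h1 : l.1 ≤ x) (h2 : x ≤ r.1) : Spans b x :=
  ⟨h.bl.trans h1, h2.trans h.br⟩

theorem l_mem_closed (h : IsCell S V t b l r) : l ∈ closedStrip b t l.1 r.1 :=
  ⟨le_rfl, h.lr.le, h.l_low, h.l_up⟩

theorem r_mem_closed (h : IsCell S V t b l r) : r ∈ closedStrip b t l.1 r.1 :=
  ⟨h.lr.le, le_rfl, h.r_low, h.r_up⟩

theorem strip_nonempty (h : IsCell S V t b l r) :
    ((l.1 + r.1) / 2, (segHeight b ((l.1 + r.1) / 2) + segHeight t ((l.1 + r.1) / 2)) / 2) ∈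
      strip b t l.1 r.1 := by
  have h0 := h.lr
  have := h.lt ((l.1 + r.1) / 2) (by linarith) (by linarith)
  refine ⟨?_, ?_, ?_, ?_⟩ <;> simp only <;> linarith

theorem vertex_on (hS : SegSystem S V) (h : IsCell S V t b l r)
    (hz : z ∈ closedStrip b t l.1 r.1) (hs : s ∈ S) (hsz : Spans s z.1)
    (hzs : z.2 = segHeight s z.1) : s = t ∨ s = b ∨ z ∈ V := by
  by_contra! hcon
  obtain ⟨n1, n2, n3⟩ := hcon
  have hlr := h.lr
  obtain ⟨z1, z2, z3, z4⟩ := hz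
  obtain ⟨e1, e2⟩ := hsz
  have hzV : (z.1, segHeight s z.1) = z := by rw [← hzs]
  by_cases hx : ∃ x, l.1 < x ∧ x < r.1 ∧ Spans s x
  · obtain ⟨x, x1, x2, x3⟩ := hx
    have ht := h.tl; have hb := h.bl; have htr := h.tr; have hbr := h.br
    have k1 := hS.height_ne h.t_mem hs n1.symm (by linarith) (by linarith) x3
    have k2 := hS.height_ne h.b_mem hs n2.symm (by linarith) (by linarith) x3
    have k3 := h.noS s hs x x1 x2 x3
    have k4 : segHeight s x < segHeight b x ∨ segHeight t x < segHeight s x := by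
      by_contra! hcon
      exact k3 ⟨x1, x2, lt_of_le_of_ne hcon.1 k2, lt_of_le_of_ne hcon.2 k1.symm⟩
    rcases k4 with k4 | k4
    · have := hS.le_of_lt hs h.b_mem x3 (h.b_spans x1.le x2.le) ⟨e1, e2⟩ (h.b_spans z1 z2) k4
      have h5 := hS.cross s hs b h.b_mem n2 z.1 ⟨e1, e2⟩ (h.b_spans z1 z2) (by linarith)
      rw [hzV] at h5
      exact n3 h5
    · have := hS.le_of_lt h.t_mem hs (h.t_spans x1.le x2.le) x3 (h.t_spans z1 z2) ⟨e1, e2⟩ k4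
      have h5 := hS.cross s hs t h.t_mem n1 z.1 ⟨e1, e2⟩ (h.t_spans z1 z2) (by linarith)
      rw [hzV] at h5
      exact n3 h5
  · have hend : z.1 = s.1.1 ∨ z.1 = s.2.1 := by
      by_contra! hcon
      have e1 := lt_of_le_of_ne e1 hcon.1.symm
      have e2 := lt_of_le_of_ne e2 hcon.2
      apply hx
      rcases z1.eq_or_lt with z1 | z1
      · refine ⟨(z.1 + min s.2.1 r.1) / 2, ?_, ?_, ?_, ?_⟩ <;>
          rcases min_cases s.2.1 r.1 with ⟨m1, m2⟩ | ⟨m1, m2⟩ <;> rw [m1] <;> linarith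
      · refine ⟨(z.1 + max s.1.1 l.1) / 2, ?_, ?_, ?_, ?_⟩ <;>
          rcases max_cases s.1.1 l.1 with ⟨m1, m2⟩ | ⟨m1, m2⟩ <;> rw [m1] <;> linarith
    rcases hend with h5 | h5
    · have : z = s.1 := Prod.ext h5 (by rw [hzs, h5, segHeight_left])
      exact n3 (this ▸ hS.fst_mem s hs)
    · have : z = s.2 := Prod.ext h5 (by rw [hzs, h5, segHeight_right (hS.lt s hs)])
      exact n3 (this ▸ hS.snd_mem s hs)

theorem eq_of_mem (hS : SegSystem S V) (h : IsCell S V t b l r)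
    (hv : v ∈ V) (hz : v ∈ closedStrip b t l.1 r.1) : v = l ∨ v = r := by
  obtain ⟨z1, z2, z3, z4⟩ := hz
  rcases z1.eq_or_lt with z1 | z1
  · exact Or.inl (hS.inj _ hv _ h.l_mem z1.symm)
  rcases z2.eq_or_lt with z2 | z2
  · exact Or.inr (hS.inj _ hv _ h.r_mem z2)
  exfalso
  have ht := h.tl; have hb := h.bl; have htr := h.tr; have hbr := h.br
  have k1 := hS.ends_of_vert hv h.t_mem (by linarith) (by linarith)
  have k2 := hS.ends_of_vert hv h.b_mem (by linarith) (by linarith)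
  exact h.noV v hv ⟨z1, z2, lt_of_le_of_ne z3 k2.symm, lt_of_le_of_ne z4 k1⟩

/-- The open cells are disjoint. -/
theorem unique (hS : SegSystem S V) (h : IsCell S V t b l r) (h' : IsCell S V t' b' l' r')
    (hz : z ∈ strip b t l.1 r.1) (hz' : z ∈ strip b' t' l'.1 r'.1) :
    t = t' ∧ b = b' ∧ l = l' ∧ r = r' := by
  have aux : ∀ {t b t' b' : Seg} {l r l' r' : ℝ × ℝ}, IsCell S V t b l r → IsCell S V t' b' l' r' →
      z ∈ strip b t l.1 r.1 → z ∈ strip b' t' l'.1 r'.1 →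
      segHeight t' z.1 ≤ segHeight t z.1 ∧ segHeight b z.1 ≤ segHeight b' z.1 := by
    intro t b t' b' l r l' r' h h' ⟨z1, z2, z3, z4⟩ ⟨y1, y2, y3, y4⟩
    constructor
    · by_contra! hlt
      exact h'.noS t h.t_mem z.1 y1 y2 (h.t_spans z1.le z2.le) ⟨y1, y2, y3.trans z4, hlt⟩
    · by_contra! hlt
      exact h'.noS b h.b_mem z.1 y1 y2 (h.b_spans z1.le z2.le) ⟨y1, y2, hlt, z3.trans y4⟩
  have a1 := aux h h' hz hz'
  have a2 := aux h' h hz' hz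
  obtain ⟨z1, z2, z3, z4⟩ := hz
  obtain ⟨y1, y2, y3, y4⟩ := hz'
  have htt : t = t' := by
    by_contra hne
    exact hS.height_ne h.t_mem h'.t_mem hne (h.tl.trans_lt z1) (z2.trans_le h.tr)
      (h'.t_spans y1.le y2.le) (le_antisymm a2.1 a1.1)
  have hbb : b = b' := by
    by_contra hne
    exact hS.height_ne h.b_mem h'.b_mem hne (h.bl.trans_lt z1) (z2.trans_le h.br)
      (h'.b_spans y1.le y2.le) (le_antisymm a1.2 a2.2)
  subst htt hbb
  refine ⟨rfl, rfl, ?_, ?_⟩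
  · have aux2 : ∀ {l r l' r' : ℝ × ℝ}, IsCell S V t b l r → IsCell S V t b l' r' → l.1 < z.1 →
        z.1 < r.1 → l'.1 < z.1 → l'.1 ≤ l.1 := by
      intro l r l' r' h h' z1 z2 y1
      by_contra! hlt
      rcases h.eq_of_mem hS h'.l_mem ⟨hlt.le, by linarith, h'.l_low, h'.l_up⟩ with rfl | rfl
      · exact lt_irrefl _ hlt
      · linarith
    exact hS.inj _ h.l_mem _ h'.l_mem (le_antisymm (aux2 h' h y1 y2 z1) (aux2 h h' z1 z2 y1))
  · have aux2 : ∀ {l r l' r' : ℝ × ℝ}, IsCell S V t b l r → IsCell S V t b l' r' → l.1 < z.1 →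
        z.1 < r.1 → z.1 < r'.1 → r.1 ≤ r'.1 := by
      intro l r l' r' h h' z1 z2 y1
      by_contra! hlt
      rcases h.eq_of_mem hS h'.r_mem ⟨by linarith, hlt.le, h'.r_low, h'.r_up⟩ with rfl | rfl
      · linarith
      · exact lt_irrefl _ hlt
    exact hS.inj _ h.r_mem _ h'.r_mem (le_antisymm (aux2 h h' z1 z2 y2) (aux2 h' h y1 y2 z2))

end IsCell

end Trapezoids

section TrapezoidCells

variable {S S' : Finset Seg} {V V' : Finset (ℝ × ℝ)}

namespace IsCell

variable {t b t' b' s : Seg} {l r l' r' v z : ℝ × ℝ}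

theorem not_strictBtw (hS : SegSystem S V) (h : IsCell S V t b l r) (hv : v ∈ V)
    (hvc : v ∈ closedStrip b t l.1 r.1) (hzc : z ∈ closedStrip b t l.1 r.1) (hvz : v.1 = z.1)
    (hs : s ∈ S) (hsz : Spans s z.1) : ¬ StrictBtw (segHeight s z.1) z.2 v.2 := by
  intro hbtw
  obtain ⟨-, -, v3, v4⟩ := hvc
  obtain ⟨z1, z2, z3, z4⟩ := hzc
  rw [hvz] at v3 v4
  have hw : (z.1, segHeight s z.1) ∈ closedStrip b t l.1 r.1 := by
    refine ⟨z1, z2, ?_, ?_⟩ <;> simp only <;> rcases hbtw with ⟨c1, c2⟩ | ⟨c1, c2⟩ <;> linarith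
  rcases h.vertex_on hS hw hs hsz rfl with rfl | rfl | hV
  · rcases hbtw with ⟨c1, c2⟩ | ⟨c1, c2⟩ <;> linarith
  · rcases hbtw with ⟨c1, c2⟩ | ⟨c1, c2⟩ <;> linarith
  · have := hS.inj _ hV _ hv hvz.symm
    rw [← this] at hbtw
    rcases hbtw with ⟨c1, c2⟩ | ⟨c1, c2⟩
    · exact lt_irrefl _ c2
    · exact lt_irrefl _ c1

theorem mem_closed_of_end (h : IsCell S V t b l r) (hv : v = l ∨ v = r) :
    v ∈ closedStrip b t l.1 r.1 := by
  rcases hv with rfl | rfl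
  · exact h.l_mem_closed
  · exact h.r_mem_closed

theorem mem_of_end (h : IsCell S V t b l r) (hv : v = l ∨ v = r) : v ∈ V := by
  rcases hv with rfl | rfl
  · exact h.l_mem
  · exact h.r_mem

/-- Two closed cells with a common point have a common side. -/
theorem exists_common (hS : SegSystem S V) (h : IsCell S V t b l r) (h' : IsCell S V t' b' l' r')
    (hz : z ∈ closedStrip b t l.1 r.1) (hz' : z ∈ closedStrip b' t' l'.1 r'.1) :
    (t = t' ∧ b = b' ∧ l = l' ∧ r = r') ∨
    (∃ s ∈ S, Spans s z.1 ∧ z.2 = segHeight s z.1 ∧ (s = t ∨ s = b) ∧ (s = t' ∨ s = b')) ∨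
    (∃ v ∈ V, v.1 = z.1 ∧ (v = l ∨ v = r) ∧ (v = l' ∨ v = r')) := by
  by_cases hzV : z ∈ V
  · exact Or.inr (Or.inr ⟨z, hzV, rfl, h.eq_of_mem hS hzV hz, h'.eq_of_mem hS hzV hz'⟩)
  by_cases hzS : ∃ s ∈ S, Spans s z.1 ∧ z.2 = segHeight s z.1
  · obtain ⟨s, hs, h1, h2⟩ := hzS
    refine Or.inr (Or.inl ⟨s, hs, h1, h2, ?_, ?_⟩)
    · have := h.vertex_on hS hz hs h1 h2; tauto
    · have := h'.vertex_on hS hz' hs h1 h2; tauto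
  have strict : ∀ {t b : Seg} {l r : ℝ × ℝ}, IsCell S V t b l r → z ∈ closedStrip b t l.1 r.1 →
      segHeight b z.1 < z.2 ∧ z.2 < segHeight t z.1 := by
    rintro t b l r h ⟨z1, z2, z3, z4⟩
    exact ⟨lt_of_le_of_ne z3 fun heq => hzS ⟨b, h.b_mem, h.b_spans z1 z2, heq.symm⟩,
      lt_of_le_of_ne z4 fun heq => hzS ⟨t, h.t_mem, h.t_spans z1 z2, heq⟩⟩
  have wall : ∀ {t b t' b' : Seg} {l r l' r' : ℝ × ℝ}, IsCell S V t b l r →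
      IsCell S V t' b' l' r' → z ∈ closedStrip b t l.1 r.1 → z ∈ closedStrip b' t' l'.1 r'.1 →
      ∀ v, (v = l ∨ v = r) → v.1 = z.1 → (v = l' ∨ v = r') := by
    intro t b t' b' l r l' r' h h' hz hz' v hv hvz
    have hvV := h.mem_of_end hv
    have hvc := h.mem_closed_of_end hv
    have st := strict h' hz'
    obtain ⟨z1, z2, -, -⟩ := hz'
    refine h'.eq_of_mem hS hvV ⟨hvz ▸ z1, hvz ▸ z2, ?_, ?_⟩
    · rw [hvz]
      by_contra! hlt
      exact h.not_strictBtw hS hvV hvc hz hvz h'.b_mem (h'.b_spans z1 z2) (Or.inr ⟨hlt, st.1⟩)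
    · rw [hvz]
      by_contra! hlt
      exact h.not_strictBtw hS hvV hvc hz hvz h'.t_mem (h'.t_spans z1 z2) (Or.inl ⟨st.2, hlt⟩)
  have end_or : ∀ {t b : Seg} {l r : ℝ × ℝ}, IsCell S V t b l r → z ∈ closedStrip b t l.1 r.1 →
      (∃ v, (v = l ∨ v = r) ∧ v.1 = z.1) ∨ z ∈ strip b t l.1 r.1 := by
    intro t b l r h hz
    have st := strict h hz
    obtain ⟨z1, z2, -, -⟩ := hz
    rcases z1.eq_or_lt with z1 | z1
    · exact Or.inl ⟨l, Or.inl rfl, z1⟩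
    rcases z2.eq_or_lt with z2 | z2
    · exact Or.inl ⟨r, Or.inr rfl, z2.symm⟩
    exact Or.inr ⟨z1, z2, st.1, st.2⟩
  rcases end_or h hz with ⟨v, hv, hvz⟩ | ho
  · exact Or.inr (Or.inr ⟨v, h.mem_of_end hv, hvz, hv, wall h h' hz hz' v hv hvz⟩)
  rcases end_or h' hz' with ⟨v, hv, hvz⟩ | ho₂
  · exact Or.inr (Or.inr ⟨v, h'.mem_of_end hv, hvz, wall h' h hz' hz v hv hvz, hv⟩)
  exact Or.inl (h.unique hS h' ho ho₂)

/-- A vertex of a coarser system cannot be on the wall through a point of an open coarse cell. -/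
theorem not_mem_coarse (hS : SegSystem S V) (hS' : SegSystem S' V') (hSS : S' ⊆ S) (hVV : V' ⊆ V)
    (h : IsCell S V t b l r) (h' : IsCell S' V' t' b' l' r')
    (hz : z ∈ closedStrip b t l.1 r.1) (hz' : z ∈ strip b' t' l'.1 r'.1)
    (hv : v = l ∨ v = r) (hvz : v.1 = z.1) : v ∉ V' := by
  intro hvV
  have hvc := h.mem_closed_of_end hv
  obtain ⟨z1, z2, z3, z4⟩ := hz'
  have sp1 := h'.b_spans z1.le z2.le
  have sp2 := h'.t_spans z1.le z2.le
  have k1 := h.not_strictBtw hS (hVV hvV) hvc hz hvz (hSS h'.b_mem) sp1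
  have k2 := h.not_strictBtw hS (hVV hvV) hvc hz hvz (hSS h'.t_mem) sp2
  have ht := h'.tl; have hb := h'.bl; have htr := h'.tr; have hbr := h'.br
  have n1 := hS'.ends_of_vert hvV h'.t_mem (by linarith) (by linarith)
  have n2 := hS'.ends_of_vert hvV h'.b_mem (by linarith) (by linarith)
  refine h'.noV v hvV ⟨hvz ▸ z1, hvz ▸ z2, ?_, ?_⟩
  · rw [hvz] at n2 ⊢
    refine lt_of_le_of_ne ?_ n2.symm
    by_contra! hlt
    exact k1 (Or.inr ⟨hlt, z3⟩)
  · rw [hvz] at n1 ⊢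
    refine lt_of_le_of_ne ?_ n1
    by_contra! hlt
    exact k2 (Or.inl ⟨z4, hlt⟩)

/-- A fine cell with all sides in the coarser system whose closure meets an open coarse cell is
equal to that coarse cell, and so has no vertex in it. -/
theorem strip_of_coarse (hS' : SegSystem S' V') (hSS : S' ⊆ S) (hVV : V' ⊆ V)
    (h : IsCell S V t b l r) (h' : IsCell S' V' t' b' l' r')
    (hz : z ∈ closedStrip b t l.1 r.1) (hz' : z ∈ strip b' t' l'.1 r'.1)
    (ht : t ∈ S') (hb : b ∈ S') (hl : l ∈ V') (hr : r ∈ V') (hv : v ∈ V) :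
    v ∉ strip b' t' l'.1 r'.1 := by
  have hc : IsCell S' V' t b l r := { h with
    t_mem := ht, b_mem := hb, l_mem := hl, r_mem := hr
    noV := fun v hv => h.noV v (hVV hv)
    noS := fun s hs => h.noS s (hSS hs) }
  set w : ℝ × ℝ := ((l.1 + r.1) / 2,
    (segHeight b ((l.1 + r.1) / 2) + segHeight t ((l.1 + r.1) / 2)) / 2) with hw
  have hwm : w ∈ strip b t l.1 r.1 := h.strip_nonempty
  have hcont : Filter.Tendsto (fun α : ℝ => α • w + (1 - α) • z) (nhdsWithin 0 (Set.Ioi 0))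
      (nhds z) := by
    have : Filter.Tendsto (fun α : ℝ => α • w + (1 - α) • z) (nhds 0)
        (nhds ((0 : ℝ) • w + (1 - 0 : ℝ) • z)) := by
      apply Continuous.tendsto
      fun_prop
    rw [zero_smul, sub_zero, one_smul, zero_add] at this
    exact this.mono_left nhdsWithin_le_nhds
  have e1 := hcont.eventually ((isOpen_strip _ _ _ _).mem_nhds hz')
  have e2 : ∀ᶠ α : ℝ in nhdsWithin 0 (Set.Ioi 0), α ∈ Set.Ioo (0 : ℝ) 1 :=
    Ioo_mem_nhdsGT one_pos
  obtain ⟨α, h1, h2, h3⟩ := (e1.and e2).exists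
  have h4 := combo_mem_strip hwm hz h2 (sub_nonneg.2 h3.le) (by ring)
  obtain ⟨rfl, rfl, rfl, rfl⟩ := hc.unique hS' h' h4 h1
  exact h.noV v hv

end IsCell

/-- All cells. -/
def cells (S : Finset Seg) (V : Finset (ℝ × ℝ)) : Finset (Seg × Seg × (ℝ × ℝ) × (ℝ × ℝ)) :=
  (S ×ˢ S ×ˢ V ×ˢ V).filter fun T => IsCell S V T.1 T.2.1 T.2.2.1 T.2.2.2

theorem mem_cells {T : Seg × Seg × (ℝ × ℝ) × (ℝ × ℝ)} :
    T ∈ cells S V ↔ IsCell S V T.1 T.2.1 T.2.2.1 T.2.2.2 := by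
  unfold cells
  rw [mem_filter]
  refine ⟨fun h => h.2, fun h => ⟨?_, h⟩⟩
  simp only [mem_product]
  exact ⟨h.t_mem, h.b_mem, h.l_mem, h.r_mem⟩

/-- A label of the left side of a cell. -/
def leftLabel (T : Seg × Seg × (ℝ × ℝ) × (ℝ × ℝ)) : Seg ⊕ Seg ⊕ (ℝ × ℝ) :=
  if T.2.2.1 = T.1.1 then .inl T.1 else if T.2.2.1 = T.2.1.1 then .inr (.inl T.2.1)
    else .inr (.inr T.2.2.1)

theorem SegSystem.leftLabel_injOn (hS : SegSystem S V) :
    Set.InjOn leftLabel (cells S V : Set _) := by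
  rintro ⟨t, b, l, r⟩ hT ⟨t', b', l', r'⟩ hT' heq
  have h := mem_cells.1 (mem_coe.1 hT)
  have h' := mem_cells.1 (mem_coe.1 hT')
  simp only at h h'
  suffices hz : ∃ z, z ∈ strip b t l.1 r.1 ∧ z ∈ strip b' t' l'.1 r'.1 by
    obtain ⟨z, hz, hz'⟩ := hz
    obtain ⟨rfl, rfl, rfl, rfl⟩ := h.unique hS h' hz hz'
    rfl
  have hlr := h.lr
  have hlr' := h'.lr
  unfold leftLabel at heq
  simp only at heq
  split_ifs at heq
  all_goals try (exfalso; simp at heq; done)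
  · obtain rfl : t = t' := Sum.inl_injective heq
    have hll : l = l' := Eq.trans ‹l = t.1› (Eq.symm ‹l' = t.1›)
    subst hll
    obtain ⟨x, x1, x2⟩ := exists_between (lt_min hlr hlr')
    have x3 := x2.trans_le (min_le_left _ _)
    have x4 := x2.trans_le (min_le_right _ _)
    obtain ⟨y, y1, y2⟩ := exists_between (max_lt (h.lt x x1 x3) (h'.lt x x1 x4))
    exact ⟨(x, y), ⟨x1, x3, (le_max_left _ _).trans_lt y1, y2⟩,
      ⟨x1, x4, (le_max_right _ _).trans_lt y1, y2⟩⟩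
  · obtain rfl : b = b' := Sum.inl_injective (Sum.inr_injective heq)
    have hll : l = l' := Eq.trans ‹l = b.1› (Eq.symm ‹l' = b.1›)
    subst hll
    obtain ⟨x, x1, x2⟩ := exists_between (lt_min hlr hlr')
    have x3 := x2.trans_le (min_le_left _ _)
    have x4 := x2.trans_le (min_le_right _ _)
    obtain ⟨y, y1, y2⟩ := exists_between (lt_min (h.lt x x1 x3) (h'.lt x x1 x4))
    exact ⟨(x, y), ⟨x1, x3, y1, y2.trans_le (min_le_left _ _)⟩,
      ⟨x1, x4, y1, y2.trans_le (min_le_right _ _)⟩⟩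
  · obtain rfl : l = l' := Sum.inr_injective (Sum.inr_injective heq)
    have strict : ∀ {t b : Seg} {r : ℝ × ℝ}, IsCell S V t b l r → l ≠ t.1 → l ≠ b.1 →
        ∀ᶠ x in nhdsWithin l.1 (Set.Ioi l.1), (x, l.2) ∈ strip b t l.1 r.1 := by
      intro t b r h h1 h2
      have hlr := h.lr
      have s1 : segHeight b l.1 < l.2 := by
        refine lt_of_le_of_ne h.l_low fun heq => ?_
        rcases hS.vert l h.l_mem b h.b_mem (h.b_spans le_rfl hlr.le) heq.symm with h3 | h3
        · exact h2 h3
        · have := h.br; rw [← h3] at this; linarith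
      have s2 : l.2 < segHeight t l.1 := by
        refine lt_of_le_of_ne h.l_up fun heq => ?_
        rcases hS.vert l h.l_mem t h.t_mem (h.t_spans le_rfl hlr.le) heq with h3 | h3
        · exact h1 h3
        · have := h.tr; rw [← h3] at this; linarith
      have e1 : ∀ᶠ x in nhdsWithin l.1 (Set.Ioi l.1), segHeight b x < l.2 :=
        nhdsWithin_le_nhds ((isOpen_lt (segHeight_continuous b) continuous_const).mem_nhds s1)
      have e2 : ∀ᶠ x in nhdsWithin l.1 (Set.Ioi l.1), l.2 < segHeight t x :=
        nhdsWithin_le_nhds ((isOpen_lt continuous_const (segHeight_continuous t)).mem_nhds s2)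
      have e3 : ∀ᶠ x in nhdsWithin l.1 (Set.Ioi l.1), x ∈ Set.Ioo l.1 r.1 := Ioo_mem_nhdsGT hlr
      filter_upwards [e1, e2, e3] with x x1 x2 x3
      exact ⟨x3.1, x3.2, x1, x2⟩
    obtain ⟨x, hx⟩ := ((strict h ‹_› ‹_›).and (strict h' ‹_› ‹_›)).exists
    exact ⟨_, hx⟩

theorem SegSystem.card_cells_le (hS : SegSystem S V) : (cells S V).card ≤ 2 * S.card + V.card := by
  have : (cells S V).card ≤ (S.disjSum (S.disjSum V)).card := by
    refine card_le_card_of_injOn leftLabel (fun T hT => ?_) hS.leftLabel_injOn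
    have h := mem_cells.1 (mem_coe.1 hT)
    rw [mem_coe]
    unfold leftLabel
    split_ifs
    · exact inl_mem_disjSum.2 h.t_mem
    · exact inr_mem_disjSum.2 (inl_mem_disjSum.2 h.b_mem)
    · exact inr_mem_disjSum.2 (inr_mem_disjSum.2 h.l_mem)
  rw [card_disjSum, card_disjSum] at this
  omega

end TrapezoidCells

section TrapezoidCover

variable {S : Finset Seg} {V : Finset (ℝ × ℝ)}

namespace SegSystem

/-- A point in general position that lies above some segment and below some segment is in the
interior of a cell. -/
theorem exists_cell (hS : SegSystem S V) {z : ℝ × ℝ} (hzV : ∀ v ∈ V, v.1 ≠ z.1)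
    (hzS : ∀ s ∈ S, Spans s z.1 → z.2 ≠ segHeight s z.1)
    (hup : ∃ s ∈ S, Spans s z.1 ∧ z.2 < segHeight s z.1)
    (hlow : ∃ s ∈ S, Spans s z.1 ∧ segHeight s z.1 < z.2) :
    ∃ t b l r, IsCell S V t b l r ∧ z ∈ strip b t l.1 r.1 := by
  obtain ⟨t, ht, htmin⟩ := (S.filter fun s => Spans s z.1 ∧ z.2 < segHeight s z.1).exists_min_image
    (fun s => segHeight s z.1) (by obtain ⟨s, h1, h2⟩ := hup; exact ⟨s, mem_filter.2 ⟨h1, h2⟩⟩)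
  obtain ⟨b, hb, hbmax⟩ := (S.filter fun s => Spans s z.1 ∧ segHeight s z.1 < z.2).exists_max_image
    (fun s => segHeight s z.1) (by obtain ⟨s, h1, h2⟩ := hlow; exact ⟨s, mem_filter.2 ⟨h1, h2⟩⟩)
  obtain ⟨htS, hts, htz⟩ := mem_filter.1 ht
  obtain ⟨hbS, hbs, hbz⟩ := mem_filter.1 hb
  have opn : ∀ s ∈ S, Spans s z.1 → s.1.1 < z.1 ∧ z.1 < s.2.1 := fun s hs h =>
    ⟨lt_of_le_of_ne h.1 (hzV _ (hS.fst_mem s hs)), lt_of_le_of_ne h.2 (hzV _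
      (hS.snd_mem s hs)).symm⟩
  obtain ⟨t1, t2⟩ := opn t htS hts
  obtain ⟨b1, b2⟩ := opn b hbS hbs
  have hbt : b ≠ t := by rintro rfl; linarith
  have le : ∀ x, Spans b x → Spans t x → segHeight b x ≤ segHeight t x := fun x h1 h2 =>
    hS.le_of_lt hbS htS hbs hts h1 h2 (hbz.trans htz)
  obtain ⟨l, hl, hlmax⟩ := (V.filter fun v => v.1 < z.1 ∧ t.1.1 ≤ v.1 ∧ b.1.1 ≤ v.1 ∧
      segHeight b v.1 ≤ v.2 ∧ v.2 ≤ segHeight t v.1).exists_max_image Prod.fst (by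
    rcases le_total t.1.1 b.1.1 with h | h
    · refine ⟨b.1, mem_filter.2 ⟨hS.fst_mem b hbS, b1, h, le_rfl, (segHeight_left b).le, ?_⟩⟩
      rw [← segHeight_left]
      exact le _ ⟨le_rfl, (hS.lt b hbS).le⟩ ⟨h, (b1.trans t2).le⟩
    · refine ⟨t.1, mem_filter.2 ⟨hS.fst_mem t htS, t1, le_rfl, h, ?_, (segHeight_left t).ge⟩⟩
      rw [← segHeight_left t]
      exact le _ ⟨h, (t1.trans b2).le⟩ ⟨le_rfl, (hS.lt t htS).le⟩)
  obtain ⟨r, hr, hrmin⟩ := (V.filter fun v => z.1 < v.1 ∧ v.1 ≤ t.2.1 ∧ v.1 ≤ b.2.1 ∧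
      segHeight b v.1 ≤ v.2 ∧ v.2 ≤ segHeight t v.1).exists_min_image Prod.fst (by
    rcases le_total b.2.1 t.2.1 with h | h
    · refine ⟨b.2, mem_filter.2 ⟨hS.snd_mem b hbS, b2, h, le_rfl,
        (segHeight_right (hS.lt b hbS)).le, ?_⟩⟩
      rw [← segHeight_right (hS.lt b hbS)]
      exact le _ ⟨(hS.lt b hbS).le, le_rfl⟩ ⟨(t1.trans b2).le, h⟩
    · refine ⟨t.2, mem_filter.2 ⟨hS.snd_mem t htS, t2, le_rfl, h, ?_,
        (segHeight_right (hS.lt t htS)).ge⟩⟩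
      rw [← segHeight_right (hS.lt t htS)]
      exact le _ ⟨(b1.trans t2).le, h⟩ ⟨(hS.lt t htS).le, le_rfl⟩)
  obtain ⟨hlV, l1, l2, l3, l4, l5⟩ := mem_filter.1 hl
  obtain ⟨hrV, r1, r2, r3, r4, r5⟩ := mem_filter.1 hr
  have hlt : ∀ x, l.1 < x → x < r.1 → segHeight b x < segHeight t x := fun x h1 h2 =>
    lt_of_le_of_ne (le x ⟨(l3.trans_lt h1).le, (h2.trans_le r3).le⟩
      ⟨(l2.trans_lt h1).le, (h2.trans_le r2).le⟩)
      (hS.height_ne hbS htS hbt (l3.trans_lt h1) (h2.trans_le r3)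
        ⟨(l2.trans_lt h1).le, (h2.trans_le r2).le⟩)
  refine ⟨t, b, l, r, ⟨htS, hbS, hlV, hrV, l1.trans r1, l2, r2, l3, r3, l4, l5, r4, r5, hlt,
    ?_, ?_⟩,
    l1, r1, hbz, htz⟩
  · rintro v hv ⟨v1, v2, v3, v4⟩
    rcases (hzV v hv).lt_or_gt with h | h
    · exact v1.not_ge (hlmax v (mem_filter.2 ⟨hv, h, (l2.trans_lt v1).le, (l3.trans_lt v1).le,
        v3.le, v4.le⟩))
    · exact v2.not_ge (hrmin v (mem_filter.2 ⟨hv, h, (v2.trans_le r2).le, (v2.trans_le r3).le,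
        v3.le, v4.le⟩))
  · rintro s hs x x1 x2 hsx ⟨-, -, x3, x4⟩
    simp only at x3 x4
    have spt : Spans t x := ⟨(l2.trans_lt x1).le, (x2.trans_le r2).le⟩
    have spb : Spans b x := ⟨(l3.trans_lt x1).le, (x2.trans_le r3).le⟩
    by_cases hsz : Spans s z.1
    · rcases (hzS s hs hsz).lt_or_gt with h | h
      · have h1 := htmin s (mem_filter.2 ⟨hs, hsz, h⟩)
        have hst : t ≠ s := by rintro rfl; exact lt_irrefl _ x4
        have h2 := hS.height_ne htS hs hst t1 t2 hsz
        exact x4.not_ge (hS.le_of_lt htS hs hts hsz spt hsx (lt_of_le_of_ne h1 h2))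
      · have h1 := hbmax s (mem_filter.2 ⟨hs, hsz, h⟩)
        have hst : b ≠ s := by rintro rfl; exact lt_irrefl _ x3
        have h2 := hS.height_ne hbS hs hst b1 b2 hsz
        exact x3.not_ge (hS.le_of_lt hs hbS hsz hbs hsx spb (lt_of_le_of_ne h1 h2.symm))
    · have hends : s.2.1 < z.1 ∨ z.1 < s.1.1 := by
        by_contra! h
        exact hsz ⟨h.2, h.1⟩
      rcases hends with h | h
      · have e := segHeight_right (hS.lt s hs)
        have sp1 : Spans s s.2.1 := ⟨(hS.lt s hs).le, le_rfl⟩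
        have sp2 : Spans b s.2.1 := ⟨spb.1.trans hsx.2, (h.trans b2).le⟩
        have sp3 : Spans t s.2.1 := ⟨spt.1.trans hsx.2, (h.trans t2).le⟩
        have := hlmax s.2 (mem_filter.2 ⟨hS.snd_mem s hs, h, sp3.1, sp2.1,
          e ▸ hS.le_of_lt hbS hs spb hsx sp2 sp1 x3, e ▸ hS.le_of_lt hs htS hsx spt sp1 sp3 x4⟩)
        exact (x1.trans_le hsx.2).not_ge this
      · have e := segHeight_left s
        have sp1 : Spans s s.1.1 := ⟨le_rfl, (hS.lt s hs).le⟩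
        have sp2 : Spans b s.1.1 := ⟨(b1.trans h).le, hsx.1.trans spb.2⟩
        have sp3 : Spans t s.1.1 := ⟨(t1.trans h).le, hsx.1.trans spt.2⟩
        have := hrmin s.1 (mem_filter.2 ⟨hS.fst_mem s hs, h, sp3.2, sp2.2,
          e ▸ hS.le_of_lt hbS hs spb hsx sp2 sp1 x3, e ▸ hS.le_of_lt hs htS hsx spt sp1 sp3 x4⟩)
        exact (hsx.1.trans_lt x2).not_ge this

/-- The closed cells cover the region between two segments. -/
theorem exists_closed_cell (hS : SegSystem S V) {bot top : Seg} (hb : bot ∈ S) (ht : top ∈ S)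
    (h1 : top.1.1 ≤ bot.1.1) (h2 : bot.2.1 ≤ top.2.1) {z : ℝ × ℝ}
    (hz : z ∈ strip bot top bot.1.1 bot.2.1) :
    ∃ T ∈ cells S V, z ∈ closedStrip T.2.1 T.1 T.2.2.1.1 T.2.2.2.1 := by
  by_contra! hno
  set U : Set (ℝ × ℝ) := ⋃ T ∈ cells S V, closedStrip T.2.1 T.1 T.2.2.1.1 T.2.2.2.1 with hU
  have hUc : IsClosed U :=
    (cells S V).finite_toSet.isClosed_biUnion fun T _ => isClosed_closedStrip _ _ _ _
  have hO : IsOpen (strip bot top bot.1.1 bot.2.1 ∩ Uᶜ) :=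
    (isOpen_strip _ _ _ _).inter hUc.isOpen_compl
  have hzO : z ∈ strip bot top bot.1.1 bot.2.1 ∩ Uᶜ := by
    refine ⟨hz, fun hzU => ?_⟩
    simp only [hU, Set.mem_iUnion] at hzU
    obtain ⟨T, hT, hzT⟩ := hzU
    exact hno T hT hzT
  obtain ⟨A, B, hA, hB, hzA, hzB, hAB⟩ := isOpen_prod_iff.1 hO z.1 z.2 hzO
  obtain ⟨x, hx, hxV⟩ := (infinite_of_mem_nhds _ (hA.mem_nhds hzA)).exists_notMem_finset
    (V.image Prod.fst)
  obtain ⟨y, hy, hyS⟩ := (infinite_of_mem_nhds _ (hB.mem_nhds hzB)).exists_notMem_finset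
    (S.image fun s => segHeight s x)
  obtain ⟨⟨w1, w2, w3, w4⟩, hw⟩ : (x, y) ∈ strip bot top bot.1.1 bot.2.1 ∩ Uᶜ := hAB ⟨hx, hy⟩
  simp only at w1 w2 w3 w4
  obtain ⟨t, b, l, r, hc, hwc⟩ := hS.exists_cell (z := (x, y))
    (fun v hv h => hxV (mem_image.2 ⟨v, hv, h⟩))
    (fun s hs _ h => hyS (mem_image.2 ⟨s, hs, h.symm⟩))
    ⟨top, ht, ⟨by simp only; linarith, by simp only; linarith⟩, w4⟩
    ⟨bot, hb, ⟨by simp only; linarith, by simp only; linarith⟩, w3⟩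
  apply hw
  simp only [hU, Set.mem_iUnion]
  exact ⟨(t, b, l, r), mem_cells.2 hc, strip_subset_closedStrip _ _ _ _ hwc⟩

end SegSystem

end TrapezoidCover

section Incidence

variable {S S' : Finset Seg} {V V' : Finset (ℝ × ℝ)}

/-- The cells, segments and vertices of a system. -/
abbrev Node (S : Finset Seg) (V : Finset (ℝ × ℝ)) : Type := ↥(cells S V) ⊕ ↥S ⊕ ↥V

/-- Incidence between cells and segments, cells and vertices, segments and vertices. -/
def Inc : Node S V → Node S V → Prop
  | .inl T, .inr (.inl s) => s.1 = T.1.1 ∨ s.1 = T.1.2.1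
  | .inl T, .inr (.inr v) => v.1 = T.1.2.2.1 ∨ v.1 = T.1.2.2.2
  | .inr (.inl s), .inr (.inr v) => v.1 = s.1.1 ∨ v.1 = s.1.2
  | _, _ => False

/-- The incidence graph of cells, segments and vertices. -/
def incGraph (S : Finset Seg) (V : Finset (ℝ × ℝ)) : SimpleGraph (Node S V) :=
  SimpleGraph.fromRel Inc

theorem incGraph_adj_of_inc {a b : Node S V} (h : Inc a b) : (incGraph S V).Adj a b := by
  refine (SimpleGraph.fromRel_adj _ _ _).2 ⟨?_, Or.inl h⟩
  rintro rfl
  rcases a with T | s | v <;> exact h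

/-- The part of the plane that belongs to a node. -/
def Node.region : Node S V → Set (ℝ × ℝ)
  | .inl T => strip T.1.2.1 T.1.1 T.1.2.2.1.1 T.1.2.2.2.1
  | .inr (.inl s) => {z | s.1.1.1 < z.1 ∧ z.1 < s.1.2.1 ∧ z.2 = segHeight s.1 z.1}
  | .inr (.inr v) => {v.1}

theorem Node.disjoint_region (hS : SegSystem S V) {a b : Node S V} (hab : a ≠ b) :
    Disjoint a.region b.region := by
  have ts : ∀ (T : ↥(cells S V)) (s : ↥S),
      Disjoint (Node.region (.inl T) : Set (ℝ × ℝ))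
          (Node.region (S := S) (V := V) (.inr (.inl s))) := by
    intro T s
    refine Set.disjoint_left.2 fun z hz hz' => ?_
    obtain ⟨z1, z2, z3⟩ := hz'
    refine (mem_cells.1 T.2).noS s.1 s.2 z.1 hz.1 hz.2.1 ⟨z1.le, z2.le⟩ ?_
    rw [← z3]
    exact hz
  have tv : ∀ (T : ↥(cells S V)) (v : ↥V),
      Disjoint (Node.region (.inl T) : Set (ℝ × ℝ))
          (Node.region (S := S) (V := V) (.inr (.inr v))) := by
    intro T v
    refine Set.disjoint_left.2 fun z hz hz' => ?_
    obtain rfl : z = v.1 := hz'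
    exact (mem_cells.1 T.2).noV v.1 v.2 hz
  have sv : ∀ (s : ↥S) (v : ↥V), Disjoint (Node.region (S := S) (V := V) (.inr (.inl s)))
      (Node.region (S := S) (V := V) (.inr (.inr v))) := by
    intro s v
    refine Set.disjoint_left.2 fun z hz hz' => ?_
    obtain rfl : z = v.1 := hz'
    exact hS.ends_of_vert v.2 s.2 hz.1 hz.2.1 hz.2.2
  rcases a with T | s | v <;> rcases b with T' | s' | v'
  · refine Set.disjoint_left.2 fun z hz hz' => hab ?_
    obtain ⟨h1, h2, h3, h4⟩ := (mem_cells.1 T.2).unique hS (mem_cells.1 T'.2) hz hz'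
    exact congrArg Sum.inl (Subtype.ext (Prod.ext h1 (Prod.ext h2 (Prod.ext h3 h4))))
  · exact ts _ _
  · exact tv _ _
  · exact (ts _ _).symm
  · refine Set.disjoint_left.2 fun z hz hz' => ?_
    refine hS.height_ne s.2 s'.2 (fun h => hab (by rw [Subtype.ext h])) hz.1 hz.2.1
      ⟨hz'.1.le, hz'.2.1.le⟩ (hz.2.2.symm.trans hz'.2.2)
  · exact sv _ _
  · exact (tv _ _).symm
  · exact (sv _ _).symm
  · refine Set.disjoint_singleton.2 fun h => hab ?_
    rw [Subtype.ext h]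

/-- A point of the region of a node. -/
def Node.centre : Node S V → ℝ × ℝ
  | .inl T => ((T.1.2.2.1.1 + T.1.2.2.2.1) / 2,
      (segHeight T.1.2.1 ((T.1.2.2.1.1 + T.1.2.2.2.1) / 2) +
      segHeight T.1.1 ((T.1.2.2.1.1 + T.1.2.2.2.1) / 2)) / 2)
  | .inr (.inl s) => ((s.1.1.1 + s.1.2.1) / 2, segHeight s.1 ((s.1.1.1 + s.1.2.1) / 2))
  | .inr (.inr v) => v.1

theorem Node.centre_mem (hS : SegSystem S V) (a : Node S V) : a.centre ∈ a.region := by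
  rcases a with T | s | v
  · exact (mem_cells.1 T.2).strip_nonempty
  · have := hS.lt s.1 s.2
    refine ⟨?_, ?_, rfl⟩ <;> simp only [Node.centre] <;> linarith
  · rfl

/-- The bends used to draw an edge of the incidence graph. -/
def Node.bends : Node S V → Node S V → List (ℝ × ℝ)
  | .inl T, .inr (.inl s) =>
      [((T.1.2.2.1.1 + T.1.2.2.2.1) / 2, segHeight s.1 ((T.1.2.2.1.1 + T.1.2.2.2.1) / 2))]
  | .inr (.inl s), .inl T =>
      [((T.1.2.2.1.1 + T.1.2.2.2.1) / 2, segHeight s.1 ((T.1.2.2.1.1 + T.1.2.2.2.1) / 2))]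
  | _, _ => []

theorem segment_subset_union_singleton {K : Set (ℝ × ℝ)} {w z : ℝ × ℝ}
    (h : ∀ α β : ℝ, 0 < α → 0 ≤ β → α + β = 1 → α • w + β • z ∈ K) : segment ℝ w z ⊆ K ∪ {z} := by
  rintro _ ⟨α, β, hα, hβ, hαβ, rfl⟩
  rcases hα.eq_or_lt with rfl | hα
  · obtain rfl : β = 1 := by linarith
    right
    simp
  · exact Or.inl (h α β hα hβ hαβ)

theorem Node.curve_subset (hS : SegSystem S V) {a b : Node S V} (h : Inc a b) :
    polylineOf (a.centre :: (a.bends b ++ [b.centre])) ⊆ a.region ∪ b.region ∧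
    polylineOf (b.centre :: (b.bends a ++ [a.centre])) ⊆ a.region ∪ b.region := by
  rcases a with T | s | v <;> rcases b with T' | s' | v'
  · exact h.elim
  · have hT := mem_cells.1 T.2
    obtain ⟨hm, hme⟩ : ((T.1.2.2.1.1 + T.1.2.2.2.1) / 2, segHeight s'.1
        ((T.1.2.2.1.1 + T.1.2.2.2.1) / 2)) ∈ closedStrip T.1.2.1 T.1.1 T.1.2.2.1.1 T.1.2.2.2.1 ∧
        ((T.1.2.2.1.1 + T.1.2.2.2.1) / 2, segHeight s'.1 ((T.1.2.2.1.1 + T.1.2.2.2.1) / 2)) ∈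
          Node.region (S := S) (V := V) (.inr (.inl s')) := by
      have h1 := hT.lr
      have h2 := hT.tl; have h3 := hT.tr; have h4 := hT.bl; have h5 := hT.br
      have h6 := hT.lt ((T.1.2.2.1.1 + T.1.2.2.2.1) / 2) (by linarith) (by linarith)
      rcases h with h | h <;> rw [Node.region, h]
      · exact ⟨⟨by simp only; linarith, by simp only; linarith, h6.le, le_rfl⟩,
          ⟨by simp only; linarith, by simp only; linarith, rfl⟩⟩
      · exact ⟨⟨by simp only; linarith, by simp only; linarith, le_rfl, h6.le⟩,
          ⟨by simp only; linarith, by simp only; linarith, rfl⟩⟩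
    set m : ℝ × ℝ := ((T.1.2.2.1.1 + T.1.2.2.2.1) / 2, segHeight s'.1
        ((T.1.2.2.1.1 + T.1.2.2.2.1) / 2)) with hmdef
    have e1 : segment ℝ (Node.centre (.inl T : Node S V)) m ⊆
        Node.region (.inl T : Node S V) ∪ Node.region (.inr (.inl s') : Node S V) :=
      (segment_subset_union_singleton fun α β hα hβ hαβ =>
        combo_mem_strip hT.strip_nonempty hm hα hβ hαβ).trans
        (Set.union_subset_union_right _ (Set.singleton_subset_iff.2 hme))
    have hconv : Convex ℝ (Node.region (.inr (.inl s') : Node S V)) := by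
      rintro w ⟨w1, w2, w3⟩ z ⟨z1, z2, z3⟩ α β hα hβ hαβ
      obtain rfl : β = 1 - α := by linarith
      refine ⟨?_, ?_, ?_⟩ <;>
        simp only [Prod.fst_add, Prod.smul_fst, Prod.snd_add, Prod.smul_snd, smul_eq_mul]
      · rcases hα.eq_or_lt with rfl | hα
        · linarith
        · nlinarith [mul_pos hα (sub_pos.2 w1), mul_nonneg hβ (sub_pos.2 z1).le]
      · rcases hα.eq_or_lt with rfl | hα
        · linarith
        · nlinarith [mul_pos hα (sub_pos.2 w2), mul_nonneg hβ (sub_pos.2 z2).le]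
      · rw [segHeight_combo _ _ _ _ _ hαβ, w3, z3]
    have e2 : segment ℝ m (Node.centre (.inr (.inl s') : Node S V)) ⊆
        Node.region (.inl T : Node S V) ∪ Node.region (.inr (.inl s') : Node S V) :=
      (hconv.segment_subset hme (Node.centre_mem hS _)).trans Set.subset_union_right
    constructor
    · simp only [Node.bends, List.cons_append, List.nil_append, polylineOf_cons_cons,
        polylineOf_singleton, Set.union_empty]
      exact Set.union_subset e1 e2
    · simp only [Node.bends, List.cons_append, List.nil_append, polylineOf_cons_cons,
        polylineOf_singleton, Set.union_empty]
      exact Set.union_subset (by rw [segment_symm]; exact e2) (by rw [segment_symm]; exact e1)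
  · have hT := mem_cells.1 T.2
    have hm := hT.mem_closed_of_end h
    have e1 : segment ℝ (Node.centre (.inl T : Node S V)) v'.1 ⊆
        Node.region (.inl T : Node S V) ∪ Node.region (.inr (.inr v') : Node S V) :=
      segment_subset_union_singleton fun α β hα hβ hαβ =>
        combo_mem_strip hT.strip_nonempty hm hα hβ hαβ
    constructor <;> simp only [Node.bends, List.nil_append, polylineOf_cons_cons,
        polylineOf_singleton, Set.union_empty]
    · exact e1
    · rw [segment_symm]; exact e1
  · exact h.elim
  · exact h.elim
  · have hlt := hS.lt s.1 s.2
    have e1 : segment ℝ (Node.centre (.inr (.inl s) : Node S V)) v'.1 ⊆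
        Node.region (.inr (.inl s) : Node S V) ∪ Node.region (.inr (.inr v') : Node S V) := by
      refine segment_subset_union_singleton fun α β hα hβ hαβ => ?_
      have hv : v'.1.2 = segHeight s.1 v'.1.1 := by
        rcases h with h | h <;> rw [h]
        · exact (segHeight_left _).symm
        · exact (segHeight_right hlt).symm
      have h1 : s.1.1.1 ≤ v'.1.1 ∧ v'.1.1 ≤ s.1.2.1 := by
        rcases h with h | h <;> rw [h]
        · exact ⟨le_rfl, hlt.le⟩
        · exact ⟨hlt.le, le_rfl⟩
      obtain rfl : β = 1 - α := by linarith
      refine ⟨?_, ?_, ?_⟩ <;> simp only [Node.centre, Prod.fst_add, Prod.smul_fst, Prod.snd_add,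
        Prod.smul_snd, smul_eq_mul]
      · nlinarith [mul_pos hα (sub_pos.2 hlt), mul_nonneg hβ (sub_nonneg.2 h1.1)]
      · nlinarith [mul_pos hα (sub_pos.2 hlt), mul_nonneg hβ (sub_nonneg.2 h1.2)]
      · rw [segHeight_combo _ _ _ _ _ hαβ, hv]
    constructor <;> simp only [Node.bends, List.nil_append, polylineOf_cons_cons,
        polylineOf_singleton, Set.union_empty]
    · exact e1
    · rw [segment_symm]; exact e1
  · exact h.elim
  · exact h.elim
  · exact h.elim

theorem not_hasCliqueMinor_incGraph (hS : SegSystem S V) : ¬ HasCliqueMinor (incGraph S V) 5 := by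
  have key : ∀ a b : Node S V, (incGraph S V).Adj a b →
      polylineOf (a.centre :: (a.bends b ++ [b.centre])) ⊆ a.region ∪ b.region := by
    intro a b hab
    rcases ((SimpleGraph.fromRel_adj _ _ _).1 hab).2 with h | h
    · exact (Node.curve_subset hS h).1
    · rw [Set.union_comm]
      exact (Node.curve_subset hS h).2
  refine not_hasCliqueMinor_five (incGraph S V) Node.centre Node.bends ?_
  intro u v x y huv hxy h1 h2 h3 h4
  refine Disjoint.mono (key u v huv) (key x y hxy) ?_
  rw [Set.disjoint_union_left, Set.disjoint_union_right, Set.disjoint_union_right]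
  exact ⟨⟨Node.disjoint_region hS h1, Node.disjoint_region hS h2⟩,
    ⟨Node.disjoint_region hS h3, Node.disjoint_region hS h4⟩⟩

theorem card_node_le (hS : SegSystem S V) :
    Fintype.card (Node S V) ≤ 3 * S.card + 2 * V.card := by
  have := hS.card_cells_le
  rw [Fintype.card_sum, Fintype.card_sum, Fintype.card_coe, Fintype.card_coe, Fintype.card_coe]
  omega

end Incidence

section Coarsening

variable {S : Finset Seg} {V : Finset (ℝ × ℝ)} {bot top : Seg} {X : Finset (Node S V)}

/-- The segments at a node. -/
def Node.segs : Node S V → Finset Seg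
  | .inl T => {T.1.1, T.1.2.1}
  | .inr (.inl s) => {s.1}
  | .inr (.inr _) => ∅

/-- The vertices at a node, other than the ends of segments. -/
def Node.verts : Node S V → Finset (ℝ × ℝ)
  | .inl T => {T.1.2.2.1, T.1.2.2.2}
  | .inr (.inl _) => ∅
  | .inr (.inr v) => {v.1}

/-- The segments at the nodes of `X`, together with two further segments. -/
def coarseSegs (X : Finset (Node S V)) (bot top : Seg) : Finset Seg :=
  X.biUnion Node.segs ∪ {bot, top}

/-- The vertices at the nodes of `X` and the ends of the segments of the coarse system. -/
def coarseVerts (X : Finset (Node S V)) (bot top : Seg) : Finset (ℝ × ℝ) :=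
  X.biUnion Node.verts ∪ ((coarseSegs X bot top).image Prod.fst ∪
    (coarseSegs X bot top).image Prod.snd)

theorem coarseSegs_subset (hb : bot ∈ S) (ht : top ∈ S) : coarseSegs X bot top ⊆ S := by
  refine union_subset (biUnion_subset.2 ?_) ?_
  · rintro (T | s | v) -
    · have := mem_cells.1 T.2
      exact insert_subset_iff.2 ⟨this.t_mem, singleton_subset_iff.2 this.b_mem⟩
    · exact singleton_subset_iff.2 s.2
    · exact empty_subset _
  · exact insert_subset_iff.2 ⟨hb, singleton_subset_iff.2 ht⟩

theorem coarseVerts_subset (hS : SegSystem S V) (hb : bot ∈ S) (ht : top ∈ S) :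
    coarseVerts X bot top ⊆ V := by
  have hsub := coarseSegs_subset (X := X) hb ht
  refine union_subset (biUnion_subset.2 ?_) (union_subset ?_ ?_)
  · rintro (T | s | v) -
    · have := mem_cells.1 T.2
      exact insert_subset_iff.2 ⟨this.l_mem, singleton_subset_iff.2 this.r_mem⟩
    · exact empty_subset _
    · exact singleton_subset_iff.2 v.2
  · exact image_subset_iff.2 fun s hs => hS.fst_mem s (hsub hs)
  · exact image_subset_iff.2 fun s hs => hS.snd_mem s (hsub hs)

theorem coarse_segSystem (hS : SegSystem S V) (hb : bot ∈ S) (ht : top ∈ S) :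
    SegSystem (coarseSegs X bot top) (coarseVerts X bot top) :=
  hS.mono (coarseSegs_subset hb ht) (coarseVerts_subset hS hb ht)
    (fun _ hs => mem_union_right _ (mem_union_left _ (mem_image_of_mem _ hs)))
    (fun _ hs => mem_union_right _ (mem_union_right _ (mem_image_of_mem _ hs)))

theorem card_coarseSegs_le : (coarseSegs X bot top).card ≤ 2 * X.card + 2 := by
  refine (card_union_le _ _).trans (Nat.add_le_add ?_ card_le_two)
  rw [mul_comm]
  refine card_biUnion_le_card_mul _ _ _ ?_
  rintro (T | s | v) -
  · exact card_le_two
  · exact (card_singleton _).le.trans (by norm_num)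
  · exact (card_empty).le.trans (by norm_num)

theorem card_coarseVerts_le : (coarseVerts X bot top).card ≤ 6 * X.card + 4 := by
  have h1 : (X.biUnion Node.verts).card ≤ X.card * 2 := by
    refine card_biUnion_le_card_mul _ _ _ ?_
    rintro (T | s | v) -
    · exact card_le_two
    · exact (card_empty).le.trans (by norm_num)
    · exact (card_singleton _).le.trans (by norm_num)
  have h2 := card_coarseSegs_le (X := X) (bot := bot) (top := top)
  have h3 := card_image_le (s := coarseSegs X bot top) (f := Prod.fst)
  have h4 := card_image_le (s := coarseSegs X bot top) (f := Prod.snd)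
  have h5 := card_union_le ((coarseSegs X bot top).image Prod.fst)
    ((coarseSegs X bot top).image Prod.snd)
  have h6 := card_union_le (X.biUnion Node.verts) ((coarseSegs X bot top).image Prod.fst ∪
    (coarseSegs X bot top).image Prod.snd)
  unfold coarseVerts
  omega

theorem card_coarse_cells_le (hS : SegSystem S V) (hb : bot ∈ S) (ht : top ∈ S) :
    (cells (coarseSegs X bot top) (coarseVerts X bot top)).card ≤ 10 * X.card + 8 := by
  have h1 := (coarse_segSystem (X := X) hS hb ht).card_cells_le
  have h2 := card_coarseSegs_le (X := X) (bot := bot) (top := top)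
  have h3 := card_coarseVerts_le (X := X) (bot := bot) (top := top)
  omega

theorem Node.segs_subset_coarse {a : Node S V} (ha : a ∈ X) {s : Seg} (hs : s ∈ a.segs) :
    s ∈ coarseSegs X bot top :=
  mem_union_left _ (mem_biUnion.2 ⟨a, ha, hs⟩)

theorem Node.verts_subset_coarse {a : Node S V} (ha : a ∈ X) {v : ℝ × ℝ} (hv : v ∈ a.verts) :
    v ∈ coarseVerts X bot top :=
  mem_union_left _ (mem_biUnion.2 ⟨a, ha, hv⟩)

/-- The incidence graph without the nodes of `X`. -/
def incGraphDiff (X : Finset (Node S V)) : SimpleGraph (Node S V) where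
  Adj a b := (incGraph S V).Adj a b ∧ a ∉ X ∧ b ∉ X
  symm := ⟨fun _ _ h => ⟨h.1.symm, h.2.2, h.2.1⟩⟩
  loopless := ⟨fun _ h => (incGraph S V).loopless.irrefl _ h.1⟩

/-- Vertices in the same open coarse cell are connected in the complement of `X`. -/
theorem reachable_of_mem_strip (hS : SegSystem S V) (hb : bot ∈ S) (ht : top ∈ S)
    (h1 : top.1.1 ≤ bot.1.1) (h2 : bot.2.1 ≤ top.2.1) {t' b' : Seg} {l' r' : ℝ × ℝ}
    (hc : IsCell (coarseSegs X bot top) (coarseVerts X bot top) t' b' l' r') {p q : ↥V}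
    (hp : p.1 ∈ strip b' t' l'.1 r'.1) (hq : q.1 ∈ strip b' t' l'.1 r'.1)
    (hpR : p.1 ∈ strip bot top bot.1.1 bot.2.1) (hqR : q.1 ∈ strip bot top bot.1.1 bot.2.1) :
    (incGraphDiff X).Reachable (.inr (.inr p)) (.inr (.inr q)) := by
  have hSc := coarse_segSystem (X := X) hS hb ht
  have hSS := coarseSegs_subset (X := X) hb ht
  have hVV := coarseVerts_subset (X := X) hS hb ht
  have hcell : ∀ z ∈ strip b' t' l'.1 r'.1, z ∈ strip bot top bot.1.1 bot.2.1 →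
      ∃ T : ↥(cells S V), z ∈ closedStrip T.1.2.1 T.1.1 T.1.2.2.1.1 T.1.2.2.2.1 ∧
        (.inl T : Node S V) ∉ X := by
    intro z hz hzR
    obtain ⟨T, hT, hzT⟩ := hS.exists_closed_cell hb ht h1 h2 hzR
    refine ⟨⟨T, hT⟩, hzT, fun hX => ?_⟩
    refine (mem_cells.1 hT).strip_of_coarse hSc hSS hVV hc hzT hz ?_ ?_ ?_ ?_ p.2 hp
    · exact Node.segs_subset_coarse hX (mem_insert_self _ _)
    · exact Node.segs_subset_coarse hX (mem_insert_of_mem (mem_singleton_self _))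
    · exact Node.verts_subset_coarse hX (mem_insert_self _ _)
    · exact Node.verts_subset_coarse hX (mem_insert_of_mem (mem_singleton_self _))
  have hpX : ∀ p : ↥V, p.1 ∈ strip b' t' l'.1 r'.1 → (.inr (.inr p) : Node S V) ∉ X :=
    fun p hp hX => hc.noV _ (Node.verts_subset_coarse hX (mem_singleton_self _)) hp
  have hadj : ∀ (p : ↥V) (T : ↥(cells S V)), p.1 ∈ strip b' t' l'.1 r'.1 →
      p.1 ∈ closedStrip T.1.2.1 T.1.1 T.1.2.2.1.1 T.1.2.2.2.1 → (.inl T : Node S V) ∉ X →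
      (incGraphDiff X).Adj (.inl T) (.inr (.inr p)) := fun p T hp hpT hT =>
    ⟨incGraph_adj_of_inc ((mem_cells.1 T.2).eq_of_mem hS p.2 hpT), hT, hpX p hp⟩
  obtain ⟨Tp, hTp, hTpX⟩ := hcell p.1 hp hpR
  obtain ⟨Tq, hTq, hTqX⟩ := hcell q.1 hq hqR
  have adjp := hadj p Tp hp hTp hTpX
  have adjq := hadj q Tq hq hTq hTqX
  suffices hT : (incGraphDiff X).Reachable (.inl Tp) (.inl Tq) from
    (adjp.symm.reachable.trans hT).trans adjq.reachable
  by_contra hno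
  set A : Set (ℝ × ℝ) := ⋃ T ∈ {T : ↥(cells S V) | (incGraphDiff X).Reachable (.inl Tp) (.inl T) ∧
    (.inl T : Node S V) ∉ X}, closedStrip T.1.2.1 T.1.1 T.1.2.2.1.1 T.1.2.2.2.1 with hA
  set B : Set (ℝ × ℝ) := ⋃ T ∈ {T : ↥(cells S V) | ¬ (incGraphDiff X).Reachable (.inl Tp) (.inl T) ∧
    (.inl T : Node S V) ∉ X}, closedStrip T.1.2.1 T.1.1 T.1.2.2.1.1 T.1.2.2.2.1 with hB
  have hAc : IsClosed A := (Set.toFinite _).isClosed_biUnion fun T _ => isClosed_closedStrip _ _ _ _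
  have hBc : IsClosed B := (Set.toFinite _).isClosed_biUnion fun T _ => isClosed_closedStrip _ _ _ _
  have hseg : ∀ z ∈ segment ℝ p.1 q.1, z ∈ strip b' t' l'.1 r'.1 ∧
      z ∈ strip bot top bot.1.1 bot.2.1 := fun z hz =>
    ⟨(convex_strip _ _ _ _).segment_subset hp hq hz,
      (convex_strip _ _ _ _).segment_subset hpR hqR hz⟩
  obtain ⟨z, hz, hzA, hzB⟩ := isPreconnected_closed_iff.1 (convex_segment p.1 q.1).isPreconnected
    A B hAc hBc (by
      intro z hz
      obtain ⟨T, hzT, hTX⟩ := hcell z (hseg z hz).1 (hseg z hz).2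
      by_cases h : (incGraphDiff X).Reachable (.inl Tp) (.inl T)
      · exact Or.inl (Set.mem_biUnion (x := T) ⟨h, hTX⟩ hzT)
      · exact Or.inr (Set.mem_biUnion (x := T) ⟨h, hTX⟩ hzT))
    ⟨p.1, left_mem_segment _ _ _, Set.mem_biUnion (x := Tp) ⟨SimpleGraph.Reachable.rfl, hTpX⟩ hTp⟩
    ⟨q.1, right_mem_segment _ _ _, Set.mem_biUnion (x := Tq) ⟨hno, hTqX⟩ hTq⟩
  obtain ⟨hzs, -⟩ := hseg z hz
  obtain ⟨T, ⟨hT, hTX⟩, hzT⟩ := Set.mem_iUnion₂.1 hzA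
  obtain ⟨T', ⟨hT', hTX'⟩, hzT'⟩ := Set.mem_iUnion₂.1 hzB
  rcases (mem_cells.1 T.2).exists_common hS (mem_cells.1 T'.2) hzT hzT' with
    ⟨e1, e2, e3, e4⟩ | ⟨s, hs, hsz, hzs', hsT, hsT'⟩ | ⟨v, hv, hvz, hvT, hvT'⟩
  · have : T = T' := Subtype.ext (Prod.ext e1 (Prod.ext e2 (Prod.ext e3 e4)))
    exact hT' (this ▸ hT)
  · have hsX : (.inr (.inl ⟨s, hs⟩) : Node S V) ∉ X := fun hX => by
      refine hc.noS s (Node.segs_subset_coarse hX (mem_singleton_self _)) z.1 hzs.1 hzs.2.1 hsz ?_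
      rw [← hzs']
      exact hzs
    have a1 : (incGraphDiff X).Adj (.inl T) (.inr (.inl ⟨s, hs⟩)) :=
      ⟨incGraph_adj_of_inc hsT, hTX, hsX⟩
    have a2 : (incGraphDiff X).Adj (.inl T') (.inr (.inl ⟨s, hs⟩)) :=
      ⟨incGraph_adj_of_inc hsT', hTX', hsX⟩
    exact hT' ((hT.trans a1.reachable).trans a2.symm.reachable)
  · have hvX : (.inr (.inr ⟨v, hv⟩) : Node S V) ∉ X := fun hX =>
      (mem_cells.1 T.2).not_mem_coarse hS hSc hSS hVV hc hzT hzs hvT hvz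
        (Node.verts_subset_coarse hX (mem_singleton_self _))
    have a1 : (incGraphDiff X).Adj (.inl T) (.inr (.inr ⟨v, hv⟩)) :=
      ⟨incGraph_adj_of_inc hvT, hTX, hvX⟩
    have a2 : (incGraphDiff X).Adj (.inl T') (.inr (.inr ⟨v, hv⟩)) :=
      ⟨incGraph_adj_of_inc hvT', hTX', hvX⟩
    exact hT' ((hT.trans a1.reachable).trans a2.symm.reachable)

end Coarsening

section Colouring

/-- Small classes can be distributed evenly. -/
theorem exists_binning {I C : Type*} [Fintype I] (good : Finset I) (col : I → C) (K : ℕ)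
    (hK : 0 < K) (h : ∀ c, K * (good.filter fun i => col i = c).card ≤ Fintype.card I) :
    ∃ g : C → Fin K, ∀ k, K * (good.filter fun i => g (col i) = k).card ≤ 2 * Fintype.card I := by
  have key : ∀ s : Finset C, ∃ g : C → Fin K, ∀ k,
      K * (good.filter fun i => col i ∈ s ∧ g (col i) = k).card ≤ 2 * Fintype.card I := by
    intro s
    induction s using Finset.induction_on with
    | empty =>
      refine ⟨fun _ => ⟨0, hK⟩, fun k => ?_⟩
      simp
    | insert c s hc ih =>
      obtain ⟨g, hg⟩ := ih
      obtain ⟨k₀, -, hk₀⟩ := (univ : Finset (Fin K)).exists_min_image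
        (fun k => (good.filter fun i => col i ∈ s ∧ g (col i) = k).card) ⟨⟨0, hK⟩, mem_univ _⟩
      have hmin : K * (good.filter fun i => col i ∈ s ∧ g (col i) = k₀).card ≤ Fintype.card I := by
        have h1 : ∑ k : Fin K, (good.filter fun i => col i ∈ s ∧ g (col i) = k).card ≤
          good.card := by
          have h2 : ∀ k, (good.filter fun i => col i ∈ s ∧ g (col i) = k).card =
              ((good.filter fun i => col i ∈ s).filter fun i => g (col i) = k).card := by
            intro k
            rw [filter_filter]
          rw [sum_congr rfl fun k _ => h2 k, ← card_eq_sum_card_fiberwise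
            fun i _ => mem_coe.2 (mem_univ (g (col i)))]
          exact card_filter_le _ _
        have h3 := card_nsmul_le_sum (univ : Finset (Fin K)) _ _ fun k hk => hk₀ k hk
        rw [card_univ, Fintype.card_fin, smul_eq_mul] at h3
        exact h3.trans (h1.trans (card_le_univ _))
      refine ⟨Function.update g c k₀, fun k => ?_⟩
      by_cases hk : k = k₀
      · subst hk
        have hsub : (good.filter fun i => col i ∈ insert c s ∧ Function.update g c k (col i) = k) ⊆
            (good.filter fun i => col i ∈ s ∧ g (col i) = k) ∪
              (good.filter fun i => col i = c) := by
          intro i hi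
          obtain ⟨hi1, hi2, hi3⟩ := mem_filter.1 hi
          by_cases hic : col i = c
          · exact mem_union_right _ (mem_filter.2 ⟨hi1, hic⟩)
          · rw [Function.update_of_ne hic] at hi3
            exact mem_union_left _ (mem_filter.2 ⟨hi1, mem_of_mem_insert_of_ne hi2 hic, hi3⟩)
        calc K * _ ≤ K * ((good.filter fun i => col i ∈ s ∧ g (col i) = k).card +
              (good.filter fun i => col i = c).card) :=
              Nat.mul_le_mul_left _ ((card_le_card hsub).trans (card_union_le _ _))
          _ ≤ Fintype.card I + Fintype.card I := by
              rw [mul_add]; exact Nat.add_le_add hmin (h c)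
          _ = 2 * Fintype.card I := (two_mul _).symm
      · have hsub : (good.filter fun i => col i ∈ insert c s ∧ Function.update g c k₀ (col i) = k) ⊆
            (good.filter fun i => col i ∈ s ∧ g (col i) = k) := by
          intro i hi
          obtain ⟨hi1, hi2, hi3⟩ := mem_filter.1 hi
          by_cases hic : col i = c
          · rw [hic, Function.update_self] at hi3
            exact absurd hi3.symm hk
          · rw [Function.update_of_ne hic] at hi3
            exact mem_filter.2 ⟨hi1, mem_of_mem_insert_of_ne hi2 hic, hi3⟩
        exact (Nat.mul_le_mul_left _ (card_le_card hsub)).trans (hg k)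
  obtain ⟨g, hg⟩ := key (good.image col)
  refine ⟨g, fun k => le_trans (Nat.mul_le_mul_left _ (card_le_card ?_)) (hg k)⟩
  intro i hi
  obtain ⟨h1, h2⟩ := mem_filter.1 hi
  exact mem_filter.2 ⟨h1, mem_image_of_mem _ h1, h2⟩

theorem exists_numbering {α : Type*} (s : Finset α) :
    ∃ e : α → ℕ, Set.InjOn e s ∧ ∀ a ∈ s, e a < s.card := by
  refine ⟨fun a => if h : a ∈ s then (s.equivFin ⟨a, h⟩).val else 0, ?_, ?_⟩
  · intro a ha b hb hab
    have ha' := mem_coe.1 ha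
    have hb' := mem_coe.1 hb
    simp only [dif_pos ha', dif_pos hb'] at hab
    exact congrArg Subtype.val (s.equivFin.injective (Fin.ext hab))
  · intro a ha
    simp only [dif_pos ha]
    exact (s.equivFin ⟨a, ha⟩).2

/-- The colouring of the good elements by their label, all other elements having no colour. -/
def labelColour {I : Type*} {K : ℕ} (good : Finset I) (lab : I → ℕ) (h : ℕ → Fin K) (i : I) :
    Option (Fin K) :=
  if i ∈ good then some (h (lab i)) else none

variable {S : Finset Seg} {V : Finset (ℝ × ℝ)} {bot top : Seg}

theorem exists_labelColour {I : Type} [Fintype I] (G : SimpleGraph I) (hS : SegSystem S V)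
    (hb : bot ∈ S) (ht : top ∈ S) (h1 : top.1.1 ≤ bot.1.1) (h2 : bot.2.1 ≤ top.2.1)
    (P : I → ↥V) (hP : Function.Injective P) (hPR : ∀ i, (P i).1 ∈ strip bot top bot.1.1 bot.2.1)
    (N : I → I → Set (Node S V))
    (hN : ∀ u v, G.Adj u v → ConnIn (incGraph S V) (N u v) ∧
      (.inr (.inr (P u)) : Node S V) ∈ N u v ∧ (.inr (.inr (P v)) : Node S V) ∈ N u v)
    (hNP : ∀ u v w, G.Adj u v → (.inr (.inr (P w)) : Node S V) ∈ N u v → w = u ∨ w = v)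
    (hNN : ∀ u v x y a, G.Adj u v → G.Adj x y → s(u, v) ≠ s(x, y) → a ∈ N u v → a ∈ N x y →
      ∃ w, a = .inr (.inr (P w)))
    {q : ℕ} (hq : 1 ≤ q) (hqq : 3 * (3 * S.card + 2 * V.card) ≤ q * q) (j : ℕ) :
    ∃ (x : ℕ) (good : Finset I) (lab : I → ℕ) (h : ℕ → Fin (2 ^ j)), x ≤ 2 ^ (j + 1) * (5 * q) ∧
      goodᶜ.card ≤ 6 * x + 4 ∧ (∀ i ∈ good, lab i < 10 * x + 8) ∧
      (∀ a ∈ good, ∀ b ∈ good, ∀ c ∈ good, ∀ d ∈ good, lab a = lab b → lab c = lab d →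
        ∀ z ∈ segment ℝ (P a).1 (P b).1, z ∈ segment ℝ (P c).1 (P d).1 → lab a = lab c) ∧
      (∀ k, 2 ^ j * (good.filter fun i => h (lab i) = k).card ≤ 2 * Fintype.card I) ∧
      (crossPairs G (labelColour good lab h) none).card ≤ 2 * x := by
  obtain ⟨X, hXc, hX⟩ := exists_iterated_separator hq
    ((Nat.mul_le_mul_left 3 (card_node_le hS)).trans hqq) (not_hasCliqueMinor_incGraph hS)
    (fun a => (univ.filter fun i => (.inr (.inr (P i)) : Node S V) = a).card) j
  have hSc := coarse_segSystem (X := X) hS hb ht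
  have hSS := coarseSegs_subset (X := X) hb ht
  have hVV := coarseVerts_subset (X := X) hS hb ht
  set good : Finset I := univ.filter fun i => (P i).1 ∉ coarseVerts X bot top with hgood
  have hgX : ∀ i ∈ good, (.inr (.inr (P i)) : Node S V) ∉ X := fun i hi hX =>
    (mem_filter.1 hi).2 (Node.verts_subset_coarse hX (mem_singleton_self _))
  have hcell : ∀ i, ∃ T, i ∈ good → T ∈ cells (coarseSegs X bot top) (coarseVerts X bot top) ∧
      (P i).1 ∈ strip T.2.1 T.1 T.2.2.1.1 T.2.2.2.1 := by
    intro i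
    by_cases hi : i ∈ good
    · have hiV := (mem_filter.1 hi).2
      obtain ⟨r1, r2, r3, r4⟩ := hPR i
      have hbc : bot ∈ coarseSegs X bot top := mem_union_right _ (mem_insert_self _ _)
      have htc : top ∈ coarseSegs X bot top :=
        mem_union_right _ (mem_insert_of_mem (mem_singleton_self _))
      obtain ⟨t, b, l, r, hc, hz⟩ := hSc.exists_cell (z := (P i).1)
        (fun v hv h => hiV (hS.inj _ (hVV hv) _ (P i).2 h ▸ hv))
        (fun s hs hsp h => by
          rcases hS.vert _ (P i).2 s (hSS hs) hsp h with h | h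
          · exact hiV (h ▸ hSc.fst_mem s hs)
          · exact hiV (h ▸ hSc.snd_mem s hs))
        ⟨top, htc, ⟨by linarith, by linarith⟩, r4⟩ ⟨bot, hbc, ⟨by linarith, by linarith⟩, r3⟩
      exact ⟨(t, b, l, r), fun _ => ⟨mem_cells.2 hc, hz⟩⟩
    · obtain ⟨T⟩ : Nonempty (Seg × Seg × (ℝ × ℝ) × (ℝ × ℝ)) := inferInstance
      exact ⟨T, fun h => absurd h hi⟩
  choose T hT using hcell
  obtain ⟨e, heinj, hecard⟩ := exists_numbering
    (cells (coarseSegs X bot top) (coarseVerts X bot top))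
  have hlab : ∀ a ∈ good, ∀ b ∈ good, e (T a) = e (T b) → T a = T b := fun a ha b hb h =>
    heinj (mem_coe.2 (hT a ha).1) (mem_coe.2 (hT b hb).1) h
  set col : I → Finset I := fun i =>
    univ.filter fun k => (incGraphDiff X).Reachable (.inr (.inr (P i))) (.inr (.inr (P k)))
      with hcol
  have hcol_eq : ∀ a b, (incGraphDiff X).Reachable (.inr (.inr (P a))) (.inr (.inr (P b))) →
      col a = col b := by
    intro a b hab
    ext k
    simp only [hcol, mem_filter, mem_univ, true_and]
    exact ⟨fun h => hab.symm.trans h, fun h => hab.trans h⟩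
  have hcol_reach : ∀ a b, col a = col b →
      (incGraphDiff X).Reachable (.inr (.inr (P a))) (.inr (.inr (P b))) := by
    intro a b hab
    have : b ∈ col b := mem_filter.2 ⟨mem_univ _, SimpleGraph.Reachable.rfl⟩
    rw [← hab] at this
    exact (mem_filter.1 this).2
  have hTcol : ∀ a ∈ good, ∀ b ∈ good, T a = T b → col a = col b := by
    intro a ha b hb' hab
    refine hcol_eq a b (reachable_of_mem_strip hS hb ht h1 h2 (mem_cells.1 (hT a ha).1)
      (hT a ha).2 ?_ (hPR a) (hPR b))
    rw [hab]
    exact (hT b hb').2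
  have hclass : ∀ c, 2 ^ j * (good.filter fun i => col i = c).card ≤ Fintype.card I := by
    intro c
    rcases (good.filter fun i => col i = c).eq_empty_or_nonempty with hemp | ⟨i₀, hi₀⟩
    · simp [hemp]
    obtain ⟨hi₀g, rfl⟩ := mem_filter.1 hi₀
    set D : Finset (Node S V) := univ.filter fun a =>
      a ∉ X ∧ (incGraphDiff X).Reachable (.inr (.inr (P i₀))) a with hD
    have hDX : Disjoint D X := disjoint_left.2 fun a ha => (mem_filter.1 ha).2.1
    have hDc : ConnIn (incGraph S V) (D : Set (Node S V)) := by
      intro u hu v hv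
      have hu' := (mem_filter.1 (mem_coe.1 hu)).2
      have hv' := (mem_filter.1 (mem_coe.1 hv)).2
      have huv := (SimpleGraph.reachable_iff_reflTransGen _ _).1 (hu'.2.symm.trans hv'.2)
      clear hv hv'
      induction huv with
      | refl => exact Relation.ReflTransGen.refl
      | tail hab hbc ih =>
        refine ih.tail ⟨hbc.1, mem_coe.2 (mem_filter.2 ⟨mem_univ _, hbc.2.2, ?_⟩)⟩
        exact (hu'.2.trans ((SimpleGraph.reachable_iff_reflTransGen _ _).2 hab)).trans hbc.reachable
    have hw := hX D hDX hDc
    have hsum : ∀ E : Finset (Node S V), ∑ a ∈ E, (univ.filter fun i =>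
        (.inr (.inr (P i)) : Node S V) = a).card =
          (univ.filter fun i => (.inr (.inr (P i)) : Node S V) ∈ E).card := by
      intro E
      rw [card_eq_sum_card_fiberwise (f := fun i => (.inr (.inr (P i)) : Node S V)) (t := E)
        fun i hi => mem_coe.2 (mem_filter.1 (mem_coe.1 hi)).2]
      refine sum_congr rfl fun a ha => congrArg _ ?_
      ext i
      simp only [mem_filter, mem_univ, true_and]
      exact ⟨fun h => ⟨h ▸ ha, h⟩, fun h => h.2⟩
    rw [hsum, hsum] at hw
    refine le_trans (Nat.mul_le_mul_left _ (card_le_card fun i hi => ?_))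
      (hw.trans (card_le_univ _))
    obtain ⟨hig, hic⟩ := mem_filter.1 hi
    exact mem_filter.2 ⟨mem_univ _, mem_filter.2 ⟨mem_univ _, hgX i hig,
      hcol_reach _ _ hic.symm⟩⟩
  obtain ⟨g, hg⟩ := exists_binning good col (2 ^ j) (by positivity)
    fun c => by convert hclass c
  have hh : ∃ h : ℕ → Fin (2 ^ j), ∀ i ∈ good, h (e (T i)) = g (col i) := by
    refine ⟨fun m => if hm : ∃ i ∈ good, e (T i) = m then g (col hm.choose) else ⟨0, by positivity⟩,
      fun i hi => ?_⟩
    have hm : ∃ k ∈ good, e (T k) = e (T i) := ⟨i, hi, rfl⟩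
    beta_reduce
    rw [dif_pos hm]
    obtain ⟨h3, h4⟩ := hm.choose_spec
    rw [hTcol _ h3 _ hi (hlab _ h3 _ hi h4)]
  obtain ⟨h, hh⟩ := hh
  refine ⟨X.card, good, fun i => e (T i), h, hXc, ?_, ?_, ?_, ?_, ?_⟩
  · refine le_trans ?_ (card_coarseVerts_le (X := X) (bot := bot) (top := top))
    refine card_le_card_of_injOn (fun i => (P i).1) (fun i hi => ?_)
      (fun a _ b _ hab => hP (Subtype.ext hab))
    have hi' := mem_compl.1 (mem_coe.1 hi)
    by_contra hi3
    exact hi' (mem_filter.2 ⟨mem_univ _, hi3⟩)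
  · exact fun i hi => (hecard _ (hT i hi).1).trans_le (card_coarse_cells_le hS hb ht)
  · intro a ha b hb' c hc d hd hab hcd z hz hz'
    have e1 := hlab a ha b hb' hab
    have e2 := hlab c hc d hd hcd
    have ha2 := (hT a ha).2
    have hb2 := (hT b hb').2
    have hc2 := (hT c hc).2
    have hd2 := (hT d hd).2
    rw [← e1] at hb2
    rw [← e2] at hd2
    obtain ⟨k1, k2, k3, k4⟩ := (mem_cells.1 (hT a ha).1).unique hSc (mem_cells.1 (hT c hc).1)
      ((convex_strip _ _ _ _).segment_subset ha2 hb2 hz)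
      ((convex_strip _ _ _ _).segment_subset hc2 hd2 hz')
    exact congrArg e (Prod.ext k1 (Prod.ext k2 (Prod.ext k3 k4)))
  · intro k
    have : (good.filter fun i => h (e (T i)) = k) = good.filter fun i => g (col i) = k :=
      filter_congr fun i hi => by rw [hh i hi]
    rw [this]
    exact hg k
  · have hcross : ∀ p ∈ crossPairs G (labelColour good (fun i => e (T i)) h) none,
        ∃ a ∈ X, G.Adj p.1 p.2 ∧ a ∈ N p.1 p.2 ∧ p.1 ∈ good ∧ p.2 ∈ good := by
      rintro ⟨u, v⟩ hp
      obtain ⟨hadj, hu, hv, huv⟩ := mem_crossPairs.1 hp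
      simp only at hadj hu hv huv
      have hug : u ∈ good := by
        by_contra hno
        exact hu (if_neg hno)
      have hvg : v ∈ good := by
        by_contra hno
        exact hv (if_neg hno)
      by_contra! hno
      obtain ⟨hconn, huN, hvN⟩ := hN u v hadj
      have hNX : ∀ a ∈ N u v, a ∉ X := fun a ha haX => hno a haX hadj ha hug hvg
      have hreach : (incGraphDiff X).Reachable (.inr (.inr (P u))) (.inr (.inr (P v))) := by
        have := hconn _ huN _ hvN
        rw [SimpleGraph.reachable_iff_reflTransGen]
        refine (hconn.closed_induction huN (P := fun b => Relation.ReflTransGen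
          (incGraphDiff X).Adj (.inr (.inr (P u))) b) Relation.ReflTransGen.refl ?_) _ hvN
        intro x hx y hy hxy hxr
        exact hxr.tail ⟨hxy, hNX x hx, hNX y hy⟩
      apply huv
      unfold labelColour
      rw [if_pos hug, if_pos hvg, hh u hug, hh v hvg, hcol_eq u v hreach]
    have : Nonempty (Node S V) := ⟨.inr (.inl ⟨bot, hb⟩)⟩
    choose! F hF using hcross
    rw [mul_comm]
    refine card_le_mul_card_image_of_maps_to (f := F) (fun p hp => (hF p hp).1) 2 ?_ |>.trans
      (by rw [mul_comm])
    intro a ha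
    rcases ((crossPairs G (labelColour good (fun i => e (T i)) h) none).filter
      fun p => F p = a).eq_empty_or_nonempty with hemp | ⟨⟨u, v⟩, hp⟩
    · rw [hemp]; simp
    obtain ⟨hp1, rfl⟩ := mem_filter.1 hp
    obtain ⟨hFX, huv, hFN, hug, hvg⟩ := hF _ hp1
    refine le_trans (card_le_card (t := {(u, v), (v, u)}) ?_) card_le_two
    rintro ⟨x, y⟩ hp'
    obtain ⟨hp1', heq⟩ := mem_filter.1 hp'
    obtain ⟨-, hxy, hFN', -, -⟩ := hF _ hp1'
    rw [heq] at hFN'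
    by_cases hs : s(u, v) = s(x, y)
    · rw [Sym2.eq_iff] at hs
      rcases hs with ⟨rfl, rfl⟩ | ⟨rfl, rfl⟩
      · exact mem_insert_self _ _
      · exact mem_insert_of_mem (mem_singleton_self _)
    · obtain ⟨w, hw⟩ := hNN u v x y _ huv hxy hs hFN hFN'
      rw [hw] at hFX hFN
      rcases hNP u v w huv hFN with rfl | rfl
      · exact absurd hFX (hgX _ hug)
      · exact absurd hFX (hgX _ hvg)

end Colouring

section Chains

/-- `a` and `b` are joined in `C` by a chain of `m` segments. -/
def SegChain (C : Set (ℝ × ℝ)) : ℕ → ℝ × ℝ → ℝ × ℝ → Prop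
  | 0, a, b => a = b
  | m + 1, a, b => ∃ c, segment ℝ a c ⊆ C ∧ SegChain C m c b

variable {C : Set (ℝ × ℝ)} {a b c d : ℝ × ℝ}

theorem SegChain.single (h : segment ℝ a b ⊆ C) : SegChain C 1 a b := ⟨b, h, rfl⟩

theorem SegChain.trans {m k : ℕ} : ∀ {a : ℝ × ℝ}, SegChain C m a b → SegChain C k b c →
    SegChain C (m + k) a c := by
  induction m with
  | zero =>
    rintro a rfl h
    rwa [zero_add]
  | succ m ih =>
    rintro a ⟨d, had, hdb⟩ h
    rw [Nat.add_right_comm]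
    exact ⟨d, had, ih hdb h⟩

theorem SegChain.exists_fun {m : ℕ} : ∀ {a : ℝ × ℝ}, SegChain C m a b →
    ∃ p : ℕ → ℝ × ℝ, p 0 = a ∧ p m = b ∧ ∀ i < m, segment ℝ (p i) (p (i + 1)) ⊆ C := by
  induction m with
  | zero =>
    rintro a rfl
    exact ⟨fun _ => a, rfl, rfl, fun i hi => absurd hi (Nat.not_lt_zero i)⟩
  | succ m ih =>
    rintro a ⟨d, had, hdb⟩
    obtain ⟨p, p0, pm, hp⟩ := ih hdb
    refine ⟨fun i => Nat.casesOn i a p, rfl, pm, fun i hi => ?_⟩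
    cases i with
    | zero =>
      change segment ℝ a (p 0) ⊆ C
      rwa [p0]
    | succ i => exact hp i (by omega)

theorem segChain_of_fun {p : ℕ → ℝ × ℝ} {m : ℕ} (hp : ∀ i < m, segment ℝ (p i) (p (i + 1)) ⊆ C)
    (i k : ℕ) (hik : i + k ≤ m) : SegChain C k (p i) (p (i + k)) := by
  induction k with
  | zero => exact rfl
  | succ k ih => exact (ih (by omega)).trans (SegChain.single (hp _ (by omega)))

theorem segChain_polylineOf (l : List (ℝ × ℝ)) (a b : ℝ × ℝ) :
    SegChain (polylineOf (a :: (l ++ [b]))) (l.length + 1) a b := by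
  suffices h : ∀ (l : List (ℝ × ℝ)) (a : ℝ × ℝ) (C : Set (ℝ × ℝ)),
      polylineOf (a :: (l ++ [b])) ⊆ C → SegChain C (l.length + 1) a b from h l a _ subset_rfl
  intro l
  induction l with
  | nil =>
    intro a C h
    rw [List.nil_append, polylineOf_cons_cons] at h
    exact SegChain.single (Set.subset_union_left.trans h)
  | cons x l ih =>
    intro a C h
    rw [List.cons_append, polylineOf_cons_cons] at h
    exact ⟨x, Set.subset_union_left.trans h, ih x C (Set.subset_union_right.trans h)⟩

/-- Two segments with a common end and a further common point overlap. -/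
theorem mem_segment_or_of_common {z : ℝ × ℝ} (h1 : z ∈ segment ℝ a b) (h2 : z ∈ segment ℝ b c)
    (hz : z ≠ b) : a ∈ segment ℝ b c ∨ c ∈ segment ℝ a b := by
  rw [segment_symm] at h1
  rw [segment_symm ℝ a b]
  rw [segment_eq_image'] at h1 h2 ⊢
  rw [segment_eq_image']
  obtain ⟨s, ⟨s0, s1⟩, rfl⟩ := h1
  obtain ⟨t, ⟨t0, t1⟩, ht⟩ := h2
  simp only at ht hz
  have e : t • (c - b) = s • (a - b) := add_left_cancel ht
  have s0' : 0 < s := lt_of_le_of_ne s0 fun h => hz (by rw [← h]; simp)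
  have t0' : 0 < t := lt_of_le_of_ne t0 fun h => hz (by rw [← e, ← h]; simp)
  rcases le_total s t with h | h
  · right
    refine ⟨s / t, ⟨by positivity, (div_le_one t0').2 h⟩, ?_⟩
    change b + (s / t) • (a - b) = c
    have : c - b = (s / t) • (a - b) := by
      rw [div_eq_inv_mul, mul_smul, ← e, smul_smul, inv_mul_cancel₀ t0'.ne', one_smul]
    rw [← this]; abel
  · left
    refine ⟨t / s, ⟨by positivity, (div_le_one s0').2 h⟩, ?_⟩
    change b + (t / s) • (c - b) = a
    have : a - b = (t / s) • (c - b) := by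
      rw [div_eq_inv_mul, mul_smul, e, smul_smul, inv_mul_cancel₀ s0'.ne', one_smul]
    rw [← this]; abel

/-- A shortest chain inside a polyline is simple. -/
theorem exists_simple_chain (l : List (ℝ × ℝ)) (a b : ℝ × ℝ) :
    ∃ (m : ℕ) (p : ℕ → ℝ × ℝ), m ≤ l.length + 1 ∧ p 0 = a ∧ p m = b ∧
      (∀ i < m, segment ℝ (p i) (p (i + 1)) ⊆ polylineOf (a :: (l ++ [b]))) ∧
      (∀ i j, i < j → j ≤ m → p i ≠ p j) ∧
      (∀ i j, i < j → j < m → ∀ z ∈ segment ℝ (p i) (p (i + 1)),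
        z ∈ segment ℝ (p j) (p (j + 1)) → j = i + 1 ∧ z = p j) := by
  set C := polylineOf (a :: (l ++ [b])) with hC
  have hex : ∃ m, SegChain C m a b := ⟨_, segChain_polylineOf l a b⟩
  obtain ⟨p, p0, pm, hp⟩ := (Nat.find_spec hex).exists_fun
  have hmin : ∀ k, SegChain C k a b → Nat.find hex ≤ k := fun k hk => Nat.find_min' hex hk
  have hlen := hmin _ (segChain_polylineOf l a b)
  set m := Nat.find hex with hm
  have left : ∀ i ≤ m, SegChain C i a (p i) := fun i hi => by
    have := segChain_of_fun hp 0 i (by omega)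
    rwa [p0, zero_add] at this
  have right : ∀ i ≤ m, SegChain C (m - i) (p i) b := fun i hi => by
    have := segChain_of_fun hp i (m - i) (by omega)
    rwa [Nat.add_sub_cancel' hi, pm] at this
  refine ⟨m, p, hlen, p0, pm, hp, ?_, ?_⟩
  · intro i j hij hj heq
    have h1 := left i (by omega)
    rw [heq] at h1
    have := hmin _ (h1.trans (right j hj))
    omega
  · intro i j hij hj z hz hz'
    have hj1 : j = i + 1 := by
      have s1 : segment ℝ (p i) z ⊆ C :=
        ((convex_segment _ _).segment_subset (left_mem_segment _ _ _) hz).trans (hp i (by omega))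
      have s2 : segment ℝ z (p (j + 1)) ⊆ C :=
        ((convex_segment _ _).segment_subset hz' (right_mem_segment _ _ _)).trans (hp j hj)
      have := hmin _ (((left i (by omega)).trans (SegChain.single s1)).trans
        ((SegChain.single s2).trans (right (j + 1) hj)))
      omega
    refine ⟨hj1, ?_⟩
    subst hj1
    by_contra hne
    have hs : segment ℝ (p i) (p (i + 1 + 1)) ⊆ C := by
      rcases mem_segment_or_of_common hz hz' hne with h | h
      · exact ((convex_segment _ _).segment_subset h (right_mem_segment _ _ _)).trans (hp _ hj)
      · exact ((convex_segment _ _).segment_subset (left_mem_segment _ _ _) h).trans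
          (hp i (by omega))
    have := hmin _ (((left i (by omega)).trans (SegChain.single hs)).trans (right (i + 1 + 1) hj))
    omega

end Chains

section Frame

/-- The segment with ends `a` and `b`, with its left end first. -/
def orient (a b : ℝ × ℝ) : Seg := if a.1 ≤ b.1 then (a, b) else (b, a)

theorem orient_fst_lt {a b : ℝ × ℝ} (h : a.1 ≠ b.1) : (orient a b).1.1 < (orient a b).2.1 := by
  unfold orient
  split_ifs with hab
  · exact lt_of_le_of_ne hab h
  · exact not_le.1 hab

theorem orient_cases (a b : ℝ × ℝ) : orient a b = (a, b) ∨ orient a b = (b, a) := by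
  unfold orient
  split_ifs
  · exact Or.inl rfl
  · exact Or.inr rfl

theorem mem_segment_iff_orient {a b : ℝ × ℝ} (h : a.1 ≠ b.1) (z : ℝ × ℝ) :
    z ∈ segment ℝ a b ↔ Spans (orient a b) z.1 ∧ z.2 = segHeight (orient a b) z.1 := by
  have key : segment ℝ a b = segment ℝ (orient a b).1 (orient a b).2 := by
    rcases orient_cases a b with h | h <;> rw [h]
    exact segment_symm ℝ a b
  rw [key, mem_segment_iff_lineHeight (orient_fst_lt h), ← and_assoc]
  rfl

theorem shear_segment (t : ℝ) (a b : ℝ × ℝ) :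
    shear t '' segment ℝ a b = segment ℝ (shear t a) (shear t b) :=
  image_segment ℝ (shear t).toAffineMap a b

variable {κ : Type*}

/-- The system of the sheared segments and a frame. -/
theorem exists_framed_segSystem (Q : Finset κ) (A B : κ → ℝ × ℝ) (V : Finset (ℝ × ℝ))
    (hA : ∀ k ∈ Q, A k ∈ V) (hB : ∀ k ∈ Q, B k ∈ V) (hne : ∀ k ∈ Q, A k ≠ B k)
    (hvert : ∀ v ∈ V, ∀ k ∈ Q, v ∈ segment ℝ (A k) (B k) → v = A k ∨ v = B k)
    (hcross : ∀ k ∈ Q, ∀ k' ∈ Q, k ≠ k' → ∀ z ∈ segment ℝ (A k) (B k),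
      z ∈ segment ℝ (A k') (B k') → z ∈ V) :
    ∃ (t : ℝ) (S : Finset Seg) (V' : Finset (ℝ × ℝ)) (bot top : Seg), SegSystem S V' ∧
      bot ∈ S ∧ top ∈ S ∧ top.1.1 ≤ bot.1.1 ∧ bot.2.1 ≤ top.2.1 ∧
      (∀ k ∈ Q, orient (shear t (A k)) (shear t (B k)) ∈ S) ∧
      (∀ v ∈ V, shear t v ∈ V' ∧ shear t v ∈ strip bot top bot.1.1 bot.2.1) ∧
      S.card ≤ Q.card + 2 ∧ V'.card ≤ V.card + 4 := by
  obtain ⟨t, ht⟩ := exists_shear_injOn V.finite_toSet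
  set W := V.image (shear t) with hW
  have hWinj : ∀ u ∈ W, ∀ v ∈ W, u.1 = v.1 → u = v := by
    intro u hu v hv huv
    have : (W : Set (ℝ × ℝ)) = shear t '' V := by rw [hW, coe_image]
    exact ht (this ▸ mem_coe.2 hu) (this ▸ mem_coe.2 hv) huv
  set M : ℝ := ∑ v ∈ W, (|v.1| + |v.2|) + 1 with hM
  have hMW : ∀ v ∈ W, |v.1| + |v.2| < M := fun v hv => by
    have := single_le_sum (f := fun v : ℝ × ℝ => |v.1| + |v.2|)
      (fun v _ => by positivity) hv
    linarith [show |v.1| + |v.2| ≤ ∑ v ∈ W, (|v.1| + |v.2|) from this]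
  have hM0 : 0 < M := by positivity
  set bot : Seg := ((-M, -M), (M, -M)) with hbot
  set top : Seg := ((-M - 1, M), (M + 1, M)) with htop
  have hbh : ∀ x, segHeight bot x = -M := fun x => by simp [segHeight, lineHeight, hbot]
  have hth : ∀ x, segHeight top x = M := fun x => by simp [segHeight, lineHeight, htop]
  have hWR : ∀ v ∈ W, v ∈ strip bot top bot.1.1 bot.2.1 := by
    intro v hv
    have h0 := hMW v hv
    have h1 := abs_lt.1 (show |v.1| < M by linarith [abs_nonneg v.2])
    have h2 := abs_lt.1 (show |v.2| < M by linarith [abs_nonneg v.1])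
    refine ⟨h1.1, h1.2, ?_, ?_⟩
    · rw [hbh]; exact h2.1
    · rw [hth]; exact h2.2
  have hAW : ∀ k ∈ Q, shear t (A k) ∈ W := fun k hk => mem_image_of_mem _ (hA k hk)
  have hBW : ∀ k ∈ Q, shear t (B k) ∈ W := fun k hk => mem_image_of_mem _ (hB k hk)
  have hneW : ∀ k ∈ Q, (shear t (A k)).1 ≠ (shear t (B k)).1 := fun k hk h =>
    hne k hk (shear_injective t (hWinj _ (hAW k hk) _ (hBW k hk) h))
  set σ : κ → Seg := fun k => orient (shear t (A k)) (shear t (B k)) with hσ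
  have hon : ∀ k ∈ Q, ∀ z : ℝ × ℝ, Spans (σ k) z.1 → z.2 = segHeight (σ k) z.1 →
      ∃ y ∈ segment ℝ (A k) (B k), shear t y = z := by
    intro k hk z h1 h2
    have := (mem_segment_iff_orient (hneW k hk) z).2 ⟨h1, h2⟩
    rwa [← shear_segment] at this
  have hin : ∀ k ∈ Q, ∀ x, Spans (σ k) x → -M < segHeight (σ k) x ∧ segHeight (σ k) x < M := by
    intro k hk x hx
    have := (mem_segment_iff_orient (hneW k hk) (x, segHeight (σ k) x)).2 ⟨hx, rfl⟩
    have h3 := (convex_strip _ _ _ _).segment_subset (hWR _ (hAW k hk)) (hWR _ (hBW k hk)) this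
    obtain ⟨-, -, h4, h5⟩ := h3
    rw [hbh] at h4
    rw [hth] at h5
    exact ⟨h4, h5⟩
  have hWy : ∀ v ∈ W, -M < v.2 ∧ v.2 < M := by
    intro v hv
    obtain ⟨-, -, h4, h5⟩ := hWR v hv
    rw [hbh] at h4
    rw [hth] at h5
    exact ⟨h4, h5⟩
  have hWx : ∀ v ∈ W, -M < v.1 ∧ v.1 < M := fun v hv => ⟨(hWR v hv).1, (hWR v hv).2.1⟩
  set S : Finset Seg := Q.image σ ∪ {bot, top} with hSdef
  set V' : Finset (ℝ × ℝ) := W ∪ {bot.1, bot.2, top.1, top.2} with hV'def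
  have memS : ∀ s, s ∈ S ↔ (∃ k ∈ Q, σ k = s) ∨ s = bot ∨ s = top := by
    intro s
    simp only [hSdef, mem_union, mem_image, mem_insert, mem_singleton]
  have memV : ∀ v, v ∈ V' ↔ v ∈ W ∨ v = bot.1 ∨ v = bot.2 ∨ v = top.1 ∨ v = top.2 := by
    intro v
    simp only [hV'def, mem_union, mem_insert, mem_singleton]
  have ends : ∀ k, ((σ k).1 = shear t (A k) ∧ (σ k).2 = shear t (B k)) ∨
      ((σ k).1 = shear t (B k) ∧ (σ k).2 = shear t (A k)) := by
    intro k
    rcases orient_cases (shear t (A k)) (shear t (B k)) with h | h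
    · exact Or.inl ⟨congrArg Prod.fst h, congrArg Prod.snd h⟩
    · exact Or.inr ⟨congrArg Prod.fst h, congrArg Prod.snd h⟩
  have hsys : SegSystem S V' := by
    refine ⟨?_, ?_, ?_, ?_, ?_, ?_⟩
    · intro s hs
      rcases (memS s).1 hs with ⟨k, hk, rfl⟩ | rfl | rfl
      · exact orient_fst_lt (hneW k hk)
      · simp only [hbot]; linarith
      · simp only [htop]; linarith
    · intro s hs
      rw [memV]
      rcases (memS s).1 hs with ⟨k, hk, rfl⟩ | rfl | rfl
      · rcases ends k with ⟨h, -⟩ | ⟨h, -⟩ <;> rw [h]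
        · exact Or.inl (hAW k hk)
        · exact Or.inl (hBW k hk)
      · tauto
      · tauto
    · intro s hs
      rw [memV]
      rcases (memS s).1 hs with ⟨k, hk, rfl⟩ | rfl | rfl
      · rcases ends k with ⟨-, h⟩ | ⟨-, h⟩ <;> rw [h]
        · exact Or.inl (hBW k hk)
        · exact Or.inl (hAW k hk)
      · tauto
      · tauto
    · have cor : ∀ v, v = bot.1 ∨ v = bot.2 ∨ v = top.1 ∨ v = top.2 →
          (v.1 ≤ -M ∨ M ≤ v.1) := by
        rintro v (rfl | rfl | rfl | rfl) <;> simp only [hbot, htop]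
        · exact Or.inl le_rfl
        · exact Or.inr le_rfl
        · exact Or.inl (by linarith)
        · exact Or.inr (by linarith)
      intro u hu v hv huv
      rcases (memV u).1 hu with hu | hu <;> rcases (memV v).1 hv with hv | hv
      · exact hWinj u hu v hv huv
      · exfalso
        have := hWx u hu
        rcases cor v hv with h | h <;> linarith
      · exfalso
        have := hWx v hv
        rcases cor u hu with h | h <;> linarith
      · rcases hu with rfl | rfl | rfl | rfl <;> rcases hv with rfl | rfl | rfl | rfl <;>
          first | rfl | (exfalso; simp only [hbot, htop] at huv; linarith)
    · intro v hv s hs hsp heq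
      rcases (memS s).1 hs with ⟨k, hk, rfl⟩ | rfl | rfl
      · have h1 := hin k hk _ hsp
        rw [← heq] at h1
        rcases (memV v).1 hv with hv | hv
        · obtain ⟨y, hy, rfl⟩ := hon k hk v hsp heq
          obtain ⟨y', hy', hyy⟩ := mem_image.1 hv
          obtain rfl := shear_injective t hyy
          rcases hvert _ hy' k hk hy with h | h <;> rcases ends k with ⟨e1, e2⟩ | ⟨e1, e2⟩ <;>
            rw [e1, e2, h]
          · exact Or.inl rfl
          · exact Or.inr rfl
          · exact Or.inr rfl
          · exact Or.inl rfl
        · exfalso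
          rcases hv with rfl | rfl | rfl | rfl
          · exact lt_irrefl _ h1.1
          · exact lt_irrefl _ h1.1
          · exact lt_irrefl _ h1.2
          · exact lt_irrefl _ h1.2
      · rw [hbh] at heq
        rcases (memV v).1 hv with hv | rfl | rfl | rfl | rfl
        · have := hWy v hv; exfalso; linarith
        · exact Or.inl rfl
        · exact Or.inr rfl
        · simp only [htop] at heq; exfalso; linarith
        · simp only [htop] at heq; exfalso; linarith
      · rw [hth] at heq
        rcases (memV v).1 hv with hv | rfl | rfl | rfl | rfl
        · have := hWy v hv; exfalso; linarith
        · simp only [hbot] at heq; exfalso; linarith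
        · simp only [hbot] at heq; exfalso; linarith
        · exact Or.inl rfl
        · exact Or.inr rfl
    · intro s hs s' hs' hss x hx hx' heq
      rcases (memS s).1 hs with ⟨k, hk, rfl⟩ | rfl | rfl <;>
        rcases (memS s').1 hs' with ⟨k', hk', rfl⟩ | rfl | rfl
      · obtain ⟨y, hy, hyz⟩ := hon k hk (x, segHeight (σ k) x) hx rfl
        obtain ⟨y', hy', hyz'⟩ := hon k' hk' (x, segHeight (σ k) x) hx' heq
        obtain rfl : y = y' := shear_injective t (hyz.trans hyz'.symm)
        rw [memV, ← hyz]
        exact Or.inl (mem_image_of_mem _ (hcross k hk k' hk' (fun h => hss (h ▸ rfl)) y hy hy'))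
      · have := hin k hk x hx; rw [hbh] at heq; exfalso; linarith
      · have := hin k hk x hx; rw [hth] at heq; exfalso; linarith
      · have := hin k' hk' x hx'; rw [hbh] at heq; exfalso; linarith
      · exact absurd rfl hss
      · rw [hbh, hth] at heq; exfalso; linarith
      · have := hin k' hk' x hx'; rw [hth] at heq; exfalso; linarith
      · rw [hbh, hth] at heq; exfalso; linarith
      · exact absurd rfl hss
  refine ⟨t, S, V', bot, top, hsys, ?_, ?_, ?_, ?_, ?_, ?_, ?_, ?_⟩
  · exact (memS _).2 (Or.inr (Or.inl rfl))
  · exact (memS _).2 (Or.inr (Or.inr rfl))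
  · simp only [hbot, htop]; linarith
  · simp only [hbot, htop]; linarith
  · exact fun k hk => (memS _).2 (Or.inl ⟨k, hk, rfl⟩)
  · exact fun v hv => ⟨(memV _).2 (Or.inl (mem_image_of_mem _ hv)), hWR _ (mem_image_of_mem _ hv)⟩
  · exact (card_union_le _ _).trans (Nat.add_le_add card_image_le card_le_two)
  · exact (card_union_le _ _).trans (Nat.add_le_add card_image_le card_le_four)

end Frame

section Drawing

variable {n : ℕ} {G : SimpleGraph (Fin n)} {π : Fin n → ℝ × ℝ}
  {bends : Fin n → Fin n → List (ℝ × ℝ)}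

theorem IsPolylineDrawing.eq_of_mem (hd : IsPolylineDrawing G π bends) {u v x y : Fin n}
    (h1 : G.Adj u v) (h2 : G.Adj x y) (hne : s(u, v) ≠ s(x, y)) {z : ℝ × ℝ}
    (hz : z ∈ edgeCurve π bends u v) (hz' : z ∈ edgeCurve π bends x y) :
    ∃ w, z = π w ∧ (w = u ∨ w = v) ∧ (w = x ∨ w = y) := by
  have : z ∈ π '' (({u, v} : Set (Fin n)) ∩ ({x, y} : Set (Fin n))) := by
    rw [← hd.inter u v x y h1 h2 hne]
    exact ⟨hz, hz'⟩
  obtain ⟨w, ⟨hw, hw'⟩, rfl⟩ := this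
  exact ⟨w, rfl, hw, hw'⟩

theorem IsPolylineDrawing.not_hasCliqueMinor (hd : IsPolylineDrawing G π bends) :
    ¬ HasCliqueMinor G 5 := by
  refine not_hasCliqueMinor_five G π bends fun u v x y h1 h2 hux huy hvx hvy => ?_
  rw [Set.disjoint_left]
  intro z hz hz'
  have hne : s(u, v) ≠ s(x, y) := by
    rw [Ne, Sym2.eq_iff]
    tauto
  obtain ⟨w, -, rfl | rfl, rfl | rfl⟩ := hd.eq_of_mem h1 h2 hne hz hz'
  · exact hux rfl
  · exact huy rfl
  · exact hvx rfl
  · exact hvy rfl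

/-- The edges of `G`, as increasing pairs. -/
def edgePairs (G : SimpleGraph (Fin n)) : Finset (Fin n × Fin n) :=
  univ.filter fun e => G.Adj e.1 e.2 ∧ e.1 < e.2

theorem mem_edgePairs {e : Fin n × Fin n} : e ∈ edgePairs G ↔ G.Adj e.1 e.2 ∧ e.1 < e.2 := by
  simp [edgePairs]

theorem IsPolylineDrawing.card_edgePairs_le (hd : IsPolylineDrawing G π bends) :
    (edgePairs G).card ≤ 22 * n := by
  have h := dartCount_le_of_not_hasCliqueMinor (V := univ) (fun a _ _ => mem_univ a)
    hd.not_hasCliqueMinor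
  rw [card_univ, Fintype.card_fin] at h
  refine le_trans (card_le_card fun e he => ?_) h
  have := (mem_edgePairs.1 he).1
  simpa using this

theorem IsPolylineDrawing.sum_length (hd : IsPolylineDrawing G π bends) :
    ∑ e ∈ edgePairs G, ((bends e.1 e.2).length : ℝ) = totalBends G bends := by
  have hg : ∑ e ∈ edgePairs G, ((bends e.1 e.2).length : ℝ) =
      ∑ u, ∑ v, if G.Adj u v ∧ u < v then ((bends u v).length : ℝ) else 0 := by
    rw [edgePairs, sum_filter, ← univ_product_univ, sum_product]
  rw [totalBends, hg, eq_div_iff two_ne_zero, mul_two]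
  nth_rewrite 2 [sum_comm]
  rw [← sum_add_distrib]
  refine sum_congr rfl fun u _ => ?_
  rw [← sum_add_distrib]
  refine sum_congr rfl fun v _ => ?_
  rw [hd.symm u v, List.length_reverse]
  by_cases h : G.Adj u v
  · rcases lt_trichotomy u v with huv | huv | huv
    · simp [h, huv, huv.not_gt]
    · exact absurd huv h.ne
    · simp [h, h.symm, huv, huv.not_gt]
  · have : ¬ G.Adj v u := fun h' => h h'.symm
    simp [h, this]

/-- An alternating walk is connected. -/
theorem connIn_zigzag {W : Type*} {G : SimpleGraph W} (x y : ℕ → W) (m : ℕ)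
    (h1 : ∀ k < m, G.Adj (x k) (y k)) (h2 : ∀ k < m, G.Adj (y k) (x (k + 1))) :
    ConnIn G {a | (∃ j ≤ m, a = x j) ∨ ∃ k < m, a = y k} := by
  induction m with
  | zero =>
    have : {a | (∃ j ≤ 0, a = x j) ∨ ∃ k < 0, a = y k} = {x 0} := by
      ext a
      simp
    rw [this]
    exact connIn_singleton G _
  | succ m ih =>
    have ih' := ih (fun k hk => h1 k (by omega)) (fun k hk => h2 k (by omega))
    have e1 := ih'.adjoin (Or.inl ⟨m, le_rfl, rfl⟩) (h1 m (by omega))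
    have e2 := e1.adjoin (Set.mem_insert _ _) (h2 m (by omega))
    convert e2 using 1
    ext a
    constructor
    · rintro (⟨j, hj, rfl⟩ | ⟨k, hk, rfl⟩)
      · rcases Nat.lt_or_ge m j with h | h
        · obtain rfl : j = m + 1 := by omega
          exact Or.inl rfl
        · exact Or.inr (Or.inr (Or.inl ⟨j, h, rfl⟩))
      · rcases Nat.lt_or_ge k m with h | h
        · exact Or.inr (Or.inr (Or.inr ⟨k, h, rfl⟩))
        · obtain rfl : k = m := by omega
          exact Or.inr (Or.inl rfl)
    · rintro (rfl | rfl | ⟨j, hj, rfl⟩ | ⟨k, hk, rfl⟩)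
      · exact Or.inl ⟨m + 1, le_rfl, rfl⟩
      · exact Or.inr ⟨m, by omega, rfl⟩
      · exact Or.inl ⟨j, by omega, rfl⟩
      · exact Or.inr ⟨k, by omega, rfl⟩

/-- In a simple chain, a vertex of the chain lies on a segment of it only as an end. -/
theorem eq_of_mem_simple_chain {p : ℕ → ℝ × ℝ} {m : ℕ}
    (hp : ∀ i j, i < j → j ≤ m → p i ≠ p j)
    (hs : ∀ i j, i < j → j < m → ∀ z ∈ segment ℝ (p i) (p (i + 1)),
      z ∈ segment ℝ (p j) (p (j + 1)) → j = i + 1 ∧ z = p j) {j k : ℕ} (hj : j ≤ m) (hk : k < m)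
    (hmem : p j ∈ segment ℝ (p k) (p (k + 1))) : j = k ∨ j = k + 1 := by
  rcases lt_trichotomy j k with h | h | h
  · obtain ⟨-, h2⟩ := hs j k h hk _ (left_mem_segment _ _ _) hmem
    exact absurd h2 (hp j k h hk.le)
  · exact Or.inl h
  · rcases Nat.lt_or_ge j m with hjm | hjm
    · exact Or.inr (hs k j h hjm _ hmem (left_mem_segment _ _ _)).1
    · obtain rfl : j = m := by omega
      by_contra hcon
      obtain ⟨i, rfl⟩ : ∃ i, j = i + 1 := ⟨j - 1, by omega⟩
      obtain ⟨-, h2⟩ := hs k i (by omega) (by omega) _ hmem (right_mem_segment _ _ _)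
      exact hp i (i + 1) (by omega) le_rfl h2.symm

/-- The ends of a pair, in increasing order. -/
def sortPair (u v : Fin n) : Fin n × Fin n := if u < v then (u, v) else (v, u)

theorem sortPair_cases (u v : Fin n) : sortPair u v = (u, v) ∨ sortPair u v = (v, u) := by
  unfold sortPair
  split_ifs
  · exact Or.inl rfl
  · exact Or.inr rfl

theorem sortPair_mem {u v : Fin n} (h : G.Adj u v) : sortPair u v ∈ edgePairs G := by
  unfold sortPair
  rw [mem_edgePairs]
  split_ifs with huv
  · exact ⟨h, huv⟩
  · exact ⟨h.symm, lt_of_le_of_ne (not_lt.1 huv) h.ne'⟩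

theorem sortPair_inj {u v x y : Fin n} (h : sortPair u v = sortPair x y) : s(u, v) = s(x, y) := by
  rw [Sym2.eq_iff]
  rcases sortPair_cases u v with e | e <;> rcases sortPair_cases x y with e' | e' <;>
    rw [e, e', Prod.mk.injEq] at h <;> tauto

/-- A drawing with few bends yields a colouring of almost all vertices by few balanced classes,
with few edges between different classes, that comes from a noncrossing labelling. -/
theorem IsPolylineDrawing.exists_labelColour (hd : IsPolylineDrawing G π bends)
    (hπ : Function.Injective π) {q : ℕ} (hq : 1 ≤ q)
    (hqq : 3 * (5 * (totalBends G bends + 22 * n) + 2 * n + 14) ≤ (q : ℝ) * q) (j : ℕ) :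
    ∃ (x : ℕ) (good : Finset (Fin n)) (lab : Fin n → ℕ) (h : ℕ → Fin (2 ^ j)),
      x ≤ 2 ^ (j + 1) * (5 * q) ∧ goodᶜ.card ≤ 6 * x + 4 ∧ (∀ i ∈ good, lab i < 10 * x + 8) ∧
      (∀ a ∈ good, ∀ b ∈ good, ∀ c ∈ good, ∀ d ∈ good, lab a = lab b → lab c = lab d →
        ∀ z ∈ segment ℝ (π a) (π b), z ∈ segment ℝ (π c) (π d) → lab a = lab c) ∧
      (∀ k, 2 ^ j * (good.filter fun i => h (lab i) = k).card ≤ 2 * n) ∧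
      (crossPairs G (labelColour good lab h) none).card ≤ 2 * x := by
  choose m p hm p0 pm hsub hne hs using fun e : Fin n × Fin n =>
    exists_simple_chain (bends e.1 e.2) (π e.1) (π e.2)
  have hsub' : ∀ e, ∀ i < m e, segment ℝ (p e i) (p e (i + 1)) ⊆ edgeCurve π bends e.1 e.2 := hsub
  have mpos : ∀ e ∈ edgePairs G, 0 < m e := by
    intro e he
    rcases Nat.eq_zero_or_pos (m e) with h | h
    · have h1 := pm e
      rw [h, p0] at h1
      exact absurd (hπ h1) (mem_edgePairs.1 he).1.ne
    · exact h
  have hpC : ∀ e ∈ edgePairs G, ∀ i ≤ m e, p e i ∈ edgeCurve π bends e.1 e.2 := by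
    intro e he i hi
    rcases Nat.lt_or_ge i (m e) with h | h
    · exact hsub' e i h (left_mem_segment _ _ _)
    · have := mpos e he
      obtain ⟨k, rfl⟩ : ∃ k, i = k + 1 := ⟨i - 1, by omega⟩
      exact hsub' e k (by omega) (right_mem_segment _ _ _)
  have hshare : ∀ e ∈ edgePairs G, ∀ e' ∈ edgePairs G, e ≠ e' → ∀ z,
      z ∈ edgeCurve π bends e.1 e.2 → z ∈ edgeCurve π bends e'.1 e'.2 →
      ∃ w, z = π w ∧ (w = e.1 ∨ w = e.2) ∧ (w = e'.1 ∨ w = e'.2) := by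
    intro e he e' he' hee z hz hz'
    obtain ⟨h1, h1'⟩ := mem_edgePairs.1 he
    obtain ⟨h2, h2'⟩ := mem_edgePairs.1 he'
    refine hd.eq_of_mem h1 h2 ?_ hz hz'
    rw [Ne, Sym2.eq_iff]
    rintro (⟨h3, h4⟩ | ⟨h3, h4⟩)
    · exact hee (Prod.ext h3 h4)
    · rw [h3, h4] at h1'
      exact lt_asymm h1' h2'
  have hend : ∀ e ∈ edgePairs G, ∀ w, π w ∈ edgeCurve π bends e.1 e.2 → w = e.1 ∨ w = e.2 := by
    intro e he w hw
    by_contra hcon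
    rw [not_or] at hcon
    exact hd.noVertex e.1 e.2 w (mem_edgePairs.1 he).1 hcon.1 hcon.2 hw
  have hchain : ∀ e ∈ edgePairs G, ∀ k < m e, ∀ i ≤ m e,
      p e i ∈ segment ℝ (p e k) (p e (k + 1)) → p e i = p e k ∨ p e i = p e (k + 1) := by
    intro e he k hk i hi hmem
    rcases eq_of_mem_simple_chain (hne e) (hs e) hi hk hmem with h | h <;> rw [h]
    · exact Or.inl rfl
    · exact Or.inr rfl
  have hpi : ∀ e ∈ edgePairs G, ∀ k < m e, ∀ w,
      π w ∈ segment ℝ (p e k) (p e (k + 1)) → π w = p e k ∨ π w = p e (k + 1) := by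
    intro e he k hk w hw
    rcases hend e he w (hsub' e k hk hw) with rfl | rfl
    · rw [← p0 e] at hw ⊢
      exact hchain e he k hk 0 (Nat.zero_le _) hw
    · rw [← pm e] at hw ⊢
      exact hchain e he k hk (m e) le_rfl hw
  set Q : Finset (Σ _ : Fin n × Fin n, ℕ) := (edgePairs G).sigma fun e => range (m e) with hQ
  have memQ : ∀ k : Σ _ : Fin n × Fin n, ℕ, k ∈ Q ↔ k.1 ∈ edgePairs G ∧ k.2 < m k.1 := by
    intro k
    simp [hQ]
  set V : Finset (ℝ × ℝ) := univ.image π ∪ Q.image fun k => p k.1 k.2 with hV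
  have memV : ∀ v, v ∈ V ↔ (∃ w, v = π w) ∨ ∃ e ∈ edgePairs G, ∃ i < m e, v = p e i := by
    intro v
    rw [hV, mem_union, mem_image, mem_image]
    refine or_congr ⟨fun ⟨w, _, h⟩ => ⟨w, h.symm⟩, fun ⟨w, h⟩ => ⟨w, mem_univ _, h.symm⟩⟩
      ⟨fun ⟨k, hk, h⟩ => ⟨k.1, ((memQ k).1 hk).1, k.2, ((memQ k).1 hk).2, h.symm⟩,
        fun ⟨e, he, i, hi, h⟩ => ⟨⟨e, i⟩, (memQ _).2 ⟨he, hi⟩, h.symm⟩⟩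
  have hpV : ∀ e ∈ edgePairs G, ∀ i ≤ m e, p e i ∈ V := by
    intro e he i hi
    rw [memV]
    rcases Nat.lt_or_ge i (m e) with h | h
    · exact Or.inr ⟨e, he, i, h, rfl⟩
    · obtain rfl : i = m e := by omega
      exact Or.inl ⟨e.2, pm e⟩
  obtain ⟨t, S, V', bot, top, hsys, hbot, htop, h1, h2, hseg, hvtx, hScard, hVcard⟩ :=
    exists_framed_segSystem Q (fun k => p k.1 k.2) (fun k => p k.1 (k.2 + 1)) V
      (fun k hk => hpV _ ((memQ k).1 hk).1 _ ((memQ k).1 hk).2.le)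
      (fun k hk => hpV _ ((memQ k).1 hk).1 _ ((memQ k).1 hk).2)
      (fun k hk => hne _ _ _ (Nat.lt_succ_self _) ((memQ k).1 hk).2)
      (by
        intro v hv k hk hvk
        obtain ⟨he, hi⟩ := (memQ k).1 hk
        rcases (memV v).1 hv with ⟨w, rfl⟩ | ⟨e', he', i, hi', rfl⟩
        · exact hpi _ he _ hi w hvk
        · by_cases hee : e' = k.1
          · subst hee
            exact hchain _ he _ hi i hi'.le hvk
          · obtain ⟨w, hw, -, -⟩ := hshare e' he' k.1 he hee _ (hpC _ he' i hi'.le)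
              (hsub' _ _ hi hvk)
            rw [hw] at hvk ⊢
            exact hpi _ he _ hi w hvk)
      (by
        rintro ⟨e, i⟩ hk ⟨e', i'⟩ hk' hkk z hz hz'
        obtain ⟨he, hi⟩ := (memQ _).1 hk
        obtain ⟨he', hi'⟩ := (memQ _).1 hk'
        by_cases hee : e = e'
        · subst hee
          have hii : i ≠ i' := fun h => hkk (by rw [h])
          rcases lt_or_gt_of_ne hii with h | h
          · obtain ⟨-, rfl⟩ := hs e i i' h hi' z hz hz'
            exact hpV e he _ hi'.le
          · obtain ⟨-, rfl⟩ := hs e i' i h hi z hz' hz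
            exact hpV e he _ hi.le
        · obtain ⟨w, rfl, -, -⟩ := hshare e he e' he' hee z (hsub' _ _ hi hz) (hsub' _ _ hi' hz')
          exact (memV _).2 (Or.inl ⟨w, rfl⟩))
  have hπV : ∀ w, π w ∈ V := fun w => (memV _).2 (Or.inl ⟨w, rfl⟩)
  obtain ⟨vn, hvn⟩ : ∃ vn : ℝ × ℝ → Node S V', ∀ v (h : v ∈ V'), vn v = .inr (.inr ⟨v, h⟩) :=
    ⟨fun v => if h : v ∈ V' then .inr (.inr ⟨v, h⟩) else .inr (.inl ⟨bot, hbot⟩),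
      fun v h => dif_pos h⟩
  obtain ⟨sn, hsn⟩ : ∃ sn : Seg → Node S V', ∀ s (h : s ∈ S), sn s = .inr (.inl ⟨s, h⟩) :=
    ⟨fun s => if h : s ∈ S then .inr (.inl ⟨s, h⟩) else .inr (.inl ⟨bot, hbot⟩),
      fun s h => dif_pos h⟩
  have hpV' : ∀ e ∈ edgePairs G, ∀ i ≤ m e, shear t (p e i) ∈ V' :=
    fun e he i hi => (hvtx _ (hpV e he i hi)).1
  set σ : Fin n × Fin n → ℕ → Seg :=
    fun e k => orient (shear t (p e k)) (shear t (p e (k + 1))) with hσ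
  have hσS : ∀ e ∈ edgePairs G, ∀ k < m e, σ e k ∈ S :=
    fun e he k hk => hseg ⟨e, k⟩ ((memQ _).2 ⟨he, hk⟩)
  set P : Fin n → ↥V' := fun i => ⟨shear t (π i), (hvtx _ (hπV i)).1⟩ with hP
  have hPvn : ∀ i, vn (shear t (π i)) = .inr (.inr (P i)) := fun i => hvn _ _
  set N : Fin n → Fin n → Set (Node S V') := fun u v =>
    {a | (∃ i ≤ m (sortPair u v), a = vn (shear t (p (sortPair u v) i))) ∨
      ∃ k < m (sortPair u v), a = sn (σ (sortPair u v) k)} with hN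
  have hends : ∀ u v, Sum.inr (Sum.inr (P u)) ∈ N u v ∧ Sum.inr (Sum.inr (P v)) ∈ N u v := by
    intro u v
    have a1 : Sum.inr (Sum.inr (P (sortPair u v).1)) ∈ N u v :=
      Or.inl ⟨0, Nat.zero_le _, by rw [p0, hPvn]⟩
    have a2 : Sum.inr (Sum.inr (P (sortPair u v).2)) ∈ N u v :=
      Or.inl ⟨_, le_rfl, by rw [pm, hPvn]⟩
    rcases sortPair_cases u v with h | h <;> rw [h] at a1 a2
    · exact ⟨a1, a2⟩
    · exact ⟨a2, a1⟩
  have hcurve : ∀ u v, G.Adj u v → ∀ w, π w ∈ edgeCurve π bends (sortPair u v).1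
      (sortPair u v).2 → w = u ∨ w = v := by
    intro u v huv w hw
    have := hend _ (sortPair_mem huv) w hw
    rcases sortPair_cases u v with h | h <;> rw [h] at this
    · exact this
    · exact this.symm
  have hcardQ : (Q.card : ℝ) ≤ totalBends G bends + 22 * n := by
    rw [hQ, card_sigma, ← hd.sum_length]
    push_cast
    have h22 : ((edgePairs G).card : ℝ) ≤ 22 * n := by exact_mod_cast hd.card_edgePairs_le
    calc ∑ e ∈ edgePairs G, ((range (m e)).card : ℝ)
        ≤ ∑ e ∈ edgePairs G, (((bends e.1 e.2).length : ℝ) + 1) :=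
          sum_le_sum fun e _ => by rw [card_range]; exact_mod_cast hm e
      _ = ∑ e ∈ edgePairs G, ((bends e.1 e.2).length : ℝ) + (edgePairs G).card := by
          rw [sum_add_distrib, sum_const, nsmul_eq_mul, mul_one]
      _ ≤ _ := by linarith
  have hVn : V.card ≤ n + Q.card := by
    refine (card_union_le _ _).trans (Nat.add_le_add ?_ card_image_le)
    exact card_image_le.trans (by rw [card_univ, Fintype.card_fin])
  have hqn : 3 * (3 * S.card + 2 * V'.card) ≤ q * q := by
    have e1 : 3 * (3 * S.card + 2 * V'.card) ≤ 3 * (5 * Q.card + 2 * n + 14) := by omega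
    have e2 : ((3 * (5 * Q.card + 2 * n + 14) : ℕ) : ℝ) ≤ ((q * q : ℕ) : ℝ) := by
      push_cast
      linarith
    exact e1.trans (by exact_mod_cast e2)
  obtain ⟨x, good, lab, h, hx, hgood, hlab, hcross, hbal, hpairs⟩ :=
    _root_.exists_labelColour G hsys hbot htop h1 h2 P
      (fun a b hab => hπ (shear_injective t (congrArg Subtype.val hab)))
      (fun i => (hvtx _ (hπV i)).2) N
      (by
        intro u v huv
        have he := sortPair_mem huv
        refine ⟨connIn_zigzag _ _ _ ?_ ?_, hends u v⟩
        · intro k hk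
          rw [hvn _ (hpV' _ he k hk.le), hsn _ (hσS _ he k hk)]
          refine (incGraph_adj_of_inc ?_).symm
          change shear t _ = (σ _ k).1 ∨ shear t _ = (σ _ k).2
          rcases orient_cases (shear t (p (sortPair u v) k)) (shear t (p (sortPair u v) (k + 1)))
            with h | h <;> rw [hσ] <;> beta_reduce <;> rw [h]
          · exact Or.inl rfl
          · exact Or.inr rfl
        · intro k hk
          rw [hvn _ (hpV' _ he (k + 1) hk), hsn _ (hσS _ he k hk)]
          refine incGraph_adj_of_inc ?_
          change shear t _ = (σ _ k).1 ∨ shear t _ = (σ _ k).2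
          rcases orient_cases (shear t (p (sortPair u v) k)) (shear t (p (sortPair u v) (k + 1)))
            with h | h <;> rw [hσ] <;> beta_reduce <;> rw [h]
          · exact Or.inr rfl
          · exact Or.inl rfl)
      (by
        rintro u v w huv (⟨i, hi, h⟩ | ⟨k, hk, h⟩)
        · have he := sortPair_mem huv
          rw [hvn _ (hpV' _ he i hi)] at h
          have h' : shear t (π w) = shear t (p (sortPair u v) i) :=
            congrArg Subtype.val (Sum.inr_injective (Sum.inr_injective h))
          refine hcurve u v huv w ?_
          rw [shear_injective t h']
          exact hpC _ he i hi
        · rw [hsn _ (hσS _ (sortPair_mem huv) k hk)] at h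
          exact absurd (Sum.inr_injective h) (by simp))
      (by
        intro u v x y a huv hxy hne' ha ha'
        have he := sortPair_mem huv
        have he' := sortPair_mem hxy
        have hee : sortPair u v ≠ sortPair x y := fun h => hne' (sortPair_inj h)
        rcases ha with ⟨i, hi, rfl⟩ | ⟨k, hk, rfl⟩
        · rcases ha' with ⟨i', hi', h⟩ | ⟨k', hk', h⟩
          · rw [hvn _ (hpV' _ he i hi), hvn _ (hpV' _ he' i' hi')] at h
            have h' : shear t (p (sortPair u v) i) = shear t (p (sortPair x y) i') :=
              congrArg Subtype.val (Sum.inr_injective (Sum.inr_injective h))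
            have h3 := shear_injective t h'
            obtain ⟨w, hw, -, -⟩ := hshare _ he _ he' hee _ (hpC _ he i hi)
              (h3 ▸ hpC _ he' i' hi')
            exact ⟨w, by rw [hw, hPvn]⟩
          · rw [hvn _ (hpV' _ he i hi), hsn _ (hσS _ he' k' hk')] at h
            exact absurd (Sum.inr_injective h) (by simp)
        · rcases ha' with ⟨i', hi', h⟩ | ⟨k', hk', h⟩
          · rw [hvn _ (hpV' _ he' i' hi'), hsn _ (hσS _ he k hk)] at h
            exact absurd (Sum.inr_injective h) (by simp)
          · exfalso
            rw [hsn _ (hσS _ he k hk), hsn _ (hσS _ he' k' hk')] at h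
            have h' : σ (sortPair u v) k = σ (sortPair x y) k' :=
              congrArg Subtype.val (Sum.inl_injective (Sum.inr_injective h))
            have hmem : ∀ z, z = p (sortPair u v) k ∨ z = p (sortPair u v) (k + 1) →
                z ∈ edgeCurve π bends (sortPair u v).1 (sortPair u v).2 ∧
                z ∈ edgeCurve π bends (sortPair x y).1 (sortPair x y).2 := by
              have hset : ∀ a b : ℝ × ℝ, ∀ z, z = (orient a b).1 ∨ z = (orient a b).2 ↔
                  z = a ∨ z = b := by
                intro a b z
                rcases orient_cases a b with h | h <;> rw [h]
                exact or_comm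
              intro z hz
              constructor
              · rcases hz with rfl | rfl
                · exact hpC _ he _ hk.le
                · exact hpC _ he _ hk
              · have h5 : shear t z = (σ (sortPair u v) k).1 ∨
                    shear t z = (σ (sortPair u v) k).2 := by
                  refine (hset _ _ _).2 ?_
                  rcases hz with rfl | rfl
                  · exact Or.inl rfl
                  · exact Or.inr rfl
                rw [h'] at h5
                rcases (hset _ _ _).1 h5 with h6 | h6 <;> rw [shear_injective t h6]
                · exact hpC _ he' _ hk'.le
                · exact hpC _ he' _ hk'
            obtain ⟨w, hw, hw1, hw2⟩ := hshare _ he _ he' hee _ (hmem _ (Or.inl rfl)).1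
              (hmem _ (Or.inl rfl)).2
            obtain ⟨w', hw', hw1', hw2'⟩ := hshare _ he _ he' hee _ (hmem _ (Or.inr rfl)).1
              (hmem _ (Or.inr rfl)).2
            have hww : w ≠ w' := by
              rintro rfl
              exact hne _ k (k + 1) (Nat.lt_succ_self _) hk (hw.trans hw'.symm)
            have hlt := (mem_edgePairs.1 he).2
            have hlt' := (mem_edgePairs.1 he').2
            apply hee
            rcases hw1 with rfl | rfl <;> rcases hw1' with rfl | rfl <;>
              rcases hw2 with e1 | e1 <;> rcases hw2' with e2 | e2
            all_goals first
              | exact absurd rfl hww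
              | exact absurd (e1.trans e2.symm) hww
              | exact Prod.ext e1 e2
              | exact Prod.ext e2 e1
              | (exfalso; rw [e1, e2] at hlt; exact lt_asymm hlt hlt'))
      hq hqn j
  refine ⟨x, good, lab, h, hx, by convert hgood, hlab, ?_, ?_, hpairs⟩
  · intro a ha b hb c hc d hd' hab hcd z hz hz'
    refine hcross a ha b hb c hc d hd' hab hcd (shear t z) ?_ ?_
    · rw [hP]; beta_reduce
      rw [← shear_segment]
      exact Set.mem_image_of_mem _ hz
    · rw [hP]; beta_reduce
      rw [← shear_segment]
      exact Set.mem_image_of_mem _ hz'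
  · intro k
    have := hbal k
    rwa [Fintype.card_fin] at this

end Drawing

section LabelledPaths

variable {n : ℕ}

/-- The path that visits the vertices in the order given by `σ`. -/
def pathOf (σ : Equiv.Perm (Fin n)) : SimpleGraph (Fin n) where
  Adj u v := (σ v : ℕ) = σ u + 1 ∨ (σ u : ℕ) = σ v + 1
  symm := ⟨fun _ _ h => h.symm⟩
  loopless := ⟨fun _ h => by omega⟩

theorem pathOf_adj {σ : Equiv.Perm (Fin n)} {u v : Fin n} :
    (pathOf σ).Adj u v ↔ (σ v : ℕ) = σ u + 1 ∨ (σ u : ℕ) = σ v + 1 := Iff.rfl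

theorem polylineOf_pair (a b : ℝ × ℝ) : polylineOf [a, b] = segment ℝ a b := by
  rw [polylineOf_cons_cons, polylineOf_singleton, Set.union_empty]

theorem mem_segment_horizontal (a b : ℝ) (z : ℝ × ℝ) :
    z ∈ segment ℝ (a, (0 : ℝ)) (b, 0) ↔ z.2 = 0 ∧ min a b ≤ z.1 ∧ z.1 ≤ max a b := by
  rw [← Prod.image_mk_segment_left, segment_eq_uIcc, Set.mem_image]
  constructor
  · rintro ⟨x, hx, rfl⟩
    exact ⟨rfl, hx.1, hx.2⟩
  · rintro ⟨h0, h1, h2⟩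
    exact ⟨z.1, ⟨h1, h2⟩, Prod.ext rfl h0.symm⟩

theorem isPlanarGraph_pathOf (σ : Equiv.Perm (Fin n)) : IsPlanarGraph (pathOf σ) := by
  set p : Fin n → ℝ × ℝ := fun v => (((σ v : ℕ) : ℝ), 0) with hp
  have hcurve : ∀ u v, edgeCurve p (fun _ _ => []) u v = segment ℝ (p u) (p v) :=
    fun u v => polylineOf_pair _ _
  have hpinj : Function.Injective p := fun u v h =>
    σ.injective (Fin.ext (Nat.cast_injective (R := ℝ) (congrArg Prod.fst h)))
  have hbet : ∀ u v, (pathOf σ).Adj u v → ∀ z : ℝ × ℝ, z ∈ segment ℝ (p u) (p v) →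
      z.2 = 0 ∧ ∃ k : ℕ, ((k = σ u ∧ k + 1 = σ v) ∨ (k = σ v ∧ k + 1 = σ u)) ∧
        (k : ℝ) ≤ z.1 ∧ z.1 ≤ (k : ℝ) + 1 := by
    intro u v huv z hz
    obtain ⟨h0, h1, h2⟩ := (mem_segment_horizontal _ _ z).1 hz
    refine ⟨h0, ?_⟩
    rcases pathOf_adj.1 huv with h | h
    · refine ⟨σ u, Or.inl ⟨rfl, h.symm⟩, ?_⟩
      rw [h] at h1 h2
      push_cast at h1 h2
      rw [min_eq_left (by linarith)] at h1
      rw [max_eq_right (by linarith)] at h2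
      exact ⟨h1, h2⟩
    · refine ⟨σ v, Or.inr ⟨rfl, h.symm⟩, ?_⟩
      rw [h] at h1 h2
      push_cast at h1 h2
      rw [min_eq_right (by linarith)] at h1
      rw [max_eq_left (by linarith)] at h2
      exact ⟨h1, h2⟩
  refine ⟨p, fun _ _ => [], hpinj, fun _ _ => rfl, ?_, ?_, ?_⟩
  · intro u v huv
    refine ⟨AffineMap.lineMap (p u) (p v), ?_, ?_, by simp, by simp, ?_⟩
    · exact (AffineMap.lineMap_continuous).continuousOn
    · exact (AffineMap.lineMap_injective ℝ fun h => huv.ne (hpinj h)).injOn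
    · rw [hcurve, segment_eq_image_lineMap]
  · intro u v x y huv hxy hne
    rw [hcurve, hcurve]
    ext z
    constructor
    · rintro ⟨hz, hz'⟩
      obtain ⟨h0, k, hk, k1, k2⟩ := hbet u v huv z hz
      obtain ⟨-, l, hl, l1, l2⟩ := hbet x y hxy z hz'
      have hkl : k ≠ l := by
        rintro rfl
        apply hne
        rw [Sym2.eq_iff]
        have e : ∀ a b : Fin n, (σ a : ℕ) = σ b → a = b := fun a b h => σ.injective (Fin.ext h)
        rcases hk with ⟨a, b⟩ | ⟨a, b⟩ <;> rcases hl with ⟨c, d⟩ | ⟨c, d⟩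
        · exact Or.inl ⟨e _ _ (a.symm.trans c), e _ _ (b.symm.trans d)⟩
        · exact Or.inr ⟨e _ _ (a.symm.trans c), e _ _ (b.symm.trans d)⟩
        · exact Or.inr ⟨e _ _ (b.symm.trans d), e _ _ (a.symm.trans c)⟩
        · exact Or.inl ⟨e _ _ (b.symm.trans d), e _ _ (a.symm.trans c)⟩
      have key : ∀ i : ℕ, z.1 = i → (i = k ∨ i = k + 1) → (i = l ∨ i = l + 1) →
          z ∈ p '' (({u, v} : Set (Fin n)) ∩ {x, y}) := by
        intro i hzi hik hil
        have e1 : i = σ u ∨ i = σ v := by omega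
        have e2 : i = σ x ∨ i = σ y := by omega
        have hz : ∀ w : Fin n, i = σ w → p w = z := fun w hw =>
          Prod.ext (by rw [hzi, hw]) h0.symm
        have inj : ∀ a b : Fin n, i = σ a → i = σ b → a = b := fun a b h h' =>
          σ.injective (Fin.ext (h.symm.trans h'))
        rcases e1 with e1 | e1
        · refine ⟨u, ⟨Or.inl rfl, ?_⟩, hz u e1⟩
          rcases e2 with e2 | e2
          · exact Or.inl (inj _ _ e1 e2)
          · exact Or.inr (inj _ _ e1 e2)
        · refine ⟨v, ⟨Or.inr rfl, ?_⟩, hz v e1⟩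
          rcases e2 with e2 | e2
          · exact Or.inl (inj _ _ e1 e2)
          · exact Or.inr (inj _ _ e1 e2)
      rcases lt_or_gt_of_ne hkl with h | h
      · have h' : (k : ℝ) + 1 ≤ l := by exact_mod_cast h
        have hl' : l = k + 1 := by
          have : (l : ℝ) ≤ k + 1 := l1.trans k2
          have : l ≤ k + 1 := by exact_mod_cast this
          omega
        exact key l (le_antisymm (k2.trans h') l1) (Or.inr hl') (Or.inl rfl)
      · have h' : (l : ℝ) + 1 ≤ k := by exact_mod_cast h
        have hl' : k = l + 1 := by
          have : (k : ℝ) ≤ l + 1 := k1.trans l2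
          have : k ≤ l + 1 := by exact_mod_cast this
          omega
        exact key k (le_antisymm (l2.trans h') k1) (Or.inl rfl) (Or.inr hl')
    · rintro ⟨w, ⟨hw | hw, hw' | hw'⟩, rfl⟩ <;> rw [← hw, ← hw'] <;>
        simp only [left_mem_segment, right_mem_segment, Set.mem_inter_iff, and_self]
  · intro u v w huv hwu hwv hmem
    rw [hcurve] at hmem
    obtain ⟨-, k, hk, k1, k2⟩ := hbet u v huv _ hmem
    have e1 : k ≤ (σ w : ℕ) := Nat.cast_le.1 (show (k : ℝ) ≤ ((σ w : ℕ) : ℝ) from k1)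
    have e2 : (σ w : ℕ) ≤ k + 1 := by
      have : ((σ w : ℕ) : ℝ) ≤ (k : ℝ) + 1 := k2
      exact_mod_cast this
    have n1 : (σ w : ℕ) ≠ σ u := fun h => hwu (σ.injective (Fin.ext h))
    have n2 : (σ w : ℕ) ≠ σ v := fun h => hwv (σ.injective (Fin.ext h))
    omega

/-- A labelled path with a marked first vertex determines the order. -/
theorem eq_of_pathOf_eq {σ τ : Equiv.Perm (Fin n)} (h : pathOf σ = pathOf τ)
    (h0 : ∀ v, (σ v : ℕ) = 0 ↔ (τ v : ℕ) = 0) : σ = τ := by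
  have key : ∀ k : ℕ, ∀ v, (σ v : ℕ) = k → (τ v : ℕ) = k := by
    intro k
    induction k using Nat.strong_induction_on with
    | _ k ih =>
      intro v hv
      rcases k with _ | k
      · exact (h0 v).1 hv
      · have hk : k < n := by have := (σ v).isLt; omega
        have hu : (σ (σ.symm ⟨k, hk⟩) : ℕ) = k := by rw [Equiv.apply_symm_apply]
        set u := σ.symm ⟨k, hk⟩
        have hadj : (pathOf τ).Adj u v := by
          rw [← h, pathOf_adj]
          omega
        have hτu := ih k (Nat.lt_succ_self k) u hu
        rcases pathOf_adj.1 hadj with h1 | h1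
        · omega
        · exfalso
          have hk' : k - 1 < n := by omega
          have hw : (σ (σ.symm ⟨k - 1, hk'⟩) : ℕ) = k - 1 := by rw [Equiv.apply_symm_apply]
          set w := σ.symm ⟨k - 1, hk'⟩
          have hτw := ih (k - 1) (by omega) w hw
          have : w = v := τ.injective (Fin.ext (by omega))
          rw [this] at hw
          omega
  ext v
  exact (key _ v rfl).symm

theorem factorial_le_mul_card_isPlanarGraph (hn : 0 < n) :
    n.factorial ≤ n * Nat.card {G : SimpleGraph (Fin n) // IsPlanarGraph G} := by
  have hinj : Function.Injective fun σ : Equiv.Perm (Fin n) =>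
      ((σ.symm ⟨0, hn⟩, ⟨pathOf σ, isPlanarGraph_pathOf σ⟩) :
        Fin n × {G : SimpleGraph (Fin n) // IsPlanarGraph G}) := by
    intro σ τ h
    simp only [Prod.mk.injEq, Subtype.mk.injEq] at h
    refine eq_of_pathOf_eq h.2 fun v => ?_
    have e : ∀ ρ : Equiv.Perm (Fin n), (ρ v : ℕ) = 0 ↔ v = ρ.symm ⟨0, hn⟩ := by
      intro ρ
      rw [Equiv.eq_symm_apply, Fin.ext_iff]
    rw [e, e, h.1]
  have := Nat.card_le_card_of_injective _ hinj
  rwa [Nat.card_prod, Nat.card_eq_fintype_card, Fintype.card_perm, Nat.card_eq_fintype_card,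
    Fintype.card_fin] at this

end LabelledPaths

section Colourings

variable {n K : ℕ}

/-- `f` comes from a noncrossing labelling of a set of points by `M` labels. -/
def IsDrawnColouring (π : Fin n → ℝ × ℝ) (M : ℕ) (f : Fin n → Option (Fin K)) : Prop :=
  ∃ (good : Finset (Fin n)) (lab : Fin n → ℕ) (h : ℕ → Fin K), (∀ i ∈ good, lab i < M) ∧
    (∀ a ∈ good, ∀ b ∈ good, ∀ c ∈ good, ∀ d ∈ good, lab a = lab b → lab c = lab d →
      ∀ z ∈ segment ℝ (π a) (π b), z ∈ segment ℝ (π c) (π d) → lab a = lab c) ∧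
    f = labelColour good lab h

/-- `lab` numbers the classes of the equivalence relation `r` on `V`. -/
def IsLabelling (V : Finset (Fin n)) (r : Fin n → Fin n → Prop) (M : ℕ) (lab : Fin n → ℕ) : Prop :=
  (∀ i ∈ V, lab i < M) ∧ ∀ i ∈ V, ∀ j ∈ V, lab i = lab j ↔ r i j

/-- A labelling of the classes of `r`, if there is one. -/
def someLabelling (V : Finset (Fin n)) (r : Fin n → Fin n → Prop) (M : ℕ) : Fin n → ℕ :=
  if h : ∃ lab, IsLabelling V r M lab then h.choose else fun _ => 0

theorem card_filter_univ_eq {α : Type*} (i j : Fintype α) (p : α → Prop) :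
    (@univ α i |>.filter p).card = (@univ α j |>.filter p).card := by
  rw [Subsingleton.elim i j]

theorem exists_card_isNoncrossing_le : ∃ A : ℕ, 1 ≤ A ∧ ∀ (n : ℕ) (pt : Fin n → ℝ × ℝ),
    (Function.Injective fun i => (pt i).1) →
    ∀ V : Finset (Fin n), (univ.filter (IsNoncrossing pt V)).card ≤ A ^ V.card := by
  refine ⟨262148, by norm_num, fun n pt hx V => ?_⟩
  have := card_isNoncrossing_le hx V
  rw [card_filter_univ_eq _ inferInstance] at this
  exact this

theorem exists_card_isDrawnColouring_le : ∃ A : ℕ, ∀ (n K : ℕ) (π : Fin n → ℝ × ℝ),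
    Function.Injective π → 0 < K → ∀ M : ℕ,
    (univ.filter fun f : Fin n → Option (Fin K) => IsDrawnColouring π M f).card ≤
      A ^ n * K ^ M := by
  obtain ⟨A, hA1, hA⟩ := exists_card_isNoncrossing_le
  refine ⟨2 * A, fun n K π hπ hK M => ?_⟩
  obtain ⟨t, ht⟩ := exists_shear_injOn (Set.finite_range π)
  have hx : Function.Injective fun i => (shear t (π i)).1 := fun a b h =>
    hπ (shear_injective t (ht ⟨π a, ⟨a, rfl⟩, rfl⟩ ⟨π b, ⟨b, rfl⟩, rfl⟩ h))
  set pt : Fin n → ℝ × ℝ := fun i => shear t (π i) with hpt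
  set F : (Σ _ : Finset (Fin n), Fin n → Fin n → Prop) × (Fin M → Fin K) →
      Fin n → Option (Fin K) := fun p i =>
    if i ∈ p.1.1 then
      if hi : someLabelling p.1.1 p.1.2 M i < M then some (p.2 ⟨_, hi⟩) else none
    else none with hF
  set T : Finset ((Σ _ : Finset (Fin n), Fin n → Fin n → Prop) × (Fin M → Fin K)) :=
    ((univ : Finset (Finset (Fin n))).sigma fun V => univ.filter (IsNoncrossing pt V)) ×ˢ univ
    with hT
  have hTc : T.card ≤ (2 * A) ^ n * K ^ M := by
    rw [hT, card_product, card_sigma, card_univ, Fintype.card_fun, Fintype.card_fin,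
      Fintype.card_fin]
    refine Nat.mul_le_mul_right _ ?_
    calc ∑ V : Finset (Fin n), (univ.filter (IsNoncrossing pt V)).card
        ≤ ∑ _V : Finset (Fin n), A ^ n := sum_le_sum fun V _ =>
          (hA n pt hx V).trans (Nat.pow_le_pow_right hA1
            ((card_le_univ V).trans_eq (Fintype.card_fin n)))
      _ = (2 * A) ^ n := by
          rw [sum_const, card_univ, Fintype.card_finset, Fintype.card_fin, smul_eq_mul, mul_pow]
  refine le_trans (le_trans (card_le_card ?_) (card_image_le (s := T) (f := F))) hTc
  intro f hf
  obtain ⟨good, lab, h, hlab, hcross, rfl⟩ := (mem_filter.1 hf).2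
  set r : Fin n → Fin n → Prop := fun i j => i ∈ good ∧ j ∈ good ∧ lab i = lab j with hr
  have hnc : IsNoncrossing pt good r := by
    refine ⟨fun u v h => h.1, fun v hv => ⟨hv, hv, rfl⟩, fun u v h => ⟨h.2.1, h.1, h.2.2.symm⟩,
      fun u v w h h' => ⟨h.1, h'.2.1, h.2.2.trans h'.2.2⟩, ?_⟩
    rintro a b c d z ⟨ha, hb, hab⟩ ⟨hc, hd, hcd⟩ hz hz'
    rw [hpt] at hz hz'
    beta_reduce at hz hz'
    rw [← shear_segment] at hz hz'
    obtain ⟨y, hy, rfl⟩ := hz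
    obtain ⟨y', hy', hyy⟩ := hz'
    obtain rfl := shear_injective t hyy
    exact ⟨ha, hc, hcross a ha b hb c hc d hd hab hcd _ hy hy'⟩
  have hL : IsLabelling good r M (someLabelling good r M) := by
    have hex : ∃ l, IsLabelling good r M l :=
      ⟨lab, hlab, fun i hi j hj => ⟨fun e => ⟨hi, hj, e⟩, fun e => e.2.2⟩⟩
    rw [someLabelling, dif_pos hex]
    exact hex.choose_spec
  set L := someLabelling good r M with hLdef
  set g : Fin M → Fin K := fun m =>
    if hm : ∃ i ∈ good, L i = m then h (lab hm.choose) else ⟨0, hK⟩ with hg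
  refine mem_image.2 ⟨(⟨good, r⟩, g), ?_, ?_⟩
  · rw [hT, mem_product]
    refine ⟨mem_sigma.2 ⟨mem_univ _, mem_filter.2 ⟨mem_univ _, hnc⟩⟩, mem_univ _⟩
  · funext i
    by_cases hi : i ∈ good
    · have hm : ∃ i' ∈ good, L i' = (⟨L i, hL.1 i hi⟩ : Fin M) := ⟨i, hi, rfl⟩
      have h1 : lab hm.choose = lab i :=
        ((hL.2 _ hm.choose_spec.1 _ hi).1 hm.choose_spec.2).2.2
      have e1 : F (⟨good, r⟩, g) i = some (g ⟨L i, hL.1 i hi⟩) := by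
        rw [hF]
        beta_reduce
        rw [if_pos hi, dif_pos (hL.1 i hi)]
      have e2 : g ⟨L i, hL.1 i hi⟩ = h (lab hm.choose) := dif_pos hm
      rw [e1, e2, labelColour, if_pos hi, h1]
    · rw [hF]
      beta_reduce
      rw [if_neg hi, labelColour, if_neg hi]

/-- The product of the factorials of the sizes of balanced classes. -/
theorem prod_factorial_classSize_le {j k : ℕ} (f : Fin n → Option (Fin (2 ^ j)))
    (hnone : classSize f univ none ≤ k) (hsome : ∀ i, 2 ^ j * classSize f univ (some i) ≤ 2 * n) :
    (2 ^ j) ^ n * ∏ i, (classSize f univ i).factorial ≤ (2 ^ j) ^ k * (2 * n) ^ n := by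
  have hsum : classSize f univ none + ∑ i, classSize f univ (some i) = n := by
    rw [← Fintype.sum_option (f := fun i => classSize f univ i)]
    have := card_eq_sum_card_fiberwise (s := (univ : Finset (Fin n))) (f := f) (t := univ)
      (fun _ _ => mem_coe.2 (mem_univ _))
    rw [card_univ, Fintype.card_fin] at this
    refine (sum_congr rfl fun i _ => ?_).trans this.symm
    unfold classSize
    congr
  have hfac : ∀ i, (2 ^ j) ^ classSize f univ (some i) * (classSize f univ (some i)).factorial ≤
      (2 * n) ^ classSize f univ (some i) := fun i =>
    (Nat.mul_le_mul_left _ (Nat.factorial_le_pow _)).trans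
      (by rw [← mul_pow]; exact Nat.pow_le_pow_left (hsome i) _)
  have hprod := prod_le_prod (s := univ) (fun i _ => Nat.zero_le _) fun i _ => hfac i
  rw [prod_mul_distrib, prod_pow_eq_pow_sum, prod_pow_eq_pow_sum] at hprod
  set s := ∑ i, classSize f univ (some i)
  set m := classSize f univ none
  rw [Fintype.prod_option]
  have hm : m.factorial ≤ (2 * n) ^ m :=
    (Nat.factorial_le_pow m).trans (Nat.pow_le_pow_left (by omega) m)
  calc (2 ^ j) ^ n * (m.factorial * ∏ i, (classSize f univ (some i)).factorial)
      = (2 ^ j) ^ m * m.factorial *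
        ((2 ^ j) ^ s * ∏ i, (classSize f univ (some i)).factorial) := by
        rw [show (2 ^ j) ^ n = (2 ^ j) ^ m * (2 ^ j) ^ s by rw [← pow_add, hsum]]; ring
    _ ≤ (2 ^ j) ^ k * (2 * n) ^ m * (2 * n) ^ s :=
        Nat.mul_le_mul (Nat.mul_le_mul (Nat.pow_le_pow_right (by positivity) hnone) hm) hprod
    _ = _ := by rw [mul_assoc, ← pow_add, hsum]

end Colourings

section Counting

theorem pow_self_le_three_pow_mul_factorial (n : ℕ) : n ^ n ≤ 3 ^ n * n.factorial := by
  have h1 := Real.pow_div_factorial_le_exp (n : ℝ) (Nat.cast_nonneg n) n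
  have h2 : Real.exp (n : ℝ) ≤ 3 ^ n := by
    rw [← mul_one (n : ℝ), Real.exp_nat_mul]
    exact pow_le_pow_left₀ (Real.exp_pos 1).le Real.exp_one_lt_three.le n
  have h3 : (0 : ℝ) < n.factorial := by exact_mod_cast n.factorial_pos
  have h4 := (div_le_iff₀ h3).1 (h1.trans h2)
  exact_mod_cast h4

theorem two_mul_pow_self_le_card_isPlanarGraph {n : ℕ} (hn : 0 < n) :
    (2 * n) ^ n ≤ 12 ^ n * Nat.card {G : SimpleGraph (Fin n) // IsPlanarGraph G} := by
  calc (2 * n) ^ n = 2 ^ n * n ^ n := mul_pow _ _ _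
    _ ≤ 2 ^ n * (3 ^ n * (n * Nat.card {G : SimpleGraph (Fin n) // IsPlanarGraph G})) :=
        Nat.mul_le_mul_left _ ((pow_self_le_three_pow_mul_factorial n).trans
          (Nat.mul_le_mul_left _ (factorial_le_mul_card_isPlanarGraph hn)))
    _ ≤ 2 ^ n * (3 ^ n * (2 ^ n * Nat.card {G : SimpleGraph (Fin n) // IsPlanarGraph G})) :=
        Nat.mul_le_mul_left _ (Nat.mul_le_mul_left _
          (Nat.mul_le_mul_right _ Nat.lt_two_pow_self.le))
    _ = _ := by
        rw [← mul_assoc, ← mul_assoc, ← mul_pow, ← mul_pow]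
        norm_num

theorem classSize_le_card {W ι : Type} {f : W → ι} {V T : Finset W} {i : ι}
    (h : ∀ v ∈ V, f v = i → v ∈ T) : classSize f V i ≤ T.card :=
  card_le_card fun v hv => h v (mem_filter.1 hv).1 (mem_filter.1 hv).2

theorem mem_sparseGraphs_univ {W ι : Type} [Fintype W] {f : W → ι} {z : ι} {k : ℕ}
    {G : SimpleGraph W} (h5 : ¬ HasCliqueMinor G 5) (hk : (crossPairs G f z).card ≤ k) :
    G ∈ sparseGraphs f z k univ :=
  mem_filter.2 ⟨mem_univ _, fun a _ _ => mem_univ a, h5, hk⟩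

/-- The number of graphs that have a drawing with few bends. -/
theorem exists_card_fewBends_le : ∃ A B C D : ℕ, ∀ (n : ℕ) (π : Fin n → ℝ × ℝ),
    Function.Injective π → ∀ (j q k : ℕ) (b : ℝ), 1 ≤ q → k = 10 * (2 ^ (j + 1) * (5 * q)) + 8 →
    3 * (5 * (b + 22 * n) + 2 * n + 14) ≤ (q : ℝ) * q →
    (2 ^ j) ^ n * Nat.card {G : SimpleGraph (Fin n) // IsPlanarGraph G ∧
        ∃ bends : Fin n → Fin n → List (ℝ × ℝ),
          IsPolylineDrawing G π bends ∧ totalBends G bends < b} ≤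
      (A * D) ^ n * (2 * n) ^ n *
        (B * (2 ^ j) ^ (2 * k) * (2 ^ j + 1) ^ (8 * ((2 ^ j + 1) * (C * k + 1)))) := by
  obtain ⟨C, D, B, hsparse⟩ := exists_card_sparseGraphs_le
  obtain ⟨A, hA⟩ := exists_card_isDrawnColouring_le
  refine ⟨A, B, C, D, fun n π hπ j q k b hq hk hb => ?_⟩
  set T : Finset (Fin n → Option (Fin (2 ^ j))) := univ.filter fun f =>
    IsDrawnColouring π k f ∧ classSize f univ none ≤ k ∧
      ∀ i, 2 ^ j * classSize f univ (some i) ≤ 2 * n with hT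
  have hTcard : T.card ≤ A ^ n * (2 ^ j) ^ k := by
    refine le_trans (card_le_card fun f hf => ?_) (hA n (2 ^ j) π hπ (by positivity) k)
    exact mem_filter.2 ⟨mem_univ _, (mem_filter.1 hf).2.1⟩
  have hcover : Nat.card {G : SimpleGraph (Fin n) // IsPlanarGraph G ∧
        ∃ bends : Fin n → Fin n → List (ℝ × ℝ),
          IsPolylineDrawing G π bends ∧ totalBends G bends < b} ≤
      ∑ f ∈ T, (sparseGraphs f none k univ).card := by
    refine le_trans ?_ card_biUnion_le
    rw [← Set.ncard_coe_finset]
    refine Set.ncard_le_ncard ?_ (Finset.finite_toSet _)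
    rintro G ⟨-, bends, hd, hbends⟩
    obtain ⟨x, good, lab, h, hx, hgood, hlab, hcross, hbal, hpairs⟩ :=
      hd.exists_labelColour hπ hq (le_trans (by linarith) hb) j
    rw [mem_coe, mem_biUnion]
    refine ⟨labelColour good lab h, ?_, ?_⟩
    · refine mem_filter.2 ⟨mem_univ _, ⟨good, lab, h, ?_, hcross, rfl⟩, ?_, ?_⟩
      · exact fun i hi => (hlab i hi).trans_le (by omega)
      · refine le_trans (classSize_le_card fun i _ hi => ?_) (hgood.trans (by omega))
        rw [mem_compl]
        intro hi'
        rw [labelColour, if_pos hi'] at hi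
        exact Option.some_ne_none _ hi
      · intro c
        refine le_trans (Nat.mul_le_mul_left _ (classSize_le_card fun i _ h1 => ?_)) (hbal c)
        rw [labelColour] at h1
        split_ifs at h1 with h2
        exact mem_filter.2 ⟨h2, Option.some_injective _ h1⟩
    · exact mem_sparseGraphs_univ hd.not_hasCliqueMinor (hpairs.trans (by omega))
  set e := 8 * ((2 ^ j + 1) * (C * k + 1)) with he
  have hone : ∀ f ∈ T, (2 ^ j) ^ n * (sparseGraphs f none k univ).card ≤
      B * (2 ^ j + 1) ^ e * D ^ n * ((2 ^ j) ^ k * (2 * n) ^ n) := by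
    intro f hf
    obtain ⟨-, h1, h2⟩ := (mem_filter.1 hf).2
    have h3 := hsparse (Fin n) (Option (Fin (2 ^ j))) f none k h1
    rw [Fintype.card_option, Fintype.card_fin, Fintype.card_fin] at h3
    calc (2 ^ j) ^ n * (sparseGraphs f none k univ).card
        ≤ (2 ^ j) ^ n * (B * (2 ^ j + 1) ^ e * D ^ n * ∏ i, (classSize f univ i).factorial) :=
          Nat.mul_le_mul_left _ h3
      _ = B * (2 ^ j + 1) ^ e * D ^ n * ((2 ^ j) ^ n * ∏ i, (classSize f univ i).factorial) := by
          ring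
      _ ≤ _ := Nat.mul_le_mul_left _ (prod_factorial_classSize_le f h1 h2)
  calc _ ≤ (2 ^ j) ^ n * ∑ f ∈ T, (sparseGraphs f none k univ).card :=
        Nat.mul_le_mul_left _ hcover
    _ = ∑ f ∈ T, (2 ^ j) ^ n * (sparseGraphs f none k univ).card := mul_sum _ _ _
    _ ≤ ∑ f ∈ T, B * (2 ^ j + 1) ^ e * D ^ n * ((2 ^ j) ^ k * (2 * n) ^ n) := sum_le_sum hone
    _ = T.card * (B * (2 ^ j + 1) ^ e * D ^ n * ((2 ^ j) ^ k * (2 * n) ^ n)) := by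
        rw [sum_const, smul_eq_mul]
    _ ≤ A ^ n * (2 ^ j) ^ k * (B * (2 ^ j + 1) ^ e * D ^ n * ((2 ^ j) ^ k * (2 * n) ^ n)) :=
        Nat.mul_le_mul_right _ hTcard
    _ = _ := by
        rw [mul_pow A, two_mul k, pow_add]
        ring

end Counting

/-- For every fixed injective vertex mapping, the number of planar graphs on `Fin n`
admitting a polyline drawing with fewer than `c·n²` total bends is at most a
`2^{-n}` fraction of all planar graphs on `Fin n`. -/
theorem few_bends_graphs_are_rare :
    ∃ c : ℝ, 0 < c ∧ ∃ N : ℕ, ∀ n : ℕ, N ≤ n →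
      ∀ π : Fin n → ℝ × ℝ, Function.Injective π →
      (Nat.card {G : SimpleGraph (Fin n) // IsPlanarGraph G ∧
          ∃ bends : Fin n → Fin n → List (ℝ × ℝ),
            IsPolylineDrawing G π bends ∧ totalBends G bends < c * (n : ℝ) ^ 2} : ℝ) ≤
        (2 : ℝ) ^ (-(n : ℤ)) *
          (Nat.card {G : SimpleGraph (Fin n) // IsPlanarGraph G} : ℝ) := by
  obtain ⟨A, B, C, D, hmain⟩ := exists_card_fewBends_le
  obtain ⟨j, hj⟩ : ∃ j, 96 * (A * D) ≤ 2 ^ j := ⟨_, Nat.lt_two_pow_self.le⟩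
  obtain ⟨E, hE⟩ : ∃ E, E = 2 * j + (j + 1) * (8 * ((2 ^ j + 1) * C)) := ⟨_, rfl⟩
  obtain ⟨F, hF⟩ : ∃ F, F = (j + 1) * (8 * (2 ^ j + 1)) := ⟨_, rfl⟩
  obtain ⟨L, hL⟩ : ∃ L, L = 100 * 2 ^ j * E + 1 := ⟨_, rfl⟩
  have hL1 : 1 ≤ L := by omega
  have hL0 : (0 : ℝ) < L := by exact_mod_cast hL1
  refine ⟨1 / (120 * (L : ℝ) ^ 2), by positivity, 3024 * L ^ 2 + B + 8 * E + F + 2 * L + 1, ?_⟩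
  intro n hn π hπ
  obtain ⟨q, hq⟩ : ∃ q, q = n / L := ⟨_, rfl⟩
  have hqn : L * q ≤ n := hq ▸ Nat.mul_div_le n L
  have hnq : n < L * q + L := by
    rw [hq]
    exact Nat.lt_mul_div_succ n hL1
  have hq1 : 1 ≤ q := by
    rw [hq]
    exact Nat.div_pos (by omega) hL1
  obtain ⟨k, hk⟩ : ∃ k, k = 10 * (2 ^ (j + 1) * (5 * q)) + 8 := ⟨_, rfl⟩
  have hb : 3 * (5 * (1 / (120 * (L : ℝ) ^ 2) * (n : ℝ) ^ 2 + 22 * n) + 2 * n + 14) ≤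
      (q : ℝ) * q := by
    have hn1 : (1 : ℝ) ≤ n := by exact_mod_cast (by omega : 1 ≤ n)
    have hn2 : 3024 * (L : ℝ) ^ 2 ≤ n := by exact_mod_cast (by omega : 3024 * L ^ 2 ≤ n)
    have hn3 : (n : ℝ) ≤ 2 * (L * q) := by
      exact_mod_cast (by omega : n ≤ 2 * (L * q))
    have h1 : (n : ℝ) ^ 2 ≤ 4 * (L : ℝ) ^ 2 * (q * q) := by nlinarith
    have h2 : 1 / (120 * (L : ℝ) ^ 2) * (n : ℝ) ^ 2 = (n : ℝ) ^ 2 / (8 * (L : ℝ) ^ 2) / 15 := by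
      field_simp
      norm_num
    have h3 : (n : ℝ) ^ 2 / (8 * (L : ℝ) ^ 2) ≤ q * q / 2 := by
      rw [div_le_iff₀ (by positivity)]
      linarith
    have h4 : 378 * (n : ℝ) ≤ (n : ℝ) ^ 2 / (8 * (L : ℝ) ^ 2) := by
      rw [le_div_iff₀ (by positivity)]
      nlinarith
    rw [h2]
    linarith
  have hexp : B * (2 ^ j) ^ (2 * k) * (2 ^ j + 1) ^ (8 * ((2 ^ j + 1) * (C * k + 1))) ≤ 4 ^ n := by
    have h1 : 2 ^ j + 1 ≤ 2 ^ (j + 1) := by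
      rw [pow_succ]
      have : 1 ≤ 2 ^ j := Nat.one_le_two_pow
      omega
    calc _ ≤ 2 ^ B * (2 ^ j) ^ (2 * k) * (2 ^ (j + 1)) ^ (8 * ((2 ^ j + 1) * (C * k + 1))) :=
          Nat.mul_le_mul (Nat.mul_le_mul_right _ Nat.lt_two_pow_self.le) (Nat.pow_le_pow_left h1 _)
      _ = 2 ^ (B + j * (2 * k) + (j + 1) * (8 * ((2 ^ j + 1) * (C * k + 1)))) := by
          rw [← pow_mul, ← pow_mul, ← pow_add, ← pow_add]
      _ ≤ 2 ^ (2 * n) := by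
          refine Nat.pow_le_pow_right (by norm_num) ?_
          have e1 : B + j * (2 * k) + (j + 1) * (8 * ((2 ^ j + 1) * (C * k + 1))) =
              B + F + E * k := by
            rw [hE, hF]
            ring
          have e2 : E * k + q = L * q + 8 * E := by
            rw [hk, hL, pow_succ]
            ring
          rw [e1]
          omega
      _ = 4 ^ n := by rw [pow_mul]; norm_num
  set X := Nat.card {G : SimpleGraph (Fin n) // IsPlanarGraph G ∧
    ∃ bends : Fin n → Fin n → List (ℝ × ℝ), IsPolylineDrawing G π bends ∧
      totalBends G bends < 1 / (120 * (L : ℝ) ^ 2) * (n : ℝ) ^ 2}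
  have hX := hmain n π hπ j q k _ hq1 hk hb
  have hY := two_mul_pow_self_le_card_isPlanarGraph (show 0 < n by omega)
  set Y := Nat.card {G : SimpleGraph (Fin n) // IsPlanarGraph G}
  have hXY : (2 ^ j) ^ n * (2 ^ n * X) ≤ (2 ^ j) ^ n * Y := by
    calc (2 ^ j) ^ n * (2 ^ n * X) = 2 ^ n * ((2 ^ j) ^ n * X) := by ring
      _ ≤ 2 ^ n * ((A * D) ^ n * (12 ^ n * Y) * 4 ^ n) :=
          Nat.mul_le_mul_left _ (hX.trans (Nat.mul_le_mul (Nat.mul_le_mul_left _ hY) hexp))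
      _ = (96 * (A * D)) ^ n * Y := by
          rw [mul_pow 96, show 96 = 2 * (12 * 4) by norm_num, mul_pow 2, mul_pow 12]
          ac_rfl
      _ ≤ (2 ^ j) ^ n * Y := Nat.mul_le_mul_right _ (Nat.pow_le_pow_left hj n)
  have hfin : 2 ^ n * X ≤ Y := Nat.le_of_mul_le_mul_left hXY (by positivity)
  have hfin' : (2 : ℝ) ^ n * X ≤ Y := by exact_mod_cast hfin
  rw [zpow_neg, zpow_natCast, inv_mul_eq_div, le_div_iff₀ (by positivity)]
  linarith
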